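/- arXiv:1509.02717 — 3 statements merged into one kernel-verified Lean document; each statement's English description precedes it below -/
import Mathlib

section
/- Let G_a, G_b, G_c be nontrivial cyclic groups with generators a, b, c respectively, and let w be an element of the free product G_a*G_b*G_c whose exponent sum in each of the generators a, b, c is non-zero modulo the order of that generator (equivalently: for each factor, the image of w under the canonical retraction of G_a*G_b*G_c onto that factor, killing the other two factors, is nontrivial). Then each of the natural maps G_a → G, G_b → G, G_c → G is injective, where G = (G_a*G_b*G_c)/N(w). -/
open Monoid

/-- The canonical retraction of an indexed free product onto its `i`-th factor,
killing all the other factors. -/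
noncomputable def CoprodI.retract {ι : Type*} {G : ι → Type*} [∀ i, Group (G i)] (i : ι) :
    Monoid.CoprodI G →* G i :=
  letI := Classical.decEq ι
  Monoid.CoprodI.lift fun j =>
    if h : j = i then (by subst h; exact MonoidHom.id (G j)) else (1 : G j →* G i)

namespace OneRel
open MeasureTheory Set
open scoped ContDiff

/-- Partial derivative in the `i`-th coordinate. -/
noncomputable def pd {m : ℕ} (i : Fin m) (f : (Fin m → ℝ) → ℝ) (x : Fin m → ℝ) : ℝ :=
  fderiv ℝ f x (Pi.single i 1)

lemma pd_contDiff {m : ℕ} (i : Fin m) {f : (Fin m → ℝ) → ℝ} (hf : ContDiff ℝ ∞ f) :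
    ContDiff ℝ ∞ (pd i f) := by
  have h : ContDiff ℝ ∞ (fderiv ℝ f) := hf.fderiv_right (by simp)
  exact h.clm_apply contDiff_const

lemma pd_comm {m : ℕ} (i j : Fin m) {f : (Fin m → ℝ) → ℝ} (hf : ContDiff ℝ ∞ f)
    (x : Fin m → ℝ) : pd i (pd j f) x = pd j (pd i f) x := by
  have h : ContDiff ℝ ∞ (fderiv ℝ f) := hf.fderiv_right (by simp)
  have key : ∀ i j : Fin m, pd i (pd j f) x
      = fderiv ℝ (fderiv ℝ f) x (Pi.single i 1) (Pi.single j 1) := by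
    intro i j
    unfold pd
    rw [fderiv_clm_apply (h.differentiable (by simp) x) (differentiableAt_const _)]
    simp
  rw [key, key]
  apply (hf.contDiffAt.isSymmSndFDerivAt _).eq
  rw [minSmoothness_of_isRCLikeNormedField]
  exact WithTop.coe_le_coe.2 le_top

lemma pd_line {m : ℕ} (i : Fin m) {f : (Fin m → ℝ) → ℝ} (hf : ContDiff ℝ ∞ f)
    (x : Fin m → ℝ) : pd i f x = deriv (fun r : ℝ => f (x + r • Pi.single i 1)) 0 := by
  have := (hf.differentiable (by simp) x).lineDeriv_eq_fderiv (v := Pi.single i (1:ℝ))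
  unfold pd
  rw [← this]; rfl

lemma pd_mul {m : ℕ} (i : Fin m) {f g : (Fin m → ℝ) → ℝ} (hf : ContDiff ℝ ∞ f)
    (hg : ContDiff ℝ ∞ g) (x : Fin m → ℝ) :
    pd i (fun y => f y * g y) x = pd i f x * g x + f x * pd i g x := by
  unfold pd
  rw [fderiv_fun_mul (hf.differentiable (by simp) x) (hg.differentiable (by simp) x)]
  simp; ring

lemma pd_add {m : ℕ} (i : Fin m) {f g : (Fin m → ℝ) → ℝ} (hf : ContDiff ℝ ∞ f)
    (hg : ContDiff ℝ ∞ g) (x : Fin m → ℝ) :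
    pd i (fun y => f y + g y) x = pd i f x + pd i g x := by
  unfold pd
  rw [fderiv_fun_add (hf.differentiable (by simp) x) (hg.differentiable (by simp) x)]
  simp

lemma pd_sub {m : ℕ} (i : Fin m) {f g : (Fin m → ℝ) → ℝ} (hf : ContDiff ℝ ∞ f)
    (hg : ContDiff ℝ ∞ g) (x : Fin m → ℝ) :
    pd i (fun y => f y - g y) x = pd i f x - pd i g x := by
  unfold pd
  rw [fderiv_fun_sub (hf.differentiable (by simp) x) (hg.differentiable (by simp) x)]
  simp

/-- Determinant of three vector fields. -/
def det3 {X : Type*} (a b c : Fin 3 → X → ℝ) (x : X) : ℝ :=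
  a 0 x * (b 1 x * c 2 x - b 2 x * c 1 x) + a 1 x * (b 2 x * c 0 x - b 0 x * c 2 x)
    + a 2 x * (b 0 x * c 1 x - b 1 x * c 0 x)

lemma det3_contDiff {m : ℕ} {a b c : Fin 3 → (Fin m → ℝ) → ℝ} (ha : ∀ k, ContDiff ℝ ∞ (a k))
    (hb : ∀ k, ContDiff ℝ ∞ (b k)) (hc : ∀ k, ContDiff ℝ ∞ (c k)) :
    ContDiff ℝ ∞ (det3 a b c) := by
  unfold det3
  have := ha 0; have := ha 1; have := ha 2
  have := hb 0; have := hb 1; have := hb 2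
  have := hc 0; have := hc 1; have := hc 2
  fun_prop

lemma pd_det3 {m : ℕ} (i : Fin m) {a b c : Fin 3 → (Fin m → ℝ) → ℝ}
    (ha : ∀ k, ContDiff ℝ ∞ (a k))
    (hb : ∀ k, ContDiff ℝ ∞ (b k)) (hc : ∀ k, ContDiff ℝ ∞ (c k)) (x : Fin m → ℝ) :
    pd i (det3 a b c) x = det3 (fun k => pd i (a k)) b c x + det3 a (fun k => pd i (b k)) c x
      + det3 a b (fun k => pd i (c k)) x := by
  have := ha 0; have := ha 1; have := ha 2
  have := hb 0; have := hb 1; have := hb 2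
  have := hc 0; have := hc 1; have := hc 2
  unfold det3
  rw [pd_add _ (by fun_prop) (by fun_prop), pd_add _ (by fun_prop) (by fun_prop),
    pd_mul _ (by fun_prop) (by fun_prop), pd_mul _ (by fun_prop) (by fun_prop),
    pd_mul _ (by fun_prop) (by fun_prop), pd_sub _ (by fun_prop) (by fun_prop),
    pd_sub _ (by fun_prop) (by fun_prop), pd_sub _ (by fun_prop) (by fun_prop),
    pd_mul _ (by fun_prop) (by fun_prop), pd_mul _ (by fun_prop) (by fun_prop),
    pd_mul _ (by fun_prop) (by fun_prop), pd_mul _ (by fun_prop) (by fun_prop),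
    pd_mul _ (by fun_prop) (by fun_prop), pd_mul _ (by fun_prop) (by fun_prop)]
  ring

/-- The differential of a unit vector field is orthogonal to the field. -/
lemma pd_orth {m : ℕ} {n : Fin 3 → (Fin m → ℝ) → ℝ} (hn : ∀ k, ContDiff ℝ ∞ (n k))
    (h1 : ∀ x, n 0 x * n 0 x + n 1 x * n 1 x + n 2 x * n 2 x = 1) (i : Fin m) (x : Fin m → ℝ) :
    n 0 x * pd i (n 0) x + n 1 x * pd i (n 1) x + n 2 x * pd i (n 2) x = 0 := by
  have := hn 0; have := hn 1; have := hn 2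
  have h : pd i (fun x => n 0 x * n 0 x + n 1 x * n 1 x + n 2 x * n 2 x) x = 0 := by
    simp only [h1]; simp [pd]
  rw [pd_add _ (by fun_prop) (by fun_prop), pd_add _ (by fun_prop) (by fun_prop),
    pd_mul _ (by fun_prop) (by fun_prop), pd_mul _ (by fun_prop) (by fun_prop),
    pd_mul _ (by fun_prop) (by fun_prop)] at h
  linarith

lemma det3_eq_zero {X : Type*} (n a b c : Fin 3 → X → ℝ) (x : X)
    (h1 : n 0 x * n 0 x + n 1 x * n 1 x + n 2 x * n 2 x = 1)
    (ha : n 0 x * a 0 x + n 1 x * a 1 x + n 2 x * a 2 x = 0)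
    (hb : n 0 x * b 0 x + n 1 x * b 1 x + n 2 x * b 2 x = 0)
    (hc : n 0 x * c 0 x + n 1 x * c 1 x + n 2 x * c 2 x = 0) : det3 a b c x = 0 := by
  have e0 : n 0 x * det3 a b c x = 0 := by
    unfold det3
    linear_combination (b 1 x * c 2 x - b 2 x * c 1 x) * ha
      + (c 1 x * a 2 x - c 2 x * a 1 x) * hb + (a 1 x * b 2 x - a 2 x * b 1 x) * hc
  have e1 : n 1 x * det3 a b c x = 0 := by
    unfold det3
    linear_combination (b 2 x * c 0 x - b 0 x * c 2 x) * ha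
      + (c 2 x * a 0 x - c 0 x * a 2 x) * hb + (a 2 x * b 0 x - a 0 x * b 2 x) * hc
  have e2 : n 2 x * det3 a b c x = 0 := by
    unfold det3
    linear_combination (b 0 x * c 1 x - b 1 x * c 0 x) * ha
      + (c 0 x * a 1 x - c 1 x * a 0 x) * hb + (a 0 x * b 1 x - a 1 x * b 0 x) * hc
  linear_combination n 0 x * e0 + n 1 x * e1 + n 2 x * e2 - det3 a b c x * h1

/-- The vector field dual to the pulled back area form. -/
noncomputable def fieldV (n : Fin 3 → (Fin 3 → ℝ) → ℝ) (i : Fin 3) : (Fin 3 → ℝ) → ℝ :=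
  det3 n (fun k => pd (i + 1) (n k)) (fun k => pd (i + 2) (n k))

lemma fieldV_contDiff {n : Fin 3 → (Fin 3 → ℝ) → ℝ} (hn : ∀ k, ContDiff ℝ ∞ (n k)) (i : Fin 3) :
    ContDiff ℝ ∞ (fieldV n i) :=
  det3_contDiff hn (fun k => pd_contDiff _ (hn k)) (fun k => pd_contDiff _ (hn k))

lemma fieldV_div {n : Fin 3 → (Fin 3 → ℝ) → ℝ} (hn : ∀ k, ContDiff ℝ ∞ (n k))
    (h1 : ∀ x, n 0 x * n 0 x + n 1 x * n 1 x + n 2 x * n 2 x = 1) (x : Fin 3 → ℝ) :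
    ∑ i, pd i (fieldV n i) x = 0 := by
  have hz : det3 (fun k => pd 0 (n k)) (fun k => pd 1 (n k)) (fun k => pd 2 (n k)) x = 0 :=
    det3_eq_zero n _ _ _ x (h1 x) (pd_orth hn h1 0 x) (pd_orth hn h1 1 x) (pd_orth hn h1 2 x)
  have hd : ∀ i j k, pd i (pd j (n k)) x = pd j (pd i (n k)) x := fun i j k => pd_comm i j (hn k) x
  have t0 : fieldV n 0 = det3 n (fun k => pd 1 (n k)) (fun k => pd 2 (n k)) := rfl
  have t1 : fieldV n 1 = det3 n (fun k => pd 2 (n k)) (fun k => pd 0 (n k)) := rfl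
  have t2 : fieldV n 2 = det3 n (fun k => pd 0 (n k)) (fun k => pd 1 (n k)) := rfl
  have c := fun i (k : Fin 3) => pd_contDiff i (hn k)
  rw [Fin.sum_univ_three, t0, t1, t2, pd_det3 _ hn (c _) (c _), pd_det3 _ hn (c _) (c _),
    pd_det3 _ hn (c _) (c _)]
  unfold det3 at *
  simp only [hd 1 0, hd 2 0, hd 2 1]
  linear_combination 3 * hz

lemma pd_translate {m : ℕ} (i : Fin m) {f : (Fin m → ℝ) → ℝ} (v : Fin m → ℝ)
    (h : ∀ x, f (x + v) = f x) (x : Fin m → ℝ) : pd i f (x + v) = pd i f x := by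
  unfold pd
  rw [← fderiv_comp_add_right]
  simp only [h]

/-- Integral of the derivative along a face. -/
lemma face_integral {f : (Fin 3 → ℝ) → ℝ} (hf : ContDiff ℝ ∞ f) (s : ℝ)
    (hpole : ∀ x : Fin 3 → ℝ, (x 2 = 0 ∨ x 2 = Real.pi) → ∀ r : ℝ,
      f (x + r • Pi.single 1 1) = f x) :
    ∫ y in Icc (0 : Fin 2 → ℝ) ![2 * Real.pi, Real.pi], pd 2 f (Fin.insertNth 0 s y)
      = (f ![s, 0, Real.pi] - f ![s, 0, 0]) * (2 * Real.pi) := by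
  have hins : ∀ y : Fin 2 → ℝ, (Fin.insertNth 0 s y : Fin 3 → ℝ)
      = s • Pi.single 0 1 + y 0 • Pi.single 1 1 + y 1 • Pi.single 2 1 := by
    intro y; ext j; fin_cases j
    · simp
    · simp
    · simp; rfl
  set g : (Fin 2 → ℝ) → ℝ := fun y => f (Fin.insertNth 0 s y : Fin 3 → ℝ) with hg
  have hgc : ContDiff ℝ ∞ g := by
    simp only [hg, hins]
    fun_prop
  have hpd : ∀ y, pd 2 f (Fin.insertNth 0 s y : Fin 3 → ℝ) = pd 1 g y := by
    intro y
    rw [pd_line _ hf, pd_line _ hgc]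
    congr 1
    ext r
    simp only [hg]
    congr 1
    rw [hins, hins]
    ext j; fin_cases j <;> simp
  simp only [hpd]
  have hdiv := integral_divergence_of_hasFDerivAt_off_countable' (E := ℝ) (0 : Fin 2 → ℝ)
    ![2 * Real.pi, Real.pi] (by intro j; fin_cases j <;> simp [Real.pi_pos.le])
    ![fun _ => 0, g] ![fun _ => 0, fun y => fderiv ℝ g y] ∅ countable_empty
    (by
      intro i; fin_cases i
      · exact continuousOn_const
      · exact hgc.continuous.continuousOn)
    (by
      intro x _ i; fin_cases i
      · exact hasFDerivAt_const _ _
      · exact (hgc.differentiable (by simp) x).hasFDerivAt)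
    (by
      have : Continuous (pd 1 g) := (pd_contDiff 1 hgc).continuous
      refine (Continuous.continuousOn ?_).integrableOn_compact isCompact_Icc
      convert this using 2 with y
      rw [Fin.sum_univ_succ]
      simp [pd])
  have hL : ∀ y, ∑ i, (![fun _ => 0, fun y => fderiv ℝ g y] :
      Fin 2 → (Fin 2 → ℝ) → (Fin 2 → ℝ) →L[ℝ] ℝ) i y (Pi.single i 1) = pd 1 g y := by
    intro y; simp [pd]
  simp only [hL] at hdiv
  rw [hdiv, Fin.sum_univ_two]
  have hconst : ∀ (z : Fin 1 → ℝ) (p : ℝ), (p = 0 ∨ p = Real.pi) →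
      g (Fin.insertNth 1 p z : Fin 2 → ℝ) = f ![s, 0, p] := by
    intro z p hp
    have := hpole ![s, 0, p] (by simpa using hp) (z 0)
    rw [← this]
    simp only [hg]
    congr 1
    ext j; fin_cases j
    · simp
    · simp [Fin.insertNth, Fin.succAboveCases]
    · simp [Fin.insertNth, Fin.succAboveCases]
  have hm : (volume : Measure (Fin 1 → ℝ)).real
      (Icc ((0 : Fin 2 → ℝ) ∘ Fin.succAbove 1) (![2 * Real.pi, Real.pi] ∘ Fin.succAbove 1))
      = 2 * Real.pi := by
    rw [Measure.real, Real.volume_Icc_pi]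
    simp [Real.pi_pos.le]
  simp only [Matrix.cons_val_zero, Matrix.cons_val_one, Pi.zero_apply, integral_zero, sub_self,
    zero_add]
  simp only [hconst _ Real.pi (Or.inr rfl), hconst _ 0 (Or.inl rfl), setIntegral_const, hm]
  simp only [smul_eq_mul]
  ring

/-- Homotopy invariance of degree, in the form we need. -/
theorem degree_lemma {n : Fin 3 → (Fin 3 → ℝ) → ℝ} (hn : ∀ k, ContDiff ℝ ∞ (n k))
    (h1 : ∀ x, n 0 x * n 0 x + n 1 x * n 1 x + n 2 x * n 2 x = 1)
    (hper : ∀ k x, n k (x + (2 * Real.pi) • Pi.single 1 1) = n k x)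
    (hpole : ∀ k, ∀ x : Fin 3 → ℝ, (x 2 = 0 ∨ x 2 = Real.pi) → ∀ r : ℝ,
      n k (x + r • Pi.single 1 1) = n k x)
    (hrot : ∀ x : Fin 3 → ℝ, (x 0 = 0 ∨ x 0 = 1) → ∀ r : ℝ,
      n 0 (x + r • Pi.single 1 1) = Real.cos r * n 0 x - Real.sin r * n 1 x ∧
      n 1 (x + r • Pi.single 1 1) = Real.sin r * n 0 x + Real.cos r * n 1 x ∧
      n 2 (x + r • Pi.single 1 1) = n 2 x) :
    n 2 ![0, 0, Real.pi] - n 2 ![0, 0, 0] = n 2 ![1, 0, Real.pi] - n 2 ![1, 0, 0] := by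
  have hc := fieldV_contDiff hn
  have hdiv := integral_divergence_of_hasFDerivAt_off_countable' (E := ℝ) (0 : Fin 3 → ℝ)
    ![1, 2 * Real.pi, Real.pi] (by intro j; fin_cases j <;> simp [Real.pi_pos.le])
    (fieldV n) (fun i x => fderiv ℝ (fieldV n i) x) ∅ countable_empty
    (fun i => (hc i).continuous.continuousOn)
    (fun x _ i => ((hc i).differentiable (by simp) x).hasFDerivAt)
    (by
      have : (fun x => ∑ i, (fderiv ℝ (fieldV n i) x) (Pi.single i 1)) = fun _ => 0 := by
        funext x; exact fieldV_div hn h1 x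
      rw [this]
      exact integrableOn_zero)
  have hz : ∀ x, ∑ i, (fderiv ℝ (fieldV n i) x) (Pi.single i 1) = 0 := fieldV_div hn h1
  simp only [hz, integral_zero] at hdiv
  rw [Fin.sum_univ_three] at hdiv
  -- the `θ` faces
  have f1 : ∀ y : Fin 2 → ℝ, fieldV n 1 (Fin.insertNth 1 (2 * Real.pi) y : Fin 3 → ℝ)
      = fieldV n 1 (Fin.insertNth 1 0 y : Fin 3 → ℝ) := by
    intro y
    have : (Fin.insertNth 1 (2 * Real.pi) y : Fin 3 → ℝ)
        = Fin.insertNth 1 0 y + (2 * Real.pi) • Pi.single 1 1 := by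
      ext j; fin_cases j <;> simp [Fin.insertNth, Fin.succAboveCases]
    rw [this]
    unfold fieldV det3
    simp only [hper, pd_translate _ _ (hper _)]
  -- the `φ` faces
  have f2 : ∀ (y : Fin 2 → ℝ) (p : ℝ), (p = 0 ∨ p = Real.pi) →
      fieldV n 2 (Fin.insertNth 2 p y : Fin 3 → ℝ) = 0 := by
    intro y p hp
    have h0 : ∀ k, pd 1 (n k) (Fin.insertNth 2 p y : Fin 3 → ℝ) = 0 := by
      intro k
      rw [pd_line _ (hn k)]
      have : (Fin.insertNth 2 p y : Fin 3 → ℝ) 2 = p := by simp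
      simp only [hpole k (Fin.insertNth 2 p y : Fin 3 → ℝ) (by rw [this]; exact hp)]
      simp
    have t2 : fieldV n 2 = det3 n (fun k => pd 0 (n k)) (fun k => pd 1 (n k)) := rfl
    rw [t2]
    simp [det3, h0]
  -- the `s` faces
  have f0 : ∀ (y : Fin 2 → ℝ) (s : ℝ), (s = 0 ∨ s = 1) →
      fieldV n 0 (Fin.insertNth 0 s y : Fin 3 → ℝ) = pd 2 (n 2) (Fin.insertNth 0 s y) := by
    intro y s hs
    set x : Fin 3 → ℝ := Fin.insertNth 0 s y with hx
    have hx0 : x 0 = 0 ∨ x 0 = 1 := by simpa [hx] using hs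
    have a0 : pd 1 (n 0) x = - n 1 x := by
      rw [pd_line _ (hn 0)]
      simp only [(hrot x hx0 _).1]
      have : HasDerivAt (fun r => Real.cos r * n 0 x - Real.sin r * n 1 x)
        (-Real.sin 0 * n 0 x - Real.cos 0 * n 1 x) 0 :=
        ((Real.hasDerivAt_cos 0).mul_const _).sub ((Real.hasDerivAt_sin 0).mul_const _)
      rw [this.deriv]; simp
    have a1 : pd 1 (n 1) x = n 0 x := by
      rw [pd_line _ (hn 1)]
      simp only [(hrot x hx0 _).2.1]
      have : HasDerivAt (fun r => Real.sin r * n 0 x + Real.cos r * n 1 x)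
        (Real.cos 0 * n 0 x + -Real.sin 0 * n 1 x) 0 :=
        ((Real.hasDerivAt_sin 0).mul_const _).add ((Real.hasDerivAt_cos 0).mul_const _)
      rw [this.deriv]; simp
    have a2 : pd 1 (n 2) x = 0 := by
      rw [pd_line _ (hn 2)]
      simp only [(hrot x hx0 _).2.2]
      simp
    have t0 : fieldV n 0 = det3 n (fun k => pd 1 (n k)) (fun k => pd 2 (n k)) := rfl
    rw [t0]
    have ho := pd_orth hn h1 2 x
    have hu := h1 x
    simp only [det3, a0, a1, a2]
    linear_combination (-n 2 x) * ho + pd 2 (n 2) x * hu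
  have g0 : ((0 : Fin 3 → ℝ) ∘ Fin.succAbove 0) = (0 : Fin 2 → ℝ) := rfl
  have g1 : ((![1, 2 * Real.pi, Real.pi] : Fin 3 → ℝ) ∘ Fin.succAbove 0)
      = ![2 * Real.pi, Real.pi] := by
    ext j; fin_cases j <;> rfl
  have u0 : (![1, 2 * Real.pi, Real.pi] : Fin 3 → ℝ) 0 = 1 := rfl
  have u1 : (![1, 2 * Real.pi, Real.pi] : Fin 3 → ℝ) 1 = 2 * Real.pi := rfl
  have u2 : (![1, 2 * Real.pi, Real.pi] : Fin 3 → ℝ) 2 = Real.pi := rfl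
  rw [u0, u1, u2, g0, g1] at hdiv
  simp only [Pi.zero_apply, f1, f2 _ _ (Or.inl rfl), f2 _ _ (Or.inr rfl), f0 _ _ (Or.inl rfl),
    f0 _ _ (Or.inr rfl), sub_self, add_zero, face_integral (hn 2) _ (hpole 2)] at hdiv
  have := Real.pi_pos
  have h2 : (2 * Real.pi) ≠ 0 := by positivity
  apply mul_right_cancel₀ h2
  linarith

end OneRel

namespace OneRel
open scoped ContDiff Quaternion

/-! ### Unit quaternions -/

/-- `c + s u`, where `u` is the unit vector with polar coordinates `θ`, `φ`. -/
noncomputable def quv (c s θ φ : ℝ) : ℍ[ℝ] :=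
  ⟨c, s * (Real.sin φ * Real.cos θ), s * (Real.sin φ * Real.sin θ), s * Real.cos φ⟩

lemma quv_re (c s θ φ : ℝ) : (quv c s θ φ).re = c := rfl
lemma quv_imI (c s θ φ : ℝ) : (quv c s θ φ).imI = s * (Real.sin φ * Real.cos θ) := rfl
lemma quv_imJ (c s θ φ : ℝ) : (quv c s θ φ).imJ = s * (Real.sin φ * Real.sin θ) := rfl
lemma quv_imK (c s θ φ : ℝ) : (quv c s θ φ).imK = s * Real.cos φ := rfl

/-- `cos τ + sin τ u` as a unit of the quaternion algebra. -/
noncomputable def qu (τ θ φ : ℝ) : ℍ[ℝ]ˣ where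
  val := quv (Real.cos τ) (Real.sin τ) θ φ
  inv := quv (Real.cos τ) (-Real.sin τ) θ φ
  val_inv := by
    have h1 := Real.sin_sq_add_cos_sq τ
    have h2 := Real.sin_sq_add_cos_sq θ
    have h3 := Real.sin_sq_add_cos_sq φ
    ext
    · simp only [Quaternion.re_mul, Quaternion.re_one, quv_re, quv_imI, quv_imJ, quv_imK]
      linear_combination h1 + Real.sin τ ^ 2 * Real.sin φ ^ 2 * h2 + Real.sin τ ^ 2 * h3
    · simp only [Quaternion.imI_mul, Quaternion.imI_one, quv_re, quv_imI, quv_imJ, quv_imK]; ring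
    · simp only [Quaternion.imJ_mul, Quaternion.imJ_one, quv_re, quv_imI, quv_imJ, quv_imK]; ring
    · simp only [Quaternion.imK_mul, Quaternion.imK_one, quv_re, quv_imI, quv_imJ, quv_imK]; ring
  inv_val := by
    have h1 := Real.sin_sq_add_cos_sq τ
    have h2 := Real.sin_sq_add_cos_sq θ
    have h3 := Real.sin_sq_add_cos_sq φ
    ext
    · simp only [Quaternion.re_mul, Quaternion.re_one, quv_re, quv_imI, quv_imJ, quv_imK]
      linear_combination h1 + Real.sin τ ^ 2 * Real.sin φ ^ 2 * h2 + Real.sin τ ^ 2 * h3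
    · simp only [Quaternion.imI_mul, Quaternion.imI_one, quv_re, quv_imI, quv_imJ, quv_imK]; ring
    · simp only [Quaternion.imJ_mul, Quaternion.imJ_one, quv_re, quv_imI, quv_imJ, quv_imK]; ring
    · simp only [Quaternion.imK_mul, Quaternion.imK_one, quv_re, quv_imI, quv_imJ, quv_imK]; ring

lemma qu_re (τ θ φ : ℝ) : (qu τ θ φ : ℍ[ℝ]).re = Real.cos τ := rfl
lemma qu_imI (τ θ φ : ℝ) :
    (qu τ θ φ : ℍ[ℝ]).imI = Real.sin τ * (Real.sin φ * Real.cos θ) := rfl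
lemma qu_imJ (τ θ φ : ℝ) :
    (qu τ θ φ : ℍ[ℝ]).imJ = Real.sin τ * (Real.sin φ * Real.sin θ) := rfl
lemma qu_imK (τ θ φ : ℝ) : (qu τ θ φ : ℍ[ℝ]).imK = Real.sin τ * Real.cos φ := rfl
lemma qui_re (τ θ φ : ℝ) : (((qu τ θ φ)⁻¹ : ℍ[ℝ]ˣ) : ℍ[ℝ]).re = Real.cos τ := rfl
lemma qui_imI (τ θ φ : ℝ) :
    (((qu τ θ φ)⁻¹ : ℍ[ℝ]ˣ) : ℍ[ℝ]).imI = -Real.sin τ * (Real.sin φ * Real.cos θ) := rfl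
lemma qui_imJ (τ θ φ : ℝ) :
    (((qu τ θ φ)⁻¹ : ℍ[ℝ]ˣ) : ℍ[ℝ]).imJ = -Real.sin τ * (Real.sin φ * Real.sin θ) := rfl
lemma qui_imK (τ θ φ : ℝ) :
    (((qu τ θ φ)⁻¹ : ℍ[ℝ]ˣ) : ℍ[ℝ]).imK = -Real.sin τ * Real.cos φ := rfl

/-- One-parameter subgroup. -/
noncomputable def quHom (θ φ : ℝ) : Multiplicative ℝ →* ℍ[ℝ]ˣ where
  toFun τ := qu τ.toAdd θ φ
  map_one' := by
    ext <;> simp [qu_re, qu_imI, qu_imJ, qu_imK]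
  map_mul' x y := by
    have h2 := Real.sin_sq_add_cos_sq θ
    have h3 := Real.sin_sq_add_cos_sq φ
    ext
    · simp only [Units.val_mul, Quaternion.re_mul, qu_re, qu_imI, qu_imJ, qu_imK, toAdd_mul,
        Real.cos_add]
      linear_combination Real.sin x.toAdd * Real.sin y.toAdd * h3
        + Real.sin x.toAdd * Real.sin y.toAdd * Real.sin φ ^ 2 * h2
    · simp only [Units.val_mul, Quaternion.imI_mul, qu_re, qu_imI, qu_imJ, qu_imK, toAdd_mul,
        Real.sin_add]
      ring
    · simp only [Units.val_mul, Quaternion.imJ_mul, qu_re, qu_imI, qu_imJ, qu_imK, toAdd_mul,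
        Real.sin_add]
      ring
    · simp only [Units.val_mul, Quaternion.imK_mul, qu_re, qu_imI, qu_imJ, qu_imK, toAdd_mul,
        Real.sin_add]
      ring

lemma qu_eq_quHom (τ θ φ : ℝ) : qu τ θ φ = quHom θ φ (Multiplicative.ofAdd τ) := rfl

lemma qu_zpow (τ θ φ : ℝ) (k : ℤ) : qu τ θ φ ^ k = qu (k * τ) θ φ := by
  rw [qu_eq_quHom, ← map_zpow, ← ofAdd_zsmul, qu_eq_quHom, zsmul_eq_mul]

lemma qu_pi (τ θ : ℝ) : qu τ θ Real.pi = qu (-τ) 0 0 := by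
  ext <;> simp [qu_re, qu_imI, qu_imJ, qu_imK]

lemma qu_zero (τ θ : ℝ) : qu τ θ 0 = qu τ 0 0 := by
  ext <;> simp [qu_re, qu_imI, qu_imJ, qu_imK]

lemma qu_comm (τ τ' : ℝ) : qu τ' 0 0 * qu τ 0 0 * (qu τ' 0 0)⁻¹ = qu τ 0 0 := by
  rw [mul_inv_eq_iff_eq_mul, qu_eq_quHom, qu_eq_quHom, ← map_mul (quHom 0 0),
    ← map_mul (quHom 0 0), mul_comm]

/-- The imaginary part transforms by rotation under conjugation. -/
lemma conj_rot (r : ℝ) (q : ℍ[ℝ]ˣ) :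
    ((qu (r / 2) 0 0 * q * (qu (r / 2) 0 0)⁻¹ : ℍ[ℝ]ˣ) : ℍ[ℝ]).imI
      = Real.cos r * (q : ℍ[ℝ]).imI - Real.sin r * (q : ℍ[ℝ]).imJ ∧
    ((qu (r / 2) 0 0 * q * (qu (r / 2) 0 0)⁻¹ : ℍ[ℝ]ˣ) : ℍ[ℝ]).imJ
      = Real.sin r * (q : ℍ[ℝ]).imI + Real.cos r * (q : ℍ[ℝ]).imJ ∧
    ((qu (r / 2) 0 0 * q * (qu (r / 2) 0 0)⁻¹ : ℍ[ℝ]ˣ) : ℍ[ℝ]).imK = (q : ℍ[ℝ]).imK ∧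
    ((qu (r / 2) 0 0 * q * (qu (r / 2) 0 0)⁻¹ : ℍ[ℝ]ˣ) : ℍ[ℝ]).re = (q : ℍ[ℝ]).re := by
  have hc : Real.cos r = Real.cos (r / 2) ^ 2 - Real.sin (r / 2) ^ 2 := by
    rw [← Real.cos_two_mul']; congr 1; ring
  have hs : Real.sin r = 2 * Real.sin (r / 2) * Real.cos (r / 2) := by
    rw [← Real.sin_two_mul]; congr 1; ring
  have h2 := Real.sin_sq_add_cos_sq (r / 2)
  simp only [Units.val_mul, Quaternion.re_mul, Quaternion.imI_mul, Quaternion.imJ_mul,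
    Quaternion.imK_mul, qu_re, qu_imI, qu_imJ, qu_imK, qui_re, qui_imI, qui_imJ, qui_imK,
    Real.sin_zero, Real.cos_zero, hc, hs]
  refine ⟨by ring, by ring, ?_, ?_⟩
  · linear_combination (q : ℍ[ℝ]).imK * h2
  · linear_combination (q : ℍ[ℝ]).re * h2

lemma qu_rot (τ θ r φ : ℝ) :
    qu τ (θ + r) φ = qu (r / 2) 0 0 * qu τ θ φ * (qu (r / 2) 0 0)⁻¹ := by
  obtain ⟨a, b, c, d⟩ := conj_rot r (qu τ θ φ)
  ext
  · rw [d, qu_re, qu_re]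
  · rw [a, qu_imI, qu_imI, qu_imJ, Real.cos_add]; ring
  · rw [b, qu_imJ, qu_imI, qu_imJ, Real.sin_add]; ring
  · rw [c, qu_imK, qu_imK]

/-- Central elements. -/
lemma conj_eq_one_iff (q : ℍ[ℝ]ˣ) : MulAut.conj q = 1 ↔
    (q : ℍ[ℝ]).imI = 0 ∧ (q : ℍ[ℝ]).imJ = 0 ∧ (q : ℍ[ℝ]).imK = 0 := by
  constructor
  · intro h
    have key : ∀ g : ℍ[ℝ]ˣ, q * g = g * q := by
      intro g
      have := DFunLike.congr_fun h g
      rw [MulAut.conj_apply, MulAut.one_apply, mul_inv_eq_iff_eq_mul] at this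
      exact this
    have hk := congrArg Units.val (key (qu (Real.pi / 2) 0 0))
    have hi := congrArg Units.val (key (qu (Real.pi / 2) 0 (Real.pi / 2)))
    have e1 := congrArg QuaternionAlgebra.imI hk
    have e2 := congrArg QuaternionAlgebra.imJ hk
    have e3 := congrArg QuaternionAlgebra.imJ hi
    simp only [Units.val_mul, Quaternion.imI_mul, Quaternion.imJ_mul,
      qu_re, qu_imI, qu_imJ, qu_imK, Real.sin_zero, Real.cos_zero, Real.sin_pi_div_two,
      Real.cos_pi_div_two] at e1 e2 e3
    refine ⟨by linarith, by linarith, by linarith⟩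
  · rintro ⟨h1, h2, h3⟩
    ext1 g
    rw [MulAut.conj_apply, MulAut.one_apply, mul_inv_eq_iff_eq_mul]
    ext
    · simp only [Units.val_mul, Quaternion.re_mul, h1, h2, h3]; ring
    · simp only [Units.val_mul, Quaternion.imI_mul, h1, h2, h3]; ring
    · simp only [Units.val_mul, Quaternion.imJ_mul, h1, h2, h3]; ring
    · simp only [Units.val_mul, Quaternion.imK_mul, h1, h2, h3]; ring

/-- The family of triples of unit quaternions; coordinates are `s, θ, φ`. -/
noncomputable def fam (t : Fin 3 → ℝ) (x : Fin 3 → ℝ) : Fin 3 → ℍ[ℝ]ˣ :=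
  ![qu (Real.pi * t 0) 0 0, qu (Real.pi * t 1) 0 (Real.pi * x 0), qu (Real.pi * t 2) (x 1) (x 2)]

/-- The value of the word on the family. -/
noncomputable def ev (W : FreeGroup (Fin 3)) (t x : Fin 3 → ℝ) : ℍ[ℝ]ˣ :=
  FreeGroup.lift (fam t x) W

lemma ev_contDiff (W : FreeGroup (Fin 3)) (t : Fin 3 → ℝ) :
    ContDiff ℝ ∞ (fun x => (ev W t x : ℍ[ℝ]).re) ∧ ContDiff ℝ ∞ (fun x => (ev W t x : ℍ[ℝ]).imI) ∧
    ContDiff ℝ ∞ (fun x => (ev W t x : ℍ[ℝ]).imJ) ∧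
    ContDiff ℝ ∞ (fun x => (ev W t x : ℍ[ℝ]).imK) := by
  induction W using FreeGroup.induction_on with
  | C1 => simp [ev, contDiff_const]
  | of i =>
    fin_cases i
    all_goals
      simp only [ev, FreeGroup.lift_apply_of, fam, Fin.zero_eta, Fin.mk_one, Fin.reduceFinMk,
        Matrix.cons_val, qu_re, qu_imI, qu_imJ, qu_imK]
      refine ⟨?_, ?_, ?_, ?_⟩ <;> fun_prop
  | inv_of i _ =>
    fin_cases i
    all_goals
      simp only [ev, map_inv, FreeGroup.lift_apply_of, fam, Fin.zero_eta, Fin.mk_one,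
        Fin.reduceFinMk, Matrix.cons_val, qui_re, qui_imI, qui_imJ, qui_imK]
      refine ⟨?_, ?_, ?_, ?_⟩ <;> fun_prop
  | mul u v hu hv =>
    obtain ⟨u0, u1, u2, u3⟩ := hu
    obtain ⟨v0, v1, v2, v3⟩ := hv
    have hm : ∀ x, ev (u * v) t x = ev u t x * ev v t x := fun x => map_mul _ _ _
    simp only [hm, Units.val_mul, Quaternion.re_mul, Quaternion.imI_mul, Quaternion.imJ_mul,
      Quaternion.imK_mul]
    refine ⟨?_, ?_, ?_, ?_⟩ <;> fun_prop

/-- Exponent sum in the generator `i`. -/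
def expSum (i : Fin 3) : FreeGroup (Fin 3) →* Multiplicative ℤ :=
  FreeGroup.lift fun j => Multiplicative.ofAdd (if j = i then 1 else 0)

lemma lift_real (τ : Fin 3 → ℝ) (W : FreeGroup (Fin 3)) :
    FreeGroup.lift (fun i => Multiplicative.ofAdd (τ i)) W
      = Multiplicative.ofAdd (((expSum 0 W).toAdd : ℝ) * τ 0 + ((expSum 1 W).toAdd : ℝ) * τ 1
        + ((expSum 2 W).toAdd : ℝ) * τ 2) := by
  induction W using FreeGroup.induction_on with
  | C1 => simp
  | of i => fin_cases i <;> simp [expSum]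
  | inv_of i h =>
    rw [map_inv, h]
    simp only [map_inv, toAdd_inv, Int.cast_neg]
    rw [← ofAdd_neg]; congr 1; ring
  | mul u v hu hv =>
    rw [map_mul, hu, hv]
    simp only [map_mul, toAdd_mul, Int.cast_add]
    rw [← ofAdd_add]; congr 1; ring

/-- Values of the word on a commuting triple. -/
lemma ev_axis (τ : Fin 3 → ℝ) (W : FreeGroup (Fin 3)) :
    FreeGroup.lift (fun i => qu (τ i) 0 0) W
      = qu (((expSum 0 W).toAdd : ℝ) * τ 0 + ((expSum 1 W).toAdd : ℝ) * τ 1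
        + ((expSum 2 W).toAdd : ℝ) * τ 2) 0 0 := by
  have : FreeGroup.lift (fun i => qu (τ i) 0 0)
      = (quHom 0 0).comp (FreeGroup.lift (fun i => Multiplicative.ofAdd (τ i))) := by
    ext1 i
    simp [qu_eq_quHom]
  rw [this, MonoidHom.comp_apply, lift_real, qu_eq_quHom]

lemma ev_rot (W : FreeGroup (Fin 3)) (t x : Fin 3 → ℝ) (hx : x 0 = 0 ∨ x 0 = 1) (r : ℝ) :
    ev W t (x + r • Pi.single 1 1) = qu (r / 2) 0 0 * ev W t x * (qu (r / 2) 0 0)⁻¹ := by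
  have : FreeGroup.lift (fam t (x + r • Pi.single 1 1))
      = (MulAut.conj (qu (r / 2) 0 0)).toMonoidHom.comp (FreeGroup.lift (fam t x)) := by
    ext1 i
    fin_cases i
    · simp [fam, qu_comm]
    · rcases hx with hx | hx <;> simp [fam, hx, qu_pi, qu_comm]
    · simp [fam, qu_rot]
  unfold ev
  rw [this]
  simp

lemma ev_per (W : FreeGroup (Fin 3)) (t x : Fin 3 → ℝ) :
    ev W t (x + (2 * Real.pi) • Pi.single 1 1) = ev W t x := by
  have : fam t (x + (2 * Real.pi) • Pi.single 1 1) = fam t x := by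
    have : ∀ τ φ, qu τ (x 1 + 2 * Real.pi) φ = qu τ (x 1) φ := by
      intro τ φ
      ext <;> simp [qu_re, qu_imI, qu_imJ, qu_imK]
    simp [fam, this]
  unfold ev
  rw [this]

lemma ev_pole (W : FreeGroup (Fin 3)) (t x : Fin 3 → ℝ) (hx : x 2 = 0 ∨ x 2 = Real.pi) (r : ℝ) :
    ev W t (x + r • Pi.single 1 1) = ev W t x := by
  have : fam t (x + r • Pi.single 1 1) = fam t x := by
    rcases hx with hx | hx
    · simp [fam, hx, qu_zero _ (x 1 + r), qu_zero _ (x 1)]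
    · simp [fam, hx, qu_pi]
  unfold ev
  rw [this]

/-- Values at the four corners. -/
lemma ev_corner (W : FreeGroup (Fin 3)) (t : Fin 3 → ℝ) (s p ε δ : ℝ)
    (hs : (s = 0 ∧ ε = 1) ∨ (s = 1 ∧ ε = -1)) (hp : (p = 0 ∧ δ = 1) ∨ (p = Real.pi ∧ δ = -1)) :
    ev W t ![s, 0, p] = qu (Real.pi * (((expSum 0 W).toAdd : ℝ) * t 0
      + ε * (((expSum 1 W).toAdd : ℝ) * t 1) + δ * (((expSum 2 W).toAdd : ℝ) * t 2))) 0 0 := by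
  have : fam t ![s, 0, p] = fun i => qu ((![Real.pi * t 0, ε * (Real.pi * t 1),
      δ * (Real.pi * t 2)] : Fin 3 → ℝ) i) 0 0 := by
    ext1 i
    fin_cases i
    · simp [fam]
    · rcases hs with ⟨rfl, rfl⟩ | ⟨rfl, rfl⟩ <;> simp [fam, qu_pi]
    · rcases hp with ⟨rfl, rfl⟩ | ⟨rfl, rfl⟩ <;> simp [fam, qu_pi]
  unfold ev
  rw [this, ev_axis]
  congr 1
  simp
  ring

/-- Existence of a solution. -/
theorem exists_solution (W : FreeGroup (Fin 3)) (t : Fin 3 → ℝ) (N : Fin 3 → ℤ) (y : Fin 3 → ℝ)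
    (hN : ∀ i, ((expSum i W).toAdd : ℝ) * t i = N i + y i)
    (hy : ∀ i, 0 < y i ∧ y i ≤ 1 / 2)
    (h0 : y 0 < y 1 + y 2) (h1 : y 1 < y 0 + y 2) (h2 : y 2 < y 0 + y 1) :
    ∃ x, (ev W t x : ℍ[ℝ]).imI = 0 ∧ (ev W t x : ℍ[ℝ]).imJ = 0 ∧ (ev W t x : ℍ[ℝ]).imK = 0 := by
  by_contra hcon
  obtain ⟨-, cI, cJ, cK⟩ := ev_contDiff W t
  set f : Fin 3 → (Fin 3 → ℝ) → ℝ := ![fun x => (ev W t x : ℍ[ℝ]).imI,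
    fun x => (ev W t x : ℍ[ℝ]).imJ, fun x => (ev W t x : ℍ[ℝ]).imK] with hf
  have hfc : ∀ k, ContDiff ℝ ∞ (f k) := by
    intro k; fin_cases k
    · exact cI
    · exact cJ
    · exact cK
  set R : (Fin 3 → ℝ) → ℝ := fun x => f 0 x * f 0 x + f 1 x * f 1 x + f 2 x * f 2 x with hR
  have hRpos : ∀ x, 0 < R x := by
    intro x
    have hnn : 0 ≤ R x := by simp only [hR]; nlinarith [sq_nonneg (f 0 x), sq_nonneg (f 1 x), sq_nonneg (f 2 x)]
    rcases hnn.lt_or_eq with h | h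
    · exact h
    · exfalso
      apply hcon
      have h' : f 0 x * f 0 x + f 1 x * f 1 x + f 2 x * f 2 x = 0 := h.symm
      refine ⟨x, ?_, ?_, ?_⟩
      · change f 0 x = 0
        nlinarith [sq_nonneg (f 0 x), sq_nonneg (f 1 x), sq_nonneg (f 2 x)]
      · change f 1 x = 0
        nlinarith [sq_nonneg (f 0 x), sq_nonneg (f 1 x), sq_nonneg (f 2 x)]
      · change f 2 x = 0
        nlinarith [sq_nonneg (f 0 x), sq_nonneg (f 1 x), sq_nonneg (f 2 x)]
  have hRc : ContDiff ℝ ∞ R := by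
    have := hfc 0; have := hfc 1; have := hfc 2
    simp only [hR]; fun_prop
  set n : Fin 3 → (Fin 3 → ℝ) → ℝ := fun k x => f k x / Real.sqrt (R x) with hn
  have hnc : ∀ k, ContDiff ℝ ∞ (n k) := fun k =>
    (hfc k).div (hRc.sqrt fun x => (hRpos x).ne') fun x => (Real.sqrt_pos.2 (hRpos x)).ne'
  have hn1 : ∀ x, n 0 x * n 0 x + n 1 x * n 1 x + n 2 x * n 2 x = 1 := by
    intro x
    have hs := Real.sqrt_pos.2 (hRpos x)
    have hs2 : Real.sqrt (R x) ^ 2 = f 0 x * f 0 x + f 1 x * f 1 x + f 2 x * f 2 x :=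
      Real.sq_sqrt (hRpos x).le
    simp only [hn]
    field_simp
    linarith
  have hcongr : ∀ x x', ev W t x = ev W t x' → ∀ k, n k x = n k x' := by
    intro x x' h k
    have hk : ∀ k, f k x = f k x' := by
      intro k; fin_cases k <;> simp [hf, h]
    simp only [hn, hR, hk]
  have hrot : ∀ x : Fin 3 → ℝ, (x 0 = 0 ∨ x 0 = 1) → ∀ r : ℝ,
      n 0 (x + r • Pi.single 1 1) = Real.cos r * n 0 x - Real.sin r * n 1 x ∧
      n 1 (x + r • Pi.single 1 1) = Real.sin r * n 0 x + Real.cos r * n 1 x ∧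
      n 2 (x + r • Pi.single 1 1) = n 2 x := by
    intro x hx r
    obtain ⟨a, b, c, -⟩ := conj_rot r (ev W t x)
    rw [← ev_rot W t x hx r] at a b c
    have a' : f 0 (x + r • Pi.single 1 1) = Real.cos r * f 0 x - Real.sin r * f 1 x := a
    have b' : f 1 (x + r • Pi.single 1 1) = Real.sin r * f 0 x + Real.cos r * f 1 x := b
    have c' : f 2 (x + r • Pi.single 1 1) = f 2 x := c
    have hRR : R (x + r • Pi.single 1 1) = R x := by
      simp only [hR, a', b', c']
      linear_combination (f 0 x * f 0 x + f 1 x * f 1 x) * Real.sin_sq_add_cos_sq r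
    simp only [hn, hRR, a', b', c']
    refine ⟨by ring, by ring, trivial⟩
  have hdeg := degree_lemma hnc hn1 (fun k x => hcongr _ _ (ev_per W t x) k)
    (fun k x hx r => hcongr _ _ (ev_pole W t x hx r) k) hrot
  -- corners
  have hcorner : ∀ (s p ε δ : ℝ) (e d : ℤ), (e : ℝ) = ε → (d : ℝ) = δ →
      ((s = 0 ∧ ε = 1) ∨ (s = 1 ∧ ε = -1)) →
      ((p = 0 ∧ δ = 1) ∨ (p = Real.pi ∧ δ = -1)) → f 0 ![s, 0, p] = 0 ∧ f 1 ![s, 0, p] = 0 ∧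
      f 2 ![s, 0, p] = (-1) ^ (N 0 + e * N 1 + d * N 2)
        * Real.sin (Real.pi * (y 0 + ε * y 1 + δ * y 2)) := by
    intro s p ε δ e d he hd hs hp
    have h := ev_corner W t s p ε δ hs hp
    rw [hN, hN, hN] at h
    refine ⟨?_, ?_, ?_⟩
    · change (ev W t _ : ℍ[ℝ]).imI = 0
      rw [h, qu_imI]; simp
    · change (ev W t _ : ℍ[ℝ]).imJ = 0
      rw [h, qu_imJ]; simp
    · change (ev W t _ : ℍ[ℝ]).imK = _
      rw [h, qu_imK, Real.cos_zero, mul_one, ← Real.sin_add_int_mul_pi]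
      congr 1
      push_cast
      rw [he, hd]
      ring
  have hsq : ∀ m : ℤ, ((-1 : ℝ) ^ m = 1 ∨ (-1 : ℝ) ^ m = -1) := by
    intro m
    rcases Int.even_or_odd m with h | h
    · left; exact h.neg_one_zpow
    · right; exact h.neg_one_zpow
  set σ : ℝ := (-1) ^ (N 0 + N 1 + N 2) with hσ
  have hpar : ∀ e d : ℤ, (e = 1 ∨ e = -1) → (d = 1 ∨ d = -1) →
      (-1 : ℝ) ^ (N 0 + e * N 1 + d * N 2) = σ := by
    intro e d he hd
    have h2 : ∀ m : ℤ, (-1 : ℝ) ^ (2 * m) = 1 := fun m => (even_two_mul m).neg_one_zpow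
    have hne : (-1 : ℝ) ≠ 0 := by norm_num
    rcases he with rfl | rfl <;> rcases hd with rfl | rfl
    · simp [hσ]
    · rw [hσ, show N 0 + N 1 + N 2 = (N 0 + 1 * N 1 + -1 * N 2) + 2 * N 2 by ring,
        zpow_add₀ hne _ (2 * N 2), h2, mul_one]
    · rw [hσ, show N 0 + N 1 + N 2 = (N 0 + -1 * N 1 + 1 * N 2) + 2 * N 1 by ring,
        zpow_add₀ hne _ (2 * N 1), h2, mul_one]
    · rw [hσ, show N 0 + N 1 + N 2 = (N 0 + -1 * N 1 + -1 * N 2) + 2 * (N 1 + N 2) by ring,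
        zpow_add₀ hne _ (2 * (N 1 + N 2)), h2, mul_one]
  -- value of the third component from its sign
  have hval : ∀ x, f 0 x = 0 → f 1 x = 0 → ∀ S : ℝ, f 2 x = σ * S →
      (0 < S → n 2 x = σ) ∧ (S < 0 → n 2 x = -σ) := by
    intro x x0 x1 S hS
    have hσ2 : σ * σ = 1 := by rcases hsq (N 0 + N 1 + N 2) with h | h <;> rw [hσ, h] <;> norm_num
    have hRx : R x = S ^ 2 := by
      simp only [hR, x0, x1, hS]
      linear_combination S ^ 2 * hσ2
    constructor
    · intro hpos
      simp only [hn, hRx, hS]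
      rw [Real.sqrt_sq hpos.le]; field_simp
    · intro hneg
      simp only [hn, hRx, hS]
      rw [Real.sqrt_sq_eq_abs, abs_of_neg hneg, mul_div_assoc, div_neg, div_self hneg.ne]; ring
  have hpi := Real.pi_pos
  have hy0 := hy 0; have hy1 := hy 1; have hy2 := hy 2
  have cA := hcorner 0 Real.pi 1 (-1) 1 (-1) (by simp) (by simp) (by simp) (by simp)
  have cB := hcorner 1 Real.pi (-1) (-1) (-1) (-1) (by simp) (by simp) (by simp) (by simp)
  have cC := hcorner 1 0 (-1) 1 (-1) 1 (by simp) (by simp) (by simp) (by simp)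
  rw [hpar _ _ (by simp) (by simp)] at cA cB cC
  have vA := (hval _ cA.1 cA.2.1 _ cA.2.2).1
    (Real.sin_pos_of_pos_of_lt_pi (by apply mul_pos hpi; linarith)
      (by nlinarith))
  have vC := (hval _ cC.1 cC.2.1 _ cC.2.2).1
    (Real.sin_pos_of_pos_of_lt_pi (by apply mul_pos hpi; linarith)
      (by nlinarith))
  have vB := (hval _ cB.1 cB.2.1 _ cB.2.2).2
    (Real.sin_neg_of_neg_of_neg_pi_lt (by apply mul_neg_of_pos_of_neg hpi; linarith)
      (by nlinarith))
  rw [vA, vB, vC] at hdeg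
  have hb := hn1 ![0, 0, 0]
  have hσ2 : σ * σ = 1 := by rcases hsq (N 0 + N 1 + N 2) with h | h <;> rw [hσ, h] <;> norm_num
  have h3 : n 2 ![0, 0, 0] = 3 * σ := by linarith
  rw [h3] at hb
  nlinarith [sq_nonneg (n 0 ![0, 0, 0]), sq_nonneg (n 1 ![0, 0, 0])]

end OneRel

namespace OneRel

/-! ### Choice of rotation angles -/

lemma selA (n : ℕ) (e : ℤ) (h : ¬ (n : ℤ) ∣ e) :
    ∃ t : ℝ, ∃ N m : ℤ, (n : ℝ) * t = m ∧ 1 / 3 ≤ (e : ℝ) * t - N ∧ (e : ℝ) * t - N ≤ 1 / 2 := by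
  rcases Nat.eq_zero_or_pos n with rfl | hn
  · have he : (e : ℝ) ≠ 0 := by
      intro h0; apply h; simp only [Int.cast_eq_zero] at h0; simp [h0]
    refine ⟨1 / (3 * e), 0, 0, by simp, ?_, ?_⟩
    · apply le_of_eq; field_simp; simp
    · rw [show (e : ℝ) * (1 / (3 * e)) - ((0 : ℤ) : ℝ) = 1 / 3 by field_simp; simp]; norm_num
  · set d : ℕ := Int.gcd e n with hd
    have hdn : d ∣ n := by
      have := Int.gcd_dvd_right e n
      exact_mod_cast this
    have hde : (d : ℤ) ∣ e := Int.gcd_dvd_left e n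
    obtain ⟨p, hp⟩ := hdn
    have hd0 : 0 < d := by
      rcases Nat.eq_zero_or_pos d with h0 | h0
      · rw [h0] at hp; omega
      · exact h0
    have hp2 : 2 ≤ p := by
      by_contra hlt
      have : p = 0 ∨ p = 1 := by omega
      rcases this with h0 | h0
      · rw [h0] at hp; omega
      · apply h; rw [h0, mul_one] at hp; rw [hp]; exact hde
    have hbez := Int.gcd_eq_gcd_ab e n
    set u := Int.gcdA e n
    set v := Int.gcdB e n
    have hb : (d : ℝ) = e * u + n * v := by
      have : ((Int.gcd e n : ℤ) : ℝ) = ((e * u + n * v : ℤ) : ℝ) := by rw [hbez]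
      push_cast at this
      exact this
    have hnR : (n : ℝ) = d * p := by rw [hp]; push_cast; rfl
    have hdR : (0 : ℝ) < d := by exact_mod_cast hd0
    have hpR : (2 : ℝ) ≤ p := by exact_mod_cast hp2
    have hnR0 : (0 : ℝ) < n := by exact_mod_cast hn
    obtain ⟨j, hj⟩ : ∃ j : ℕ, j = p / 2 := ⟨_, rfl⟩
    have hval : (e : ℝ) * ((u * j : ℝ) / n) - ((-v * j : ℤ) : ℝ)
        = (j : ℝ) / p := by
      have : (e : ℝ) * u = d - n * v := by linarith
      push_cast
      field_simp
      rw [hnR] at *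
      have hx : (e : ℝ) * u = d - d * p * v := by linarith
      rw [← mul_assoc, hx]
      ring
    refine ⟨(u * j : ℝ) / n, -v * j, u * j, ?_, ?_, ?_⟩
    · push_cast; field_simp
    · rw [hval, le_div_iff₀ (by linarith)]
      have : p ≤ 3 * j := by omega
      have : (p : ℝ) ≤ 3 * (j : ℝ) := by exact_mod_cast this
      linarith
    · rw [hval, div_le_iff₀ (by linarith)]
      have : 2 * j ≤ p := by omega
      have : 2 * (j : ℝ) ≤ p := by exact_mod_cast this
      linarith

lemma selB (n : ℕ) (e k : ℤ) (h : ¬ (n : ℤ) ∣ e) (hk : ¬ (n : ℤ) ∣ k) :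
    ∃ t : ℝ, ∃ N m : ℤ, (n : ℝ) * t = m ∧ 1 / 6 < (e : ℝ) * t - N ∧ (e : ℝ) * t - N ≤ 1 / 2 ∧
      ∀ l : ℤ, (k : ℝ) * t ≠ l := by
  obtain ⟨t0, N0, m0, a0, b0, c0⟩ := selA n e h
  by_cases hk0 : ∀ l : ℤ, (k : ℝ) * t0 ≠ l
  · exact ⟨t0, N0, m0, a0, by linarith, c0, hk0⟩
  push Not at hk0
  obtain ⟨l0, hl0⟩ := hk0
  have ht1 : ∃ t1 : ℝ, ∃ N m : ℤ, (n : ℝ) * t1 = m ∧ 0 ≤ (e : ℝ) * t1 - N ∧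
      (e : ℝ) * t1 - N ≤ 1 / 2 ∧ ∀ l : ℤ, (k : ℝ) * t1 ≠ l := by
    have : ∃ t1 : ℝ, ∃ m : ℤ, (n : ℝ) * t1 = m ∧ ∀ l : ℤ, (k : ℝ) * t1 ≠ l := by
      rcases Nat.eq_zero_or_pos n with rfl | hn
      · have he : (k : ℝ) ≠ 0 := by
          intro h0; apply hk; simp only [Int.cast_eq_zero] at h0; simp [h0]
        refine ⟨1 / (2 * k), 0, by simp, ?_⟩
        intro l hl
        have : (1 : ℝ) = 2 * l := by rw [← hl]; field_simp
        have : (1 : ℤ) = 2 * l := by exact_mod_cast this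
        omega
      · have hnR0 : (0 : ℝ) < n := by exact_mod_cast hn
        refine ⟨1 / n, 1, by field_simp; simp, ?_⟩
        intro l hl
        apply hk
        refine ⟨l, ?_⟩
        have : (k : ℝ) = n * l := by rw [← hl]; field_simp
        exact_mod_cast this
    obtain ⟨t1, m, hm, hl⟩ := this
    have hr := abs_sub_round ((e : ℝ) * t1)
    rw [abs_le] at hr
    rcases le_total 0 ((e : ℝ) * t1 - round ((e : ℝ) * t1)) with hp | hp
    · exact ⟨t1, round ((e : ℝ) * t1), m, hm, hp, hr.2, hl⟩
    · refine ⟨-t1, -round ((e : ℝ) * t1), -m, ?_, ?_, ?_, ?_⟩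
      · push_cast; linarith
      · push_cast; linarith
      · push_cast; linarith
      · intro l h'
        apply hl (-l)
        push_cast; linarith
  obtain ⟨t1, N1, m1, a1, b1, c1, d1⟩ := ht1
  by_cases hgt : 1 / 6 < (e : ℝ) * t1 - N1
  · exact ⟨t1, N1, m1, a1, hgt, c1, d1⟩
  push Not at hgt
  by_cases hle : (e : ℝ) * (t0 + t1) - (N0 + N1) ≤ 1 / 2
  · refine ⟨t0 + t1, N0 + N1, m0 + m1, ?_, ?_, ?_, ?_⟩
    · push_cast; linarith
    · push_cast; linarith
    · push_cast; linarith
    · intro l hl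
      apply d1 (l - l0)
      push_cast; linarith
  · push Not at hle
    refine ⟨-(t0 + t1), -(N0 + N1) - 1, -(m0 + m1), ?_, ?_, ?_, ?_⟩
    · push_cast; linarith
    · push_cast; linarith
    · push_cast; linarith
    · intro l hl
      apply d1 (-l - l0)
      push_cast; linarith

lemma retract_of_same {G : Fin 3 → Type*} [∀ i, Group (G i)] (i : Fin 3) (g : G i) :
    CoprodI.retract i (Monoid.CoprodI.of g) = g := by
  simp [CoprodI.retract]

lemma retract_of_ne {G : Fin 3 → Type*} [∀ i, Group (G i)] (i j : Fin 3) (h : j ≠ i) (g : G j) :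
    CoprodI.retract i (Monoid.CoprodI.of g) = 1 := by
  simp [CoprodI.retract, h]

/-- The canonical map from the free group. -/
def proj {G : Fin 3 → Type*} [∀ i, Group (G i)] (gen : ∀ i, G i) :
    FreeGroup (Fin 3) →* Monoid.CoprodI G :=
  FreeGroup.lift fun i => Monoid.CoprodI.of (gen i)

lemma proj_surj {G : Fin 3 → Type*} [∀ i, Group (G i)] (gen : ∀ i, G i)
    (hgen : ∀ i, Subgroup.zpowers (gen i) = ⊤) : Function.Surjective (proj gen) := by
  intro w
  change w ∈ (proj gen).range
  induction w using Monoid.CoprodI.induction_on with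
  | one => exact one_mem _
  | of i m =>
    have : m ∈ Subgroup.zpowers (gen i) := by rw [hgen]; trivial
    obtain ⟨k, rfl⟩ := this
    exact ⟨FreeGroup.of i ^ k, by simp [proj]⟩
  | mul x y hx hy => exact mul_mem hx hy

lemma retract_proj {G : Fin 3 → Type*} [∀ i, Group (G i)] (gen : ∀ i, G i) (i : Fin 3)
    (W : FreeGroup (Fin 3)) :
    CoprodI.retract i (proj gen W) = gen i ^ (expSum i W).toAdd := by
  have : (CoprodI.retract i).comp (proj gen) = (zpowersHom _ (gen i)).comp (expSum i) := by
    ext1 j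
    by_cases h : j = i
    · subst h
      simp [proj, expSum, retract_of_same]
    · simp [proj, expSum, h, retract_of_ne i j h]
  exact DFunLike.congr_fun this W

end OneRel

/-- **Theorem 1 (Chinyere–Howie).** If `G a`, `G b`, `G c` are nontrivial cyclic groups
with generators `gen i`, and `w` is a word in their free product whose exponent sum in each
generator is nonzero modulo the order of that generator (equivalently, whose image under the
canonical retraction onto each factor is nontrivial), then each factor embeds in the
one-relator product `(G a * G b * G c)/N(w)` via the natural map. -/
theorem one_relator_product_of_three_cyclics_freiheitssatz
    {G : Fin 3 → Type*} [∀ i, Group (G i)] [∀ i, Nontrivial (G i)]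
    (gen : ∀ i, G i) (hgen : ∀ i, Subgroup.zpowers (gen i) = ⊤)
    (w : Monoid.CoprodI G)
    (hw : ∀ i, CoprodI.retract i w ≠ 1) :
    ∀ i : Fin 3,
      Function.Injective
        ((QuotientGroup.mk' (Subgroup.normalClosure {w})).comp
          (Monoid.CoprodI.of : G i →* Monoid.CoprodI G)) := by
  intro i
  rw [injective_iff_map_eq_one]
  intro g hg
  by_contra hg1
  obtain ⟨W, rfl⟩ := OneRel.proj_surj gen hgen w
  have hmem : ∀ j (x : G j), x ∈ Subgroup.zpowers (gen j) := fun j x => by rw [hgen]; trivial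
  obtain ⟨k, rfl⟩ := hmem i g
  have hk : ¬ (orderOf (gen i) : ℤ) ∣ k := by
    rw [orderOf_dvd_iff_zpow_eq_one]; exact hg1
  have he : ∀ j, ¬ (orderOf (gen j) : ℤ) ∣ (OneRel.expSum j W).toAdd := by
    intro j
    rw [orderOf_dvd_iff_zpow_eq_one, ← OneRel.retract_proj]
    exact hw j
  have hsel : ∀ j, ∃ t : ℝ, ∃ N m : ℤ, (orderOf (gen j) : ℝ) * t = m ∧
      1 / 6 < ((OneRel.expSum j W).toAdd : ℝ) * t - N ∧
      ((OneRel.expSum j W).toAdd : ℝ) * t - N ≤ 1 / 2 ∧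
      (j ≠ i → 1 / 3 ≤ ((OneRel.expSum j W).toAdd : ℝ) * t - N) ∧
      (j = i → ∀ l : ℤ, (k : ℝ) * t ≠ l) := by
    intro j
    by_cases hj : j = i
    · subst hj
      obtain ⟨t, N, m, a, b, c, d⟩ := OneRel.selB _ _ k (he j) hk
      exact ⟨t, N, m, a, b, c, fun h => absurd rfl h, fun _ => d⟩
    · obtain ⟨t, N, m, a, b, c⟩ := OneRel.selA _ _ (he j)
      exact ⟨t, N, m, a, by linarith, c, fun _ => b, fun h => absurd h hj⟩
  choose t N m hm hlo hhi hthird hnot using hsel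
  obtain ⟨x, hI, hJ, hK⟩ := OneRel.exists_solution W t N
    (fun j => ((OneRel.expSum j W).toAdd : ℝ) * t j - N j) (fun j => by ring)
    (fun j => ⟨by linarith [hlo j], hhi j⟩)
    (by
      have a0 := hlo 0; have a1 := hlo 1; have a2 := hlo 2
      have b0 := hhi 0; have b1 := hhi 1; have b2 := hhi 2
      have c0 := hthird 0; have c1 := hthird 1; have c2 := hthird 2
      fin_cases i <;> simp at c0 c1 c2 <;> linarith)
    (by
      have a0 := hlo 0; have a1 := hlo 1; have a2 := hlo 2
      have b0 := hhi 0; have b1 := hhi 1; have b2 := hhi 2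
      have c0 := hthird 0; have c1 := hthird 1; have c2 := hthird 2
      fin_cases i <;> simp at c0 c1 c2 <;> linarith)
    (by
      have a0 := hlo 0; have a1 := hlo 1; have a2 := hlo 2
      have b0 := hhi 0; have b1 := hhi 1; have b2 := hhi 2
      have c0 := hthird 0; have c1 := hthird 1; have c2 := hthird 2
      fin_cases i <;> simp at c0 c1 c2 <;> linarith)
  -- every member of the family is a rotation
  have hfam : ∀ j, ∃ θ φ, OneRel.fam t x j = OneRel.qu (Real.pi * t j) θ φ := by
    intro j
    fin_cases j
    · exact ⟨_, _, rfl⟩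
    · exact ⟨_, _, rfl⟩
    · exact ⟨_, _, rfl⟩
  have hord : ∀ j, orderOf (MulAut.conj (OneRel.fam t x j)) ∣ orderOf (gen j) := by
    intro j
    obtain ⟨θ, φ, h⟩ := hfam j
    rw [orderOf_dvd_iff_pow_eq_one, ← map_pow, OneRel.conj_eq_one_iff, h, ← zpow_natCast,
      OneRel.qu_zpow]
    have hs : Real.sin (((orderOf (gen j) : ℤ) : ℝ) * (Real.pi * t j)) = 0 := by
      rw [Real.sin_eq_zero_iff]
      refine ⟨m j, ?_⟩
      rw [← hm j]; push_cast; ring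
    rw [OneRel.qu_imI, OneRel.qu_imJ, OneRel.qu_imK, hs]
    simp
  let Φ : Monoid.CoprodI G →* MulAut (Quaternion ℝ)ˣ :=
    Monoid.CoprodI.lift fun j => monoidHomOfForallMemZpowers (hmem j) (hord j)
  have hΦgen : ∀ j, Φ (Monoid.CoprodI.of (gen j)) = MulAut.conj (OneRel.fam t x j) := by
    intro j
    simp only [Φ, Monoid.CoprodI.lift_of]
    exact monoidHomOfForallMemZpowers_apply_gen _ _
  have hΦW : Φ (OneRel.proj gen W) = MulAut.conj (OneRel.ev W t x) := by
    have : Φ.comp (OneRel.proj gen) = MulAut.conj.comp (FreeGroup.lift (OneRel.fam t x)) := by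
      ext1 j
      simp [OneRel.proj, hΦgen]
    exact DFunLike.congr_fun this W
  have hΦ1 : Φ (OneRel.proj gen W) = 1 := by
    rw [hΦW, OneRel.conj_eq_one_iff]; exact ⟨hI, hJ, hK⟩
  have hle : Subgroup.normalClosure {OneRel.proj gen W} ≤ Φ.ker :=
    Subgroup.normalClosure_le_normal (by simpa using hΦ1)
  have hin : (Monoid.CoprodI.of (gen i ^ k) : Monoid.CoprodI G) ∈
      Subgroup.normalClosure {OneRel.proj gen W} := by
    rw [← QuotientGroup.eq_one_iff]; exact hg
  have h1 : Φ (Monoid.CoprodI.of (gen i ^ k)) = 1 := hle hin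
  obtain ⟨θ, φ, h⟩ := hfam i
  rw [map_zpow, map_zpow, hΦgen, ← map_zpow, OneRel.conj_eq_one_iff, h, OneRel.qu_zpow] at h1
  obtain ⟨e1, e2, e3⟩ := h1
  rw [OneRel.qu_imI] at e1
  rw [OneRel.qu_imJ] at e2
  rw [OneRel.qu_imK] at e3
  have hs : Real.sin ((k : ℝ) * (Real.pi * t i)) = 0 := by
    have q2 := Real.sin_sq_add_cos_sq θ
    have q3 := Real.sin_sq_add_cos_sq φ
    generalize Real.sin ((k : ℝ) * (Real.pi * t i)) = S at *
    have : S ^ 2 = 0 := by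
      linear_combination S * Real.sin φ * Real.cos θ * e1 + S * Real.sin φ * Real.sin θ * e2
        + S * Real.cos φ * e3 - S ^ 2 * q3 - S ^ 2 * Real.sin φ ^ 2 * q2
    exact pow_eq_zero_iff (two_ne_zero) |>.1 this
  rw [Real.sin_eq_zero_iff] at hs
  obtain ⟨l, hl⟩ := hs
  apply hnot i rfl l
  have := Real.pi_pos.ne'
  apply mul_right_cancel₀ this
  linarith
end

section
/- Let p, q, r be prime powers and let G_a, G_b, G_c be cyclic groups of orders p, q, r with generators a, b, c respectively. Let w be an element of G_a*G_b*G_c whose exponent sum in a is non-zero modulo p, whose exponent sum in b is non-zero modulo q, and whose exponent sum in c is non-zero modulo r (equivalently: for each factor, the image of w under the canonical retraction of G_a*G_b*G_c onto that factor is nontrivial). Then each of the natural maps G_a → G, G_b → G, G_c → G is injective, where G = (G_a*G_b*G_c)/N(w). -/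
open Monoid

lemma exists_near_half (l m : ℕ) (hl : l.Prime) (hm : 0 < m) :
    ∃ s : ℕ, Nat.Coprime s (l ^ m) ∧ l ^ m ≤ 4 * s ∧ 2 * s ≤ l ^ m := by
  rcases hl.eq_two_or_odd' with rfl | hodd
  · obtain ⟨m, rfl⟩ : ∃ k, m = k + 1 := ⟨m - 1, by omega⟩
    rcases m with _ | m
    · exact ⟨1, by simp, by norm_num, by norm_num⟩
    · have h1 : 1 ≤ 2 ^ m := Nat.one_le_two_pow
      have h2 : 2 ^ (m + 1 + 1) = 4 * 2 ^ m := by ring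
      refine ⟨2 * 2 ^ m - 1, ?_, by omega, by omega⟩
      apply Nat.Coprime.pow_right
      rw [Nat.coprime_two_right]
      exact ⟨2 ^ m - 1, by omega⟩
  · have ho : Odd (l ^ m) := hodd.pow
    obtain ⟨s, hs⟩ := ho
    have h3 : 3 ≤ l := by
      have := hl.two_le
      rcases hodd with ⟨k, hk⟩
      omega
    have : l ≤ l ^ m := Nat.le_self_pow hm.ne' l
    refine ⟨s, ?_, by omega, by omega⟩
    rw [hs]
    simp

lemma exists_angle (P n : ℕ) (hP : IsPrimePow P) (hn : ¬ P ∣ n) :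
    ∃ (j : ℕ) (m : ℤ) (u : ℝ), Nat.Coprime P j ∧ 1 / 4 ≤ u ∧ u ≤ 1 / 2 ∧
      (n * j : ℝ) = P * (u + m) := by
  have hP0 : 0 < P := hP.pos
  set d := Nat.gcd n P with hd
  have hdpos : 0 < d := Nat.gcd_pos_of_pos_right _ hP0
  obtain ⟨n', hn'⟩ : d ∣ n := Nat.gcd_dvd_left _ _
  obtain ⟨q, hq⟩ : d ∣ P := Nat.gcd_dvd_right _ _
  have hcop : Nat.Coprime n' q := by
    have := Nat.coprime_div_gcd_div_gcd (m := n) (n := P) hdpos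
    rw [← hd] at this
    rwa [Nat.div_eq_of_eq_mul_right hdpos hn', Nat.div_eq_of_eq_mul_right hdpos hq] at this
  have hq1 : q ≠ 1 := by
    rintro rfl
    apply hn
    rw [hq, mul_one]; exact ⟨n', hn'⟩
  have hqP : q ∣ P := ⟨d, by rw [hq]; ring⟩
  have hq0 : q ≠ 0 := by rintro rfl; omega
  obtain ⟨l, k, hl, hk, hlk⟩ := (isPrimePow_nat_iff P).1 hP
  obtain ⟨e, he, hqe⟩ := (Nat.dvd_prime_pow hl).1 (hlk ▸ hqP)
  have he0 : 0 < e := by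
    rcases Nat.eq_zero_or_pos e with rfl | h
    · simp at hqe; exact absurd hqe hq1
    · exact h
  obtain ⟨s, hs1, hs2, hs3⟩ := exists_near_half l e hl he0
  rw [← hqe] at hs1 hs2 hs3
  obtain ⟨a, -, ha⟩ := Nat.exists_mul_mod_eq_one_of_coprime hcop (by omega)
  have hmod : n' * (a * s) ≡ s [MOD q] := by
    have h1 : n' * a ≡ 1 [MOD q] := by
      unfold Nat.ModEq; rw [ha, Nat.mod_eq_of_lt (by omega)]
    have := h1.mul_right s
    rwa [one_mul, mul_assoc] at this
  have hcj : Nat.Coprime (n' * (a * s)) q := by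
    unfold Nat.Coprime
    rw [hmod.gcd_eq]
    exact hs1
  have hcj2 : Nat.Coprime (a * s) q := Nat.Coprime.coprime_mul_left hcj
  have hm : ∃ m : ℤ, (n' * (a * s) : ℤ) = s + q * m := by
    have h2 := (Nat.modEq_iff_dvd.1 hmod.symm)
    obtain ⟨m, hm⟩ := h2
    refine ⟨m, ?_⟩
    push_cast at hm
    linarith
  obtain ⟨m, hm⟩ := hm
  have hmR : ((n' : ℝ) * (a * s)) = s + q * m := by exact_mod_cast hm
  have hqR : (0 : ℝ) < q := by exact_mod_cast Nat.pos_of_ne_zero hq0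
  refine ⟨a * s, m, s / q, ?_, ?_, ?_, ?_⟩
  · rw [← hlk]
    apply Nat.Coprime.pow_left
    rw [hqe] at hcj2
    exact ((Nat.coprime_pow_right_iff he0 _ _).1 hcj2).symm
  · rw [div_le_div_iff₀ (by norm_num) hqR]
    have : (q : ℝ) ≤ 4 * s := by exact_mod_cast hs2
    linarith
  · rw [div_le_div_iff₀ hqR (by norm_num)]
    have : 2 * (s : ℝ) ≤ q := by exact_mod_cast hs3
    linarith
  · have e1 : (n : ℝ) = d * n' := by exact_mod_cast hn'
    have e2 : (P : ℝ) = d * q := by exact_mod_cast hq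
    rw [e1, e2]
    push_cast
    have : (d : ℝ) * q * (s / q + m) = d * (s + q * m) := by field_simp
    rw [this, ← hmR]; ring
open Real

lemma grid_uniform {E T : Type*} [NormedAddCommGroup E] [PseudoMetricSpace T] (f : T → ℝ → E)
    (hf : Continuous (fun x : T × ℝ => f x.1 x.2)) (S : Set T) (hS : IsCompact S)
    (b c : ℝ) (hc : 0 < c) :
    ∃ δ > 0, ∀ t ∈ S, ∀ x ∈ Set.Icc 0 b, ∀ y ∈ Set.Icc 0 b, |x - y| < δ →
      ‖f t x - f t y‖ < c := by
  have hK : IsCompact (S ×ˢ Set.Icc 0 b) := hS.prod isCompact_Icc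
  have := hK.uniformContinuousOn_of_continuous hf.continuousOn
  rw [Metric.uniformContinuousOn_iff] at this
  obtain ⟨δ, hδ, h⟩ := this c hc
  refine ⟨δ, hδ, fun t ht x hx y hy hxy => ?_⟩
  have := h (t, x) ⟨ht, hx⟩ (t, y) ⟨ht, hy⟩ (by
    rw [Prod.dist_eq]; simpa [Real.dist_eq, hδ] using hxy)
  rwa [dist_eq_norm] at this

lemma no_winding_change (f : ℝ → ℝ → ℂ) (hf : Continuous (fun x : ℝ × ℝ => f x.1 x.2))
    (h0 : ∀ t ∈ Set.Icc (0 : ℝ) 1, ∀ x ∈ Set.Icc (0 : ℝ) (2 * π), f t x ≠ 0) (hper : ∀ t, f t (2 * π) = f t 0) (r0 r1 m : ℝ)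
    (hr0 : 0 < r0) (hr1 : 0 < r1) (hm : m ≤ 0) (hm1 : -1 ≤ m)
    (e0 : ∀ x ∈ Set.Icc (0 : ℝ) (2 * π), f 0 x = r0 * Complex.exp ((m * x : ℝ) * Complex.I))
    (e1 : ∀ x ∈ Set.Icc (0 : ℝ) (2 * π), f 1 x = r1 * Complex.exp ((x : ℝ) * Complex.I)) : False := by
  have hK : IsCompact (Set.Icc (0 : ℝ) 1 ×ˢ Set.Icc 0 (2 * π)) := isCompact_Icc.prod isCompact_Icc
  obtain ⟨⟨t0, x0⟩, htx0, hmin⟩ := hK.exists_isMinOn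
    ⟨(0, 0), by constructor <;> simp [pi_pos.le]⟩ (hf.norm.continuousOn)
  have hcpos : 0 < ‖f t0 x0‖ := norm_pos_iff.2 (h0 _ htx0.1 _ htx0.2)
  obtain ⟨δ, hδ, hu⟩ := grid_uniform f hf _ isCompact_Icc (2 * π) _ hcpos
  obtain ⟨N, hN⟩ := exists_nat_gt (max (2 * π / δ) 4)
  have hN4 : (4 : ℝ) < N := lt_of_le_of_lt (le_max_right _ _) hN
  have hNpos : (0 : ℝ) < N := by linarith
  have hNδ : 2 * π / N < δ := by
    have : 2 * π / δ < N := lt_of_le_of_lt (le_max_left _ _) hN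
    rw [div_lt_iff₀ hδ] at this
    rw [div_lt_iff₀ hNpos]; linarith
  let g : ℕ → ℝ := fun k => 2 * π * k / N
  have hg : ∀ k, k ≤ N → g k ∈ Set.Icc 0 (2 * π) := by
    intro k hk
    have hk' : (k : ℝ) ≤ N := by exact_mod_cast hk
    refine ⟨by positivity, ?_⟩
    change 2 * π * k / N ≤ 2 * π
    rw [div_le_iff₀ hNpos]
    exact mul_le_mul_of_nonneg_left hk' (by positivity)
  have hgs : ∀ k, g (k + 1) - g k = 2 * π / N := by
    intro k; simp only [g]; push_cast; field_simp; ring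
  have hslit : ∀ t ∈ Set.Icc (0 : ℝ) 1, ∀ k < N, f t (g (k + 1)) / f t (g k) ∈ Complex.slitPlane := by
    intro t ht k hk
    have h1 := hu t ht (g (k + 1)) (hg _ hk) (g k) (hg _ hk.le) (by
      rw [hgs, abs_of_pos (by positivity)]; exact hNδ)
    have h2 : ‖f t0 x0‖ ≤ ‖f t (g k)‖ := hmin (show (t, g k) ∈ _ from ⟨ht, hg _ hk.le⟩)
    have h4 := h0 t ht (g k) (hg _ hk.le)
    have h3 : f t (g (k + 1)) / f t (g k) = 1 + (f t (g (k + 1)) - f t (g k)) / f t (g k) := by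
      field_simp; ring
    rw [h3]
    apply Complex.mem_slitPlane_of_norm_lt_one
    rw [norm_div, div_lt_one (norm_pos_iff.2 h4)]
    linarith
  let F : ℝ → ℂ := fun t => ∑ k ∈ Finset.range N, Complex.log (f t (g (k + 1)) / f t (g k))
  have hcont : ∀ y : ℝ, Continuous (fun t => f t y) := fun y =>
    hf.comp (continuous_id.prodMk continuous_const)
  have hFc : ContinuousOn F (Set.Icc 0 1) := by
    apply continuousOn_finsetSum
    intro k hk
    apply ContinuousOn.clog
    · exact (hcont _).continuousOn.div₀ (hcont _).continuousOn
        (fun t ht => h0 _ ht _ (hg _ (Finset.mem_range.1 hk).le))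
    · intro t ht
      exact hslit t ht k (Finset.mem_range.1 hk)
  have hFexp : ∀ t ∈ Set.Icc (0 : ℝ) 1, Complex.exp (F t) = 1 := by
    intro t ht
    simp only [F]
    rw [Complex.exp_sum]
    have : ∀ k ∈ Finset.range N, Complex.exp (Complex.log (f t (g (k + 1)) / f t (g k)))
        = f t (g (k + 1)) / f t (g k) := fun k hk =>
      Complex.exp_log (div_ne_zero (h0 _ ht _ (hg _ (Finset.mem_range.1 hk)))
        (h0 _ ht _ (hg _ (Finset.mem_range.1 hk).le)))
    rw [Finset.prod_congr rfl this]
    have hp : ∀ n : ℕ, n ≤ N → ∏ k ∈ Finset.range n, f t (g (k + 1)) / f t (g k) = f t (g n) / f t (g 0) := by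
      intro n
      induction n with
      | zero => intro hn; simp [h0 t ht (g 0) (hg _ hn)]
      | succ n ih =>
        intro hn
        have q1 := h0 t ht (g n) (hg _ (by omega))
        have q2 := h0 t ht (g 0) (hg _ (by omega))
        rw [Finset.prod_range_succ, ih (by omega)]; field_simp
    rw [hp N le_rfl]
    have hgN : g N = 2 * π := by simp only [g]; field_simp
    have hg0 : g 0 = 0 := by simp [g]
    rw [hgN, hg0, hper, div_self (h0 _ ht _ ⟨le_rfl, by positivity⟩)]
  have hlog : ∀ (t r a : ℝ), 0 < r → -1 ≤ a → a ≤ 1 →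
      (∀ x ∈ Set.Icc (0 : ℝ) (2 * π), f t x = r * Complex.exp ((a * x : ℝ) * Complex.I)) → (F t).im = 2 * π * a := by
    intro t r a hr ha ha' h
    have : ∀ k ∈ Finset.range N, Complex.log (f t (g (k + 1)) / f t (g k))
        = ((a * (2 * π / N) : ℝ) : ℂ) * Complex.I := by
      intro k hk
      have hk := Finset.mem_range.1 hk
      have hr' : (r : ℂ) ≠ 0 := by exact_mod_cast hr.ne'
      rw [h _ (hg _ hk), h _ (hg _ hk.le), mul_div_mul_left _ _ hr', ← Complex.exp_sub]
      have : ((a * g (k + 1) : ℝ) : ℂ) * Complex.I - ((a * g k : ℝ) : ℂ) * Complex.I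
          = ((a * (2 * π / N) : ℝ) : ℂ) * Complex.I := by
        rw [← hgs k]; push_cast; ring
      rw [this]
      have hb : 2 * π / N < π := by
        rw [div_lt_iff₀ hNpos]; nlinarith [pi_pos]
      have hb0 : 0 < 2 * π / N := by positivity
      apply Complex.log_exp
      · simp only [Complex.mul_I_im, Complex.ofReal_re]; nlinarith
      · simp only [Complex.mul_I_im, Complex.ofReal_re]; nlinarith
    simp only [F]
    rw [Finset.sum_congr rfl this, Finset.sum_const, Finset.card_range, nsmul_eq_mul]
    simp
    field_simp
  have v0 := hlog 0 r0 m hr0 hm1 (by linarith) e0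
  have v1 := hlog 1 r1 1 hr1 (by norm_num) le_rfl (by simpa using e1)
  have hivt := intermediate_value_Icc (zero_le_one' ℝ) (Complex.continuous_im.comp_continuousOn hFc)
  obtain ⟨t, ht, hte⟩ := hivt (show π ∈ _ by
    simp only [Function.comp]; rw [v0, v1]; constructor <;> nlinarith [pi_pos])
  obtain ⟨n, hn⟩ := Complex.exp_eq_one_iff.1 (hFexp t ht)
  simp only [Function.comp, hn] at hte
  simp at hte
  have h2 : (n : ℝ) * 2 = 1 := by
    apply mul_right_cancel₀ pi_ne_zero; linarith
  have h3 : n * 2 = 1 := by exact_mod_cast h2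
  omega
open scoped ComplexConjugate

/-- unnormalised projection onto the `+1` eigenline of the Hermitian matrix attached to `(k, z)` -/
noncomputable def stepV (k : ℝ) (z : ℂ) (v : ℂ × ℂ) : ℂ × ℂ :=
  (v.1 + k * v.1 + conj z * v.2, v.2 + z * v.1 - k * v.2)

def InLine (k : ℝ) (z : ℂ) (v : ℂ × ℂ) : Prop :=
  k * v.1 + conj z * v.2 = v.1 ∧ z * v.1 - k * v.2 = v.2

lemma unit_cast {k : ℝ} {z : ℂ} (h : k ^ 2 + Complex.normSq z = 1) :
    (k : ℂ) ^ 2 + conj z * z = 1 := by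
  rw [← Complex.normSq_eq_conj_mul_self]; exact_mod_cast h

lemma inLine_step {k : ℝ} {z : ℂ} (h : k ^ 2 + Complex.normSq z = 1) (v : ℂ × ℂ) :
    InLine k z (stepV k z v) := by
  have h' := unit_cast h
  constructor <;> simp only [stepV]
  · linear_combination v.1 * h'
  · linear_combination v.2 * h'

lemma step_ne {k k' : ℝ} {z z' : ℂ} 
    (v : ℂ × ℂ) (hv : InLine k' z' v) (hv0 : v ≠ 0)
    (hd : (k - k') ^ 2 + Complex.normSq (z - z') < 4) : stepV k z v ≠ 0 := by
  intro h0
  apply hv0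
  obtain ⟨a1, a2⟩ := hv
  have b1 : v.1 + k * v.1 + conj z * v.2 = 0 := congrArg Prod.fst h0
  have b2 : v.2 + z * v.1 - k * v.2 = 0 := congrArg Prod.snd h0
  have c1 : ((k : ℂ) - k') * v.1 + conj (z - z') * v.2 = - 2 * v.1 := by
    rw [map_sub]; linear_combination b1 - a1
  have c2 : (z - z') * v.1 - ((k : ℂ) - k') * v.2 = - 2 * v.2 := by
    linear_combination b2 - a2
  have hn : ((((k - k') ^ 2 + Complex.normSq (z - z') : ℝ)) : ℂ) - 4 ≠ 0 := by
    intro h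
    have : (k - k') ^ 2 + Complex.normSq (z - z') - 4 = 0 := by exact_mod_cast h
    linarith
  have hcast : ((((k - k') ^ 2 + Complex.normSq (z - z') : ℝ)) : ℂ)
      = ((k : ℂ) - k') ^ 2 + conj (z - z') * (z - z') := by
    rw [← Complex.normSq_eq_conj_mul_self]; push_cast; ring
  rw [hcast] at hn
  ext
  · apply (mul_eq_zero.1 (?_ : _ * v.1 = 0)).resolve_left hn
    linear_combination ((k : ℂ) - k') * c1 + conj (z - z') * c2 - 2 * c1
  · apply (mul_eq_zero.1 (?_ : _ * v.2 = 0)).resolve_left hn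
    linear_combination (z - z') * c1 - ((k : ℂ) - k') * c2 - 2 * c2

noncomputable def transV (K : ℕ → ℝ) (Z : ℕ → ℂ) (v : ℂ × ℂ) : ℕ → ℂ × ℂ
  | 0 => v
  | n + 1 => stepV (K (n + 1)) (Z (n + 1)) (transV K Z v n)

lemma transV_spec (K : ℕ → ℝ) (Z : ℕ → ℂ) (v : ℂ × ℂ) (M : ℕ)
    (hu : ∀ n, K n ^ 2 + Complex.normSq (Z n) = 1) (hv : InLine (K 0) (Z 0) v) (hv0 : v ≠ 0)
    (hd : ∀ n < M, (K (n + 1) - K n) ^ 2 + Complex.normSq (Z (n + 1) - Z n) < 4) :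
    ∀ n ≤ M, InLine (K n) (Z n) (transV K Z v n) ∧ transV K Z v n ≠ 0 := by
  intro n
  induction n with
  | zero => intro _; exact ⟨hv, hv0⟩
  | succ n ih =>
    intro hn
    obtain ⟨i1, i2⟩ := ih (by omega)
    exact ⟨inLine_step (hu _) _, step_ne _ i1 i2 (hd n (by omega))⟩

lemma transV_rot (K : ℕ → ℝ) (Z : ℕ → ℂ) (v : ℂ × ℂ) (ω : ℂ) (hω : conj ω * ω = 1) (n : ℕ) :
    transV K (fun n => ω * Z n) (v.1, ω * v.2) n
      = ((transV K Z v n).1, ω * (transV K Z v n).2) := by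
  induction n with
  | zero => rfl
  | succ n ih =>
    simp only [transV, ih, stepV, map_mul]
    ext
    · simp only; linear_combination (conj (Z (n + 1)) * (transV K Z v n).2) * hω
    · simp only; ring

lemma transV_rot' (K : ℕ → ℝ) (Z : ℕ → ℂ) (v : ℂ × ℂ) (ω : ℂ) (hω : conj ω * ω = 1) (n : ℕ) :
    transV K (fun n => ω * Z n) (conj ω * v.1, v.2) n
      = (conj ω * (transV K Z v n).1, (transV K Z v n).2) := by
  induction n with
  | zero => rfl
  | succ n ih =>
    simp only [transV, ih, stepV, map_mul]
    ext
    · simp only; ring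
    · simp only; linear_combination (Z (n + 1) * (transV K Z v n).1) * hω

lemma transV_cont {T : Type*} [TopologicalSpace T] (K : T → ℕ → ℝ) (Z : T → ℕ → ℂ)
    (v : T → ℂ × ℂ) (hK : ∀ n, Continuous fun t => K t n) (hZ : ∀ n, Continuous fun t => Z t n)
    (hv : Continuous v) (n : ℕ) : Continuous fun t => transV (K t) (Z t) (v t) n := by
  induction n with
  | zero => exact hv
  | succ n ih =>
    have h1 := hK (n + 1)
    have h2 := hZ (n + 1)
    have h3 : Continuous fun t => ((K t (n + 1) : ℝ) : ℂ) := Complex.continuous_ofReal.comp h1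
    have h4 : Continuous fun t => conj (Z t (n + 1)) := Complex.continuous_conj.comp h2
    simp only [transV, stepV]
    fun_prop

lemma inner_ne {k : ℝ} {z : ℂ} {v w : ℂ × ℂ} (hv : InLine k z v) (hw : InLine k z w)
    (hv0 : v ≠ 0) (hw0 : w ≠ 0) : conj v.1 * w.1 + conj v.2 * w.2 ≠ 0 := by
  intro h
  apply hw0
  obtain ⟨a1, a2⟩ := hv
  obtain ⟨b1, b2⟩ := hw
  have hdet : w.1 * v.2 - w.2 * v.1 = 0 := by
    by_cases hk : (1 + (k : ℂ)) = 0
    · have h2 : (1 - (k : ℂ)) ≠ 0 := by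
        intro h3
        have : (2 : ℂ) = 0 := by linear_combination hk + h3
        norm_num at this
      apply (mul_eq_zero.1 (?_ : (1 - (k : ℂ)) * _ = 0)).resolve_left h2
      linear_combination - v.2 * b1 + w.2 * a1
    · apply (mul_eq_zero.1 (?_ : (1 + (k : ℂ)) * _ = 0)).resolve_left hk
      linear_combination - w.1 * a2 + v.1 * b2
  have hpos : (conj v.1 * v.1 + conj v.2 * v.2) ≠ 0 := by
    rw [← Complex.normSq_eq_conj_mul_self, ← Complex.normSq_eq_conj_mul_self]
    intro h3
    have h4 : Complex.normSq v.1 + Complex.normSq v.2 = 0 := by exact_mod_cast h3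
    have n1 := Complex.normSq_nonneg v.1
    have n2 := Complex.normSq_nonneg v.2
    apply hv0
    ext
    · exact Complex.normSq_eq_zero.1 (by linarith)
    · exact Complex.normSq_eq_zero.1 (by linarith)
  ext
  · apply (mul_eq_zero.1 (?_ : _ * w.1 = 0)).resolve_left hpos
    linear_combination v.1 * h + conj v.2 * hdet
  · apply (mul_eq_zero.1 (?_ : _ * w.2 = 0)).resolve_left hpos
    linear_combination v.2 * h - conj v.1 * hdet

lemma inLine_pos {v : ℂ × ℂ} (h : InLine 1 0 v) : v.2 = 0 := by
  have := h.2
  simp at this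
  have h2 : (2 : ℂ) * v.2 = 0 := by linear_combination - this
  simpa using h2

lemma inLine_neg {v : ℂ × ℂ} (h : InLine (-1) 0 v) : v.1 = 0 := by
  have := h.1
  simp at this
  have h2 : (2 : ℂ) * v.1 = 0 := by linear_combination - this
  simpa using h2

lemma topo_unit (k : ℝ → ℝ → ℝ → ℝ) (z : ℝ → ℝ → ℝ → ℂ)
    (hk : Continuous fun x : ℝ × ℝ × ℝ => k x.1 x.2.1 x.2.2)
    (hz : Continuous fun x : ℝ × ℝ × ℝ => z x.1 x.2.1 x.2.2)
    (hu : ∀ t s x, k t s x ^ 2 + Complex.normSq (z t s x) = 1)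
    (hkper : ∀ t s, k t s (2 * π) = k t s 0) (hzper : ∀ t s, z t s (2 * π) = z t s 0)
    (hk0 : ∀ t x, k t 0 x = k t 0 0) (hz0 : ∀ t x, z t 0 x = z t 0 0)
    (hk1 : ∀ t x, k t 1 x = k t 1 0) (hz1 : ∀ t x, z t 1 x = z t 1 0)
    (ek0 : ∀ s x, k 0 s x = k 0 s 0)
    (ez0 : ∀ s x, z 0 s x = Complex.exp ((x : ℝ) * Complex.I) * z 0 s 0)
    (ek1 : ∀ s x, k 1 s x = k 1 s 0)
    (ez1 : ∀ s x, z 1 s x = Complex.exp ((x : ℝ) * Complex.I) * z 1 s 0)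
    (s10 : 0 < k 1 0 0) (s11 : k 1 1 0 < 0) (s01 : 0 < k 0 1 0) : False := by
  -- values at the poles
  have zz : ∀ y : ℂ, y = Complex.exp ((π : ℝ) * Complex.I) * y → y = 0 := by
    intro y hy
    rw [Complex.exp_pi_mul_I] at hy
    have : (2 : ℂ) * y = 0 := by linear_combination hy
    simpa using this
  have z00 : z 0 0 0 = 0 := zz _ (by rw [← ez0, hz0 0 π])
  have z01 : z 0 1 0 = 0 := zz _ (by rw [← ez0, hz1 0 π])
  have z10 : z 1 0 0 = 0 := zz _ (by rw [← ez1, hz0 1 π])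
  have z11 : z 1 1 0 = 0 := zz _ (by rw [← ez1, hz1 1 π])
  have sq : ∀ t s, z t s 0 = 0 → k t s 0 = 1 ∨ k t s 0 = -1 := by
    intro t s h
    have := hu t s 0
    rw [h] at this
    simpa using this
  have k10 : k 1 0 0 = 1 := (sq _ _ z10).resolve_right (by linarith)
  have k01 : k 0 1 0 = 1 := (sq _ _ z01).resolve_right (by linarith)
  have k11 : k 1 1 0 = -1 := (sq _ _ z11).resolve_left (by linarith)
  -- uniform grids
  have hn : ∀ (a : ℝ) (b : ℂ), ‖(a, b)‖ < 1 → a ^ 2 + Complex.normSq b < 4 := by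
    intro a b h
    rw [Prod.norm_def, max_lt_iff] at h
    obtain ⟨h1, h2⟩ := h
    simp only [Real.norm_eq_abs] at h1
    rw [Complex.normSq_eq_norm_sq]
    have := sq_abs a
    nlinarith [abs_nonneg a, norm_nonneg b]
  obtain ⟨δ1, hδ1, u1⟩ := grid_uniform (fun (t : ℝ) (y : ℝ) => (k (t * y) 0 0, z (t * y) 0 0))
    ((hk.comp (f := fun x : ℝ × ℝ => (x.1 * x.2, (0 : ℝ), (0 : ℝ))) (by fun_prop)).prodMk
      (hz.comp (f := fun x : ℝ × ℝ => (x.1 * x.2, (0 : ℝ), (0 : ℝ))) (by fun_prop)))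
    (Set.Icc 0 1) isCompact_Icc 1 1 one_pos
  obtain ⟨δ2, hδ2, u2⟩ := grid_uniform
    (fun (p : ℝ × ℝ) (y : ℝ) => (k p.1 y p.2, z p.1 y p.2))
    ((hk.comp (f := fun x : (ℝ × ℝ) × ℝ => (x.1.1, x.2, x.1.2)) (by fun_prop)).prodMk
      (hz.comp (f := fun x : (ℝ × ℝ) × ℝ => (x.1.1, x.2, x.1.2)) (by fun_prop)))
    (Set.Icc 0 1 ×ˢ Set.Icc 0 (2 * π)) (isCompact_Icc.prod isCompact_Icc) 1 1 one_pos
  obtain ⟨M, hM⟩ := exists_nat_gt (max (1 / min δ1 δ2) 1)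
  have hM1 : (1 : ℝ) < M := lt_of_le_of_lt (le_max_right _ _) hM
  have hMpos : (0 : ℝ) < M := by linarith
  have hMδ : 1 / (M : ℝ) < min δ1 δ2 := by
    have h1 : 1 / min δ1 δ2 < M := lt_of_le_of_lt (le_max_left _ _) hM
    have h2 : 0 < min δ1 δ2 := lt_min hδ1 hδ2
    rw [div_lt_iff₀ h2] at h1
    rw [div_lt_iff₀ hMpos]; linarith
  let g : ℕ → ℝ := fun n => n / M
  have hg : ∀ n ≤ M, g n ∈ Set.Icc (0 : ℝ) 1 := by
    intro n hn
    have : (n : ℝ) ≤ M := by exact_mod_cast hn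
    exact ⟨by positivity, by simp only [g]; rw [div_le_one hMpos]; exact this⟩
  have hgs : ∀ n, |g (n + 1) - g n| = 1 / M := by
    intro n
    have : g (n + 1) - g n = 1 / M := by simp only [g]; push_cast; field_simp; ring
    rw [this, abs_of_pos (by positivity)]
  have hg0 : g 0 = 0 := by simp [g]
  have hgM : g M = 1 := by simp only [g]; field_simp
  -- the starting vector
  obtain ⟨v0, hv0, hv0n⟩ : ∃ v0 : ℂ × ℂ, InLine (k 0 0 0) (z 0 0 0) v0 ∧ v0 ≠ 0 := by
    rw [z00]
    rcases sq _ _ z00 with h | h <;> rw [h]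
    · exact ⟨(1, 0), by simp [InLine], by simp⟩
    · exact ⟨(0, 1), by simp [InLine], by simp⟩
  let a : ℝ → ℂ × ℂ := fun t =>
    transV (fun n => k (t * g n) 0 0) (fun n => z (t * g n) 0 0) v0 M
  have ha : ∀ t ∈ Set.Icc (0 : ℝ) 1, InLine (k t 0 0) (z t 0 0) (a t) ∧ a t ≠ 0 := by
    intro t ht
    have := transV_spec (fun n => k (t * g n) 0 0) (fun n => z (t * g n) 0 0) v0 M
      (fun n => hu _ _ _) (by simpa [hg0] using hv0) hv0n (by
        intro n hnM
        apply hn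
        exact u1 t ht _ (hg (n + 1) hnM) _ (hg n hnM.le)
          (by rw [hgs]; exact hMδ.trans_le (min_le_left _ _))) M le_rfl
    simpa [hgM] using this
  have hac : Continuous a := by
    apply transV_cont
    · intro n
      exact hk.comp (f := fun t : ℝ => (t * g n, (0 : ℝ), (0 : ℝ))) (by fun_prop)
    · intro n
      exact hz.comp (f := fun t : ℝ => (t * g n, (0 : ℝ), (0 : ℝ))) (by fun_prop)
    · exact continuous_const
  let b : ℝ → ℝ → ℂ × ℂ := fun t x =>
    transV (fun n => k t (g n) x) (fun n => z t (g n) x) (a t) M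
  have hb : ∀ t ∈ Set.Icc (0 : ℝ) 1, ∀ x ∈ Set.Icc (0 : ℝ) (2 * π),
      InLine (k t 1 0) (z t 1 0) (b t x) ∧ b t x ≠ 0 := by
    intro t ht x hx
    have := transV_spec (fun n => k t (g n) x) (fun n => z t (g n) x) (a t) M
      (fun n => hu _ _ _) (by simp only [hg0]; rw [hk0, hz0]; exact (ha t ht).1) (ha t ht).2 (by
        intro n hnM
        apply hn
        exact u2 (t, x) ⟨ht, hx⟩ _ (hg (n + 1) hnM) _ (hg n hnM.le)
          (by rw [hgs]; exact hMδ.trans_le (min_le_right _ _))) M le_rfl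
    simp only [hgM] at this
    rwa [hk1, hz1] at this
  have hbc : Continuous fun p : ℝ × ℝ => b p.1 p.2 := by
    apply transV_cont
    · intro n
      exact hk.comp (f := fun p : ℝ × ℝ => (p.1, g n, p.2)) (by fun_prop)
    · intro n
      exact hz.comp (f := fun p : ℝ × ℝ => (p.1, g n, p.2)) (by fun_prop)
    · exact hac.comp continuous_fst
  have hbper : ∀ t, b t (2 * π) = b t 0 := by
    intro t; simp only [b, hkper, hzper]
  have hb0c : Continuous fun p : ℝ × ℝ => b p.1 0 :=
    hbc.comp (f := fun p : ℝ × ℝ => (p.1, (0 : ℝ))) (by fun_prop)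
  have hω : ∀ x : ℝ, conj (Complex.exp ((x : ℝ) * Complex.I)) * Complex.exp ((x : ℝ) * Complex.I)
      = 1 := by
    intro x
    rw [← Complex.normSq_eq_conj_mul_self, Complex.normSq_eq_norm_sq, Complex.norm_exp_ofReal_mul_I]
    simp
  have hωc : ∀ x : ℝ, conj (Complex.exp ((x : ℝ) * Complex.I))
      = Complex.exp ((-1 * x : ℝ) * Complex.I) := by
    intro x
    rw [← Complex.exp_conj]
    simp
  have m0 : (0 : ℝ) ∈ Set.Icc (0 : ℝ) 1 := by simp
  have m1 : (1 : ℝ) ∈ Set.Icc (0 : ℝ) 1 := by simp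
  have mx : (0 : ℝ) ∈ Set.Icc (0 : ℝ) (2 * π) := ⟨le_rfl, by positivity⟩
  -- rotation behaviour
  have rotP : ∀ t, (∀ s x, k t s x = k t s 0) →
      (∀ s x, z t s x = Complex.exp ((x : ℝ) * Complex.I) * z t s 0) → (a t).2 = 0 →
      ∀ x : ℝ, b t x = ((b t 0).1, Complex.exp ((x : ℝ) * Complex.I) * (b t 0).2) := by
    intro t h1 h2 h3 x
    have := transV_rot (fun n => k t (g n) 0) (fun n => z t (g n) 0) (a t) _ (hω x) M
    rw [h3, mul_zero] at this
    have h4 : ((a t).1, (0 : ℂ)) = a t := by ext <;> simp [h3]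
    rw [h4] at this
    rw [← this]
    simp only [b]
    congr 1
    · funext n; exact h1 _ _
    · funext n; exact h2 _ _
  have rotN : ∀ t, (∀ s x, k t s x = k t s 0) →
      (∀ s x, z t s x = Complex.exp ((x : ℝ) * Complex.I) * z t s 0) → (a t).1 = 0 →
      ∀ x : ℝ, b t x = (conj (Complex.exp ((x : ℝ) * Complex.I)) * (b t 0).1, (b t 0).2) := by
    intro t h1 h2 h3 x
    have := transV_rot' (fun n => k t (g n) 0) (fun n => z t (g n) 0) (a t) _ (hω x) M
    rw [h3, mul_zero] at this
    have h4 : ((0 : ℂ), (a t).2) = a t := by ext <;> simp [h3]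
    rw [h4] at this
    rw [← this]
    simp only [b]
    congr 1
    · funext n; exact h1 _ _
    · funext n; exact h2 _ _
  -- the winding function
  let f : ℝ → ℝ → ℂ := fun t x => conj (b t 0).1 * (b t x).1 + conj (b t 0).2 * (b t x).2
  have hfc : Continuous fun p : ℝ × ℝ => f p.1 p.2 := by
    have c1 : Continuous fun p : ℝ × ℝ => conj (b p.1 0).1 :=
      Complex.continuous_conj.comp (continuous_fst.comp hb0c)
    have c2 : Continuous fun p : ℝ × ℝ => conj (b p.1 0).2 :=
      Complex.continuous_conj.comp (continuous_snd.comp hb0c)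
    exact (c1.mul (continuous_fst.comp hbc)).add (c2.mul (continuous_snd.comp hbc))
  have hf0 : ∀ t ∈ Set.Icc (0 : ℝ) 1, ∀ x ∈ Set.Icc (0 : ℝ) (2 * π), f t x ≠ 0 := by
    intro t ht x hx
    exact inner_ne (hb t ht 0 mx).1 (hb t ht x hx).1 (hb t ht 0 mx).2 (hb t ht x hx).2
  have hfper : ∀ t, f t (2 * π) = f t 0 := by
    intro t; simp only [f, hbper]
  -- t = 1
  have a12 : (a 1).2 = 0 := by
    have := (ha 1 m1).1; rw [k10, z10] at this; exact inLine_pos this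
  have b11 : (b 1 0).1 = 0 := by
    have := (hb 1 m1 0 mx).1; rw [k11, z11] at this; exact inLine_neg this
  have b12 : (b 1 0).2 ≠ 0 := fun h => (hb 1 m1 0 mx).2 (by ext <;> simp [b11, h])
  have e1 : ∀ x : ℝ, f 1 x = (Complex.normSq (b 1 0).2 : ℝ) * Complex.exp ((x : ℝ) * Complex.I) := by
    intro x
    simp only [f]
    rw [rotP 1 ek1 ez1 a12 x, Complex.normSq_eq_conj_mul_self, b11]
    simp only [map_zero]; ring
  -- t = 0
  have b02 : (b 0 0).2 = 0 := by
    have := (hb 0 m0 0 mx).1; rw [k01, z01] at this; exact inLine_pos this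
  have b01 : (b 0 0).1 ≠ 0 := fun h => (hb 0 m0 0 mx).2 (by ext <;> simp [b02, h])
  have p1 := Complex.normSq_pos.2 b12
  have p0 := Complex.normSq_pos.2 b01
  rcases sq _ _ z00 with h | h
  · have a02 : (a 0).2 = 0 := by
      have := (ha 0 m0).1; rw [h, z00] at this; exact inLine_pos this
    refine no_winding_change f hfc hf0 hfper _ _ 0 p0 p1 le_rfl (by norm_num) ?_ (fun x _ => e1 x)
    intro x _
    simp only [f]
    rw [rotP 0 ek0 ez0 a02 x, Complex.normSq_eq_conj_mul_self, b02]
    simp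
  · have a01 : (a 0).1 = 0 := by
      have := (ha 0 m0).1; rw [h, z00] at this; exact inLine_neg this
    refine no_winding_change f hfc hf0 hfper _ _ (-1) p0 p1 (by norm_num) le_rfl ?_ (fun x _ => e1 x)
    intro x _
    simp only [f]
    rw [rotN 0 ek0 ez0 a01 x, Complex.normSq_eq_conj_mul_self, b02, ← hωc]
    simp only [map_zero]; ring

lemma topo (k : ℝ → ℝ → ℝ → ℝ) (z : ℝ → ℝ → ℝ → ℂ)
    (hk : Continuous fun x : ℝ × ℝ × ℝ => k x.1 x.2.1 x.2.2)
    (hz : Continuous fun x : ℝ × ℝ × ℝ => z x.1 x.2.1 x.2.2)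
    (hu : ∀ t s x, ¬ (k t s x = 0 ∧ z t s x = 0))
    (hkper : ∀ t s, k t s (2 * π) = k t s 0) (hzper : ∀ t s, z t s (2 * π) = z t s 0)
    (hk0 : ∀ t x, k t 0 x = k t 0 0) (hz0 : ∀ t x, z t 0 x = z t 0 0)
    (hk1 : ∀ t x, k t 1 x = k t 1 0) (hz1 : ∀ t x, z t 1 x = z t 1 0)
    (ek0 : ∀ s x, k 0 s x = k 0 s 0)
    (ez0 : ∀ s x, z 0 s x = Complex.exp ((x : ℝ) * Complex.I) * z 0 s 0)
    (ek1 : ∀ s x, k 1 s x = k 1 s 0)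
    (ez1 : ∀ s x, z 1 s x = Complex.exp ((x : ℝ) * Complex.I) * z 1 s 0)
    (s10 : 0 < k 1 0 0) (s11 : k 1 1 0 < 0) (s01 : 0 < k 0 1 0) : False := by
  let r : ℝ → ℝ → ℝ → ℝ := fun t s x => √(k t s x ^ 2 + Complex.normSq (z t s x))
  have hpos : ∀ t s x, 0 < k t s x ^ 2 + Complex.normSq (z t s x) := by
    intro t s x
    by_cases h : k t s x = 0
    · have h2 : z t s x ≠ 0 := fun h2 => hu t s x ⟨h, h2⟩
      have := Complex.normSq_pos.2 h2
      positivity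
    · have := Complex.normSq_nonneg (z t s x)
      positivity
  have hr : ∀ t s x, 0 < r t s x := fun t s x => Real.sqrt_pos.2 (hpos t s x)
  have hrc : Continuous fun x : ℝ × ℝ × ℝ => r x.1 x.2.1 x.2.2 :=
    ((hk.pow 2).add (Complex.continuous_normSq.comp hz)).sqrt
  have hns : ∀ (x : ℝ) (y : ℂ), Complex.normSq (Complex.exp ((x : ℝ) * Complex.I) * y)
      = Complex.normSq y := by
    intro x y
    rw [Complex.normSq_mul, Complex.normSq_eq_norm_sq, Complex.norm_exp_ofReal_mul_I]
    simp
  have er0 : ∀ s x, r 0 s x = r 0 s 0 := by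
    intro s x; simp only [r]; rw [ek0, ez0, hns]
  have er1 : ∀ s x, r 1 s x = r 1 s 0 := by
    intro s x; simp only [r]; rw [ek1, ez1, hns]
  refine topo_unit (fun t s x => k t s x / r t s x) (fun t s x => z t s x / (r t s x : ℂ))
    (hk.div₀ hrc fun x => (hr _ _ _).ne')
    (hz.div₀ (Complex.continuous_ofReal.comp hrc) fun x => by
      exact_mod_cast (hr x.1 x.2.1 x.2.2).ne') ?_ ?_ ?_ ?_ ?_ ?_ ?_ ?_ ?_ ?_ ?_
    (div_pos s10 (hr _ _ _)) (div_neg_of_neg_of_pos s11 (hr _ _ _)) (div_pos s01 (hr _ _ _))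
  · intro t s x
    have h1 : r t s x ^ 2 = k t s x ^ 2 + Complex.normSq (z t s x) := Real.sq_sqrt (hpos t s x).le
    have h2 := hr t s x
    rw [Complex.normSq_div, Complex.normSq_ofReal, div_pow, ← sq, ← add_div, ← h1]
    exact div_self (by positivity)
  · intro t s; simp only [r, hkper, hzper]
  · intro t s; simp only [r, hkper, hzper]
  · intro t x; simp only [r, hk0 t x, hz0 t x]
  · intro t x; simp only [r, hk0 t x, hz0 t x]
  · intro t x; simp only [r, hk1 t x, hz1 t x]
  · intro t x; simp only [r, hk1 t x, hz1 t x]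
  · intro s x; rw [er0, ek0]
  · intro s x; rw [er0, ez0]; ring
  · intro s x; rw [er1, ek1]
  · intro s x; rw [er1, ez1]; ring

noncomputable def mkQ (r a b c : ℝ) : Quaternion ℝ := ⟨r, a, b, c⟩

@[simp] lemma mkQ_re (r a b c : ℝ) : (mkQ r a b c).re = r := rfl
@[simp] lemma mkQ_imI (r a b c : ℝ) : (mkQ r a b c).imI = a := rfl
@[simp] lemma mkQ_imJ (r a b c : ℝ) : (mkQ r a b c).imJ = b := rfl
@[simp] lemma mkQ_imK (r a b c : ℝ) : (mkQ r a b c).imK = c := rfl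

@[simp] lemma oneQ_re : (1 : Quaternion ℝ).re = 1 := rfl
@[simp] lemma oneQ_imI : (1 : Quaternion ℝ).imI = 0 := rfl
@[simp] lemma oneQ_imJ : (1 : Quaternion ℝ).imJ = 0 := rfl
@[simp] lemma oneQ_imK : (1 : Quaternion ℝ).imK = 0 := rfl

noncomputable def qq (x a b c : ℝ) : Quaternion ℝ :=
  mkQ (cos x) (a * sin x) (b * sin x) (c * sin x)

lemma qq_mul (x y a b c : ℝ) (h : a ^ 2 + b ^ 2 + c ^ 2 = 1) :
    qq x a b c * qq y a b c = qq (x + y) a b c := by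
  apply Quaternion.ext
  · simp only [qq, Quaternion.re_mul, mkQ_re, mkQ_imI, mkQ_imJ, mkQ_imK, cos_add]
    linear_combination (- sin x * sin y) * h
  · simp only [qq, Quaternion.imI_mul, mkQ_re, mkQ_imI, mkQ_imJ, mkQ_imK, sin_add]; ring
  · simp only [qq, Quaternion.imJ_mul, mkQ_re, mkQ_imI, mkQ_imJ, mkQ_imK, sin_add]; ring
  · simp only [qq, Quaternion.imK_mul, mkQ_re, mkQ_imI, mkQ_imJ, mkQ_imK, sin_add]; ring

lemma qq_zero (a b c : ℝ) : qq 0 a b c = 1 := by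
  apply Quaternion.ext <;> simp [qq]

lemma qq_pow (x a b c : ℝ) (h : a ^ 2 + b ^ 2 + c ^ 2 = 1) (n : ℕ) :
    qq x a b c ^ n = qq (n * x) a b c := by
  induction n with
  | zero => simp [qq_zero]
  | succ n ih =>
    rw [pow_succ, ih, qq_mul _ _ _ _ _ h]; congr 1; push_cast; ring

lemma qq_ne (x a b c : ℝ) (h : a ^ 2 + b ^ 2 + c ^ 2 = 1) : qq x a b c ≠ 0 := by
  intro h0
  have h1 : qq x a b c * qq (-x) a b c = 1 := by rw [qq_mul _ _ _ _ _ h]; simp [qq_zero]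
  rw [h0, zero_mul] at h1
  exact zero_ne_one h1

noncomputable def rotQ (x : ℝ) : Quaternion ℝ →* Quaternion ℝ where
  toFun q := mkQ q.re q.imI (cos x * q.imJ - sin x * q.imK) (sin x * q.imJ + cos x * q.imK)
  map_one' := by apply Quaternion.ext <;> simp
  map_mul' p q := by
    have h := sin_sq_add_cos_sq x
    apply Quaternion.ext
    · simp only [Quaternion.re_mul, mkQ_re, mkQ_imI, mkQ_imJ, mkQ_imK]
      linear_combination (p.imJ * q.imJ + p.imK * q.imK) * h
    · simp only [Quaternion.imI_mul, mkQ_re, mkQ_imI, mkQ_imJ, mkQ_imK]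
      linear_combination (- p.imJ * q.imK + p.imK * q.imJ) * h
    · simp only [Quaternion.imJ_mul, Quaternion.imK_mul, mkQ_re, mkQ_imI, mkQ_imJ, mkQ_imK]; ring
    · simp only [Quaternion.imJ_mul, Quaternion.imK_mul, mkQ_re, mkQ_imI, mkQ_imJ, mkQ_imK]; ring

lemma rotQ_apply (x : ℝ) (q : Quaternion ℝ) : rotQ x q =
    mkQ q.re q.imI (cos x * q.imJ - sin x * q.imK) (sin x * q.imJ + cos x * q.imK) := rfl

/-- images of the three generators -/
noncomputable def gq (y : Fin 3 → ℝ) (t s x : ℝ) : Fin 3 → Quaternion ℝ :=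
  ![qq (y 0) 1 0 0, qq (y 1) (cos (π * t)) (sin (π * t)) 0,
    qq (y 2) (cos (π * s)) (sin (π * s) * cos x) (sin (π * s) * sin x)]

lemma gq_eq (y : Fin 3 → ℝ) (t s x : ℝ) (i : Fin 3) : ∃ a b c : ℝ, a ^ 2 + b ^ 2 + c ^ 2 = 1 ∧
    gq y t s x i = qq (y i) a b c := by
  fin_cases i
  · exact ⟨1, 0, 0, by norm_num, rfl⟩
  · exact ⟨_, _, _, by have := sin_sq_add_cos_sq (π * t); linarith, rfl⟩
  · refine ⟨_, _, _, ?_, rfl⟩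
    have h1 := sin_sq_add_cos_sq (π * s)
    have h2 := sin_sq_add_cos_sq x
    linear_combination h1 + sin (π * s) ^ 2 * h2

lemma qq_cont {T : Type*} [TopologicalSpace T] (x : ℝ) (a b c : T → ℝ) (ha : Continuous a)
    (hb : Continuous b) (hc : Continuous c) : Continuous fun t => qq x (a t) (b t) (c t) := by
  have : (fun t => qq x (a t) (b t) (c t)) = fun t => (cos x : ℝ) • (1 : Quaternion ℝ)
      + (a t * sin x) • mkQ 0 1 0 0 + (b t * sin x) • mkQ 0 0 1 0
      + (c t * sin x) • mkQ 0 0 0 1 := by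
    funext t
    apply Quaternion.ext <;> simp [qq]
  rw [this]
  fun_prop

lemma gq_cont (y : Fin 3 → ℝ) (i : Fin 3) :
    Continuous fun p : ℝ × ℝ × ℝ => gq y p.1 p.2.1 p.2.2 i := by
  fin_cases i
  · exact qq_cont _ _ _ _ (by fun_prop) (by fun_prop) (by fun_prop)
  · exact qq_cont (y 1) (fun p : ℝ × ℝ × ℝ => cos (π * p.1)) (fun p => sin (π * p.1)) _
      (by fun_prop) (by fun_prop) (by fun_prop)
  · exact qq_cont (y 2) (fun p : ℝ × ℝ × ℝ => cos (π * p.2.1))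
      (fun p => sin (π * p.2.1) * cos p.2.2) (fun p => sin (π * p.2.1) * sin p.2.2)
      (by fun_prop) (by fun_prop) (by fun_prop)

noncomputable def wq (y : Fin 3 → ℝ) (L : List (Fin 3)) (t s x : ℝ) : Quaternion ℝ :=
  (L.map (gq y t s x)).prod

lemma wq_cont (y : Fin 3 → ℝ) (L : List (Fin 3)) :
    Continuous fun p : ℝ × ℝ × ℝ => wq y L p.1 p.2.1 p.2.2 :=
  continuous_list_prod L fun i _ => gq_cont y i

lemma qq_list (y : Fin 3 → ℝ) (L : List (Fin 3)) :
    (L.map (fun i => qq (y i) 1 0 0)).prod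
      = qq (L.count 0 * y 0 + L.count 1 * y 1 + L.count 2 * y 2) 1 0 0 := by
  induction L with
  | nil => simp [qq_zero]
  | cons i L ih =>
    rw [List.map_cons, List.prod_cons, ih, qq_mul _ _ _ _ _ (by norm_num)]
    congr 1
    fin_cases i <;> simp <;> ring

lemma qq_neg (x : ℝ) : qq x (-1) 0 0 = qq (-x) 1 0 0 := by
  apply Quaternion.ext <;> simp [qq]

lemma wq_00 (y : Fin 3 → ℝ) (L : List (Fin 3)) (x : ℝ) :
    wq y L 0 0 x = qq (L.count 0 * y 0 + L.count 1 * y 1 + L.count 2 * y 2) 1 0 0 := by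
  rw [wq, ← qq_list]
  congr 2
  funext i
  fin_cases i <;> simp [gq]

lemma wq_01 (y : Fin 3 → ℝ) (L : List (Fin 3)) (x : ℝ) :
    wq y L 0 1 x = qq (L.count 0 * y 0 + L.count 1 * y 1 - L.count 2 * y 2) 1 0 0 := by
  have := qq_list ![y 0, y 1, - y 2] L
  simp only [Matrix.cons_val] at this
  rw [sub_eq_add_neg, ← mul_neg, ← this, wq]
  congr 2
  funext i
  fin_cases i <;> simp [gq, qq_neg]

lemma wq_10 (y : Fin 3 → ℝ) (L : List (Fin 3)) (x : ℝ) :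
    wq y L 1 0 x = qq (L.count 0 * y 0 - L.count 1 * y 1 + L.count 2 * y 2) 1 0 0 := by
  have := qq_list ![y 0, - y 1, y 2] L
  simp only [Matrix.cons_val] at this
  rw [sub_eq_add_neg, ← mul_neg, ← this, wq]
  congr 2
  funext i
  fin_cases i <;> simp [gq, qq_neg]

lemma wq_11 (y : Fin 3 → ℝ) (L : List (Fin 3)) (x : ℝ) :
    wq y L 1 1 x = qq (L.count 0 * y 0 - L.count 1 * y 1 - L.count 2 * y 2) 1 0 0 := by
  have := qq_list ![y 0, - y 1, - y 2] L
  simp only [Matrix.cons_val] at this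
  rw [sub_eq_add_neg, sub_eq_add_neg, ← mul_neg, ← mul_neg, ← this, wq]
  congr 2
  funext i
  fin_cases i <;> simp [gq, qq_neg]

lemma wq_rot (y : Fin 3 → ℝ) (L : List (Fin 3)) (t : ℝ) (ht : sin (π * t) = 0) (s x : ℝ) :
    wq y L t s x = rotQ x (wq y L t s 0) := by
  simp only [wq]
  rw [map_list_prod, List.map_map]
  congr 2
  funext i
  fin_cases i
  · apply Quaternion.ext <;> simp [gq, qq, rotQ_apply]
  · apply Quaternion.ext <;> simp [gq, qq, rotQ_apply, ht]
  · apply Quaternion.ext <;> simp [gq, qq, rotQ_apply] <;> ring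

lemma exists_real (y : Fin 3 → ℝ) (L : List (Fin 3)) (u : Fin 3 → ℝ) (m : Fin 3 → ℤ)
    (hu : ∀ i, 1 / 4 ≤ u i) (hu' : ∀ i, u i ≤ 1 / 2)
    (hy : ∀ i, L.count i * y i = π * (u i + m i)) :
    ∃ t s x, (wq y L t s x).imI = 0 ∧ (wq y L t s x).imJ = 0 ∧ (wq y L t s x).imK = 0 := by
  by_contra! hne
  set σ : ℝ := (-1) ^ (m 0 + m 1 + m 2) with hσ
  have hσ0 : σ ≠ 0 := zpow_ne_zero _ (by norm_num)
  have key : ∀ (X : ℝ) (n : ℤ), Even (m 0 + m 1 + m 2 + n) →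
      σ * sin (X + n * π) = sin X := by
    intro X n hn
    rw [sin_add_int_mul_pi, ← mul_assoc, hσ, ← zpow_add₀ (by norm_num), hn.neg_one_zpow, one_mul]
  have v01 : σ * (wq y L 0 1 0).imI = sin (π * (u 0 + u 1 - u 2)) := by
    rw [wq_01, ← key _ (m 0 + m 1 - m 2) ⟨m 0 + m 1, by ring⟩]
    simp only [qq, mkQ_imI, one_mul, hy]; push_cast; ring_nf
  have v10 : σ * (wq y L 1 0 0).imI = sin (π * (u 0 - u 1 + u 2)) := by
    rw [wq_10, ← key _ (m 0 - m 1 + m 2) ⟨m 0 + m 2, by ring⟩]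
    simp only [qq, mkQ_imI, one_mul, hy]; push_cast; ring_nf
  have v11 : σ * (wq y L 1 1 0).imI = sin (π * (u 0 - u 1 - u 2)) := by
    rw [wq_11, ← key _ (m 0 - m 1 - m 2) ⟨m 0, by ring⟩]
    simp only [qq, mkQ_imI, one_mul, hy]; push_cast; ring_nf
  have n01 : (wq y L 0 1 0).imI ≠ 0 := fun h => hne 0 1 0 h (by simp [wq_01, qq]) (by simp [wq_01, qq])
  have n10 : (wq y L 1 0 0).imI ≠ 0 := fun h => hne 1 0 0 h (by simp [wq_10, qq]) (by simp [wq_10, qq])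
  have n11 : (wq y L 1 1 0).imI ≠ 0 := fun h => hne 1 1 0 h (by simp [wq_11, qq]) (by simp [wq_11, qq])
  have a0 := hu 0
  have a1 := hu 1
  have a2 := hu 2
  have b0 := hu' 0
  have b1 := hu' 1
  have b2 := hu' 2
  have s01 : 0 < σ * (wq y L 0 1 0).imI := by
    apply lt_of_le_of_ne _ (mul_ne_zero hσ0 n01).symm
    rw [v01]
    apply sin_nonneg_of_nonneg_of_le_pi <;> nlinarith [pi_pos]
  have s10 : 0 < σ * (wq y L 1 0 0).imI := by
    apply lt_of_le_of_ne _ (mul_ne_zero hσ0 n10).symm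
    rw [v10]
    apply sin_nonneg_of_nonneg_of_le_pi <;> nlinarith [pi_pos]
  have s11 : σ * (wq y L 1 1 0).imI < 0 := by
    apply lt_of_le_of_ne _ (mul_ne_zero hσ0 n11)
    rw [v11]
    apply sin_nonpos_of_nonpos_of_neg_pi_le <;> nlinarith [pi_pos]
  have hper : ∀ t s, wq y L t s (2 * π) = wq y L t s 0 := by
    intro t s; simp [wq, gq]
  have h0 : ∀ t x, wq y L t 0 x = wq y L t 0 0 := by
    intro t x; simp [wq, gq]
  have h1 : ∀ t x, wq y L t 1 x = wq y L t 1 0 := by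
    intro t x; simp [wq, gq]
  have hc := wq_cont y L
  have rk : ∀ t, sin (π * t) = 0 → ∀ s x, σ * (wq y L t s x).imI = σ * (wq y L t s 0).imI := by
    intro t ht s x; rw [wq_rot y L t ht]; rfl
  have rz : ∀ t, sin (π * t) = 0 → ∀ s x : ℝ, (⟨(wq y L t s x).imJ, (wq y L t s x).imK⟩ : ℂ)
      = Complex.exp ((x : ℝ) * Complex.I) * ⟨(wq y L t s 0).imJ, (wq y L t s 0).imK⟩ := by
    intro t ht s x; rw [wq_rot y L t ht]
    apply Complex.ext
    · simp [rotQ_apply, Complex.exp_ofReal_mul_I_re, Complex.exp_ofReal_mul_I_im]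
    · simp [rotQ_apply, Complex.exp_ofReal_mul_I_re, Complex.exp_ofReal_mul_I_im]; ring
  have hzc : Continuous fun p : ℝ × ℝ × ℝ => (⟨(wq y L p.1 p.2.1 p.2.2).imJ,
      (wq y L p.1 p.2.1 p.2.2).imK⟩ : ℂ) := by
    have e : (fun p : ℝ × ℝ × ℝ => (⟨(wq y L p.1 p.2.1 p.2.2).imJ,
      (wq y L p.1 p.2.1 p.2.2).imK⟩ : ℂ)) = fun p => ((wq y L p.1 p.2.1 p.2.2).imJ : ℂ) +
        ((wq y L p.1 p.2.1 p.2.2).imK : ℂ) * Complex.I := by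
      funext p; rw [Complex.mk_eq_add_mul_I]
    rw [e]
    exact (Complex.continuous_ofReal.comp (Quaternion.continuous_imJ.comp hc)).add
      ((Complex.continuous_ofReal.comp (Quaternion.continuous_imK.comp hc)).mul continuous_const)
  refine topo (fun t s x => σ * (wq y L t s x).imI)
    (fun t s x => (σ : ℂ) * ⟨(wq y L t s x).imJ, (wq y L t s x).imK⟩)
    (continuous_const.mul (Quaternion.continuous_imI.comp hc)) (continuous_const.mul hzc)
    ?_ ?_ ?_ ?_ ?_ ?_ ?_ (rk 0 (by simp)) ?_ (rk 1 (by simp)) ?_ s10 s11 s01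
  · rintro t s x ⟨h2, h3⟩
    have hσC : (σ : ℂ) ≠ 0 := by exact_mod_cast hσ0
    have h2 := (mul_eq_zero.1 h2).resolve_left hσ0
    have h3 := (mul_eq_zero.1 h3).resolve_left hσC
    rw [Complex.ext_iff] at h3
    exact hne t s x h2 h3.1 h3.2
  · intro t s; simp only [hper]
  · intro t s; simp only [hper]
  · intro t x; simp only [h0 t x]
  · intro t x; simp only [h0 t x]
  · intro t x; simp only [h1 t x]
  · intro t x; simp only [h1 t x]
  · intro s x; rw [rz 0 (by simp)]; ring
  · intro s x; rw [rz 1 (by simp)]; ring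

lemma retract_of_same {ι : Type*} {G : ι → Type*} [∀ i, Group (G i)] (i : ι) (g : G i) :
    CoprodI.retract i (Monoid.CoprodI.of g) = g := by
  simp [CoprodI.retract]

lemma retract_of_ne {ι : Type*} {G : ι → Type*} [∀ i, Group (G i)] (i j : ι) (h : j ≠ i)
    (g : G j) : CoprodI.retract i (Monoid.CoprodI.of g) = 1 := by
  simp [CoprodI.retract, h]

lemma exists_word {G : Fin 3 → Type*} [∀ i, Group (G i)] [∀ i, Finite (G i)]
    (gen : ∀ i, G i) (hgen : ∀ i, Subgroup.zpowers (gen i) = ⊤) (w : Monoid.CoprodI G) :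
    ∃ L : List (Fin 3), w = (L.map fun i => (Monoid.CoprodI.of (gen i) : Monoid.CoprodI G)).prod := by
  induction w using Monoid.CoprodI.induction_on with
  | one => exact ⟨[], by simp⟩
  | of i g =>
    have hg : g ∈ Subgroup.zpowers (gen i) := by rw [hgen]; trivial
    rw [← mem_powers_iff_mem_zpowers] at hg
    obtain ⟨n, rfl⟩ := hg
    exact ⟨List.replicate n i, by simp⟩
  | mul x y hx hy =>
    obtain ⟨L, rfl⟩ := hx
    obtain ⟨L', rfl⟩ := hy
    exact ⟨L ++ L', by simp⟩

lemma retract_word {G : Fin 3 → Type*} [∀ i, Group (G i)]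
    (gen : ∀ i, G i) (L : List (Fin 3)) (i : Fin 3) :
    CoprodI.retract i (L.map fun i => (Monoid.CoprodI.of (gen i) : Monoid.CoprodI G)).prod
      = gen i ^ L.count i := by
  induction L with
  | nil => simp
  | cons j L ih =>
    rw [List.map_cons, List.prod_cons, map_mul, ih]
    by_cases h : j = i
    · subst h
      rw [retract_of_same, List.count_cons_self, pow_succ']
    · rw [retract_of_ne i j h, List.count_cons_of_ne h, one_mul]

lemma conj_eq_one_of_real (q : (Quaternion ℝ)ˣ) (h1 : (q : Quaternion ℝ).imI = 0)
    (h2 : (q : Quaternion ℝ).imJ = 0) (h3 : (q : Quaternion ℝ).imK = 0) : MulAut.conj q = 1 := by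
  have hq : (q : Quaternion ℝ) = ((q : Quaternion ℝ).re : Quaternion ℝ) := by
    apply Quaternion.ext <;> simp [h1, h2, h3]
  refine MulEquiv.ext fun x => ?_
  rw [MulAut.conj_apply, MulAut.one_apply]
  have : q * x = x * q := by
    apply Units.ext
    rw [Units.val_mul, Units.val_mul, hq]
    exact Quaternion.coe_commutes _ _
  rw [this, mul_inv_cancel_right]

lemma real_of_conj_eq_one (q : (Quaternion ℝ)ˣ) (h : MulAut.conj q = 1) :
    (q : Quaternion ℝ).imI = 0 ∧ (q : Quaternion ℝ).imJ = 0 ∧ (q : Quaternion ℝ).imK = 0 := by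
  have key : ∀ x : Quaternion ℝ, x ≠ 0 → (q : Quaternion ℝ) * x = x * q := by
    intro x hx
    have := DFunLike.congr_fun h (Units.mk0 x hx)
    rw [MulAut.conj_apply, MulAut.one_apply, mul_inv_eq_iff_eq_mul] at this
    exact congrArg Units.val this
  have hi := key (mkQ 0 1 0 0) (fun h => by
    have := congrArg (fun x : Quaternion ℝ => x.imI) h
    exact one_ne_zero (α := ℝ) this)
  have hj := key (mkQ 0 0 1 0) (fun h => by
    have := congrArg (fun x : Quaternion ℝ => x.imJ) h
    exact one_ne_zero (α := ℝ) this)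
  have e1 := congrArg (fun x : Quaternion ℝ => x.imK) hi
  have e2 := congrArg (fun x : Quaternion ℝ => x.imJ) hi
  have e3 := congrArg (fun x : Quaternion ℝ => x.imK) hj
  simp only [Quaternion.imK_mul, Quaternion.imJ_mul, mkQ_re, mkQ_imI, mkQ_imJ, mkQ_imK] at e1 e2 e3
  exact ⟨by linarith, by linarith, by linarith⟩

/-- **Lemma 4.1 (Chinyere–Howie).** If `G i` are cyclic groups of prime-power orders `p i`
with generators `gen i`, and `w` is a word in their free product whose exponent sum in each
generator is nonzero modulo the order of that generator (equivalently, whose image under the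
canonical retraction onto each factor is nontrivial), then each factor embeds in the
one-relator product `(G 0 * G 1 * G 2)/N(w)` via the natural map. -/
theorem freiheitssatz_of_prime_power_cyclics
    {G : Fin 3 → Type*} [∀ i, Group (G i)]
    (p : Fin 3 → ℕ) (hp : ∀ i, IsPrimePow (p i))
    (hcard : ∀ i, Nat.card (G i) = p i)
    (gen : ∀ i, G i) (hgen : ∀ i, Subgroup.zpowers (gen i) = ⊤)
    (w : Monoid.CoprodI G)
    (hw : ∀ i, CoprodI.retract i w ≠ 1) :
    ∀ i : Fin 3,
      Function.Injective
        ((QuotientGroup.mk' (Subgroup.normalClosure {w})).comp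
          (Monoid.CoprodI.of : G i →* Monoid.CoprodI G)) := by
  have hfin : ∀ i, Finite (G i) := fun i =>
    Nat.finite_of_card_ne_zero (by rw [hcard]; exact (hp i).pos.ne')
  have hmem : ∀ i (g : G i), g ∈ Subgroup.zpowers (gen i) := by
    intro i g; rw [hgen]; trivial
  have hord : ∀ i, orderOf (gen i) = p i := by
    intro i
    rw [← hcard, orderOf_eq_card_of_forall_mem_zpowers (hmem i)]
  obtain ⟨L, hL⟩ := exists_word gen hgen w
  have hcount : ∀ i, ¬ p i ∣ L.count i := by
    intro i hd
    apply hw i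
    rw [hL, retract_word, ← orderOf_dvd_iff_pow_eq_one, hord]
    exact hd
  choose j m u hj hu1 hu2 hju using fun i => exists_angle (p i) (L.count i) (hp i) (hcount i)
  have hpR : ∀ i, (p i : ℝ) ≠ 0 := fun i => by exact_mod_cast (hp i).pos.ne'
  let y : Fin 3 → ℝ := fun i => π * j i / p i
  obtain ⟨t, s, x, r1, r2, r3⟩ := exists_real y L u m hu1 hu2 (by
    intro i
    have := hju i
    have h2 := hpR i
    simp only [y]
    field_simp
    linear_combination this)
  have hne : ∀ i, gq y t s x i ≠ 0 := by
    intro i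
    obtain ⟨a, b, c, h, e⟩ := gq_eq y t s x i
    rw [e]; exact qq_ne _ _ _ _ h
  let Q : Fin 3 → (Quaternion ℝ)ˣ := fun i => Units.mk0 _ (hne i)
  have hQp : ∀ i, orderOf (MulAut.conj (Q i)) ∣ orderOf (gen i) := by
    intro i
    rw [hord, orderOf_dvd_iff_pow_eq_one, ← map_pow]
    obtain ⟨a, b, c, h, e⟩ := gq_eq y t s x i
    have e2 : ((Q i ^ p i : (Quaternion ℝ)ˣ) : Quaternion ℝ) = qq (j i * π) a b c := by
      rw [Units.val_pow_eq_pow_val]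
      simp only [Q, Units.val_mk0, e, qq_pow _ _ _ _ h]
      congr 1
      simp only [y]
      have := hpR i
      field_simp
    apply conj_eq_one_of_real <;> rw [e2] <;> simp [qq, sin_nat_mul_pi]
  let ρi : ∀ i, G i →* MulAut (Quaternion ℝ)ˣ := fun i =>
    monoidHomOfForallMemZpowers (hmem i) (hQp i)
  have hρi : ∀ i, ρi i (gen i) = MulAut.conj (Q i) := fun i =>
    monoidHomOfForallMemZpowers_apply_gen _ _
  let ρ : Monoid.CoprodI G →* MulAut (Quaternion ℝ)ˣ := Monoid.CoprodI.lift ρi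
  have hρw : ρ w = 1 := by
    have e1 : ρ w = MulAut.conj ((L.map Q).prod) := by
      rw [hL, map_list_prod, map_list_prod, List.map_map, List.map_map]
      congr 2
      funext i
      simp only [Function.comp, ρ, Monoid.CoprodI.lift_of, hρi]
    have e2 : (((L.map Q).prod : (Quaternion ℝ)ˣ) : Quaternion ℝ) = wq y L t s x := by
      rw [wq, ← Units.coeHom_apply, map_list_prod, List.map_map]
      rfl
    rw [e1]
    apply conj_eq_one_of_real <;> rw [e2] <;> assumption
  have hker : Subgroup.normalClosure {w} ≤ ρ.ker := by
    apply Subgroup.normalClosure_le_normal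
    rintro _ rfl
    exact hρw
  intro i
  rw [injective_iff_map_eq_one]
  intro g hg
  rw [MonoidHom.comp_apply, QuotientGroup.mk'_apply, QuotientGroup.eq_one_iff] at hg
  have hg1 : ρi i g = 1 := by
    have : ρ (Monoid.CoprodI.of g) = 1 := hker hg
    simpa only [ρ, Monoid.CoprodI.lift_of] using this
  have hg2 := hmem i g
  rw [← mem_powers_iff_mem_zpowers] at hg2
  obtain ⟨n, rfl⟩ := hg2
  simp only [map_pow, hρi] at hg1
  rw [← map_pow] at hg1
  obtain ⟨q1, q2, q3⟩ := real_of_conj_eq_one _ hg1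
  obtain ⟨a, b, c, h, e⟩ := gq_eq y t s x i
  have e2 : ((Q i ^ n : (Quaternion ℝ)ˣ) : Quaternion ℝ) = qq (n * y i) a b c := by
    rw [Units.val_pow_eq_pow_val]
    simp only [Q, Units.val_mk0, e, qq_pow _ _ _ _ h]
  rw [e2] at q1 q2 q3
  simp only [qq, mkQ_imI, mkQ_imJ, mkQ_imK] at q1 q2 q3
  have hs : sin (n * y i) = 0 := by
    have : sin (n * y i) ^ 2 = 0 := by
      linear_combination (- sin (n * y i) ^ 2) * h + a * sin (n * y i) * q1
        + b * sin (n * y i) * q2 + c * sin (n * y i) * q3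
    exact pow_eq_zero_iff (two_ne_zero) |>.1 this
  obtain ⟨N, hN⟩ := sin_eq_zero_iff.1 hs
  have hd : (p i : ℤ) ∣ n * j i := by
    refine ⟨N, ?_⟩
    have h2 := hpR i
    have h3 : (p i : ℝ) * N = n * j i := by
      apply mul_right_cancel₀ pi_ne_zero
      have : (N : ℝ) * π * p i = n * y i * p i := by rw [hN]
      simp only [y] at this
      field_simp at this
      linear_combination π * this
    have h4 : (p i : ℤ) * N = n * j i := by exact_mod_cast h3
    exact h4.symm
  have hd2 : p i ∣ n := by
    have : p i ∣ n * j i := by exact_mod_cast hd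
    exact (hj i).dvd_of_dvd_mul_right this
  change gen i ^ n = 1
  rw [← orderOf_dvd_iff_pow_eq_one, hord]
  exact hd2
end

section
/- Let G_a, G_b, G_c be nontrivial cyclic groups and let w be any element of the free product G_a*G_b*G_c. Then the one-relator product G = (G_a*G_b*G_c)/N(w) contains a Freiheitssatz factor: at least one of the three natural maps G_a → G, G_b → G, G_c → G is injective. -/
open Monoid

namespace Freih
open MeasureTheory Set

noncomputable section

abbrev E3 := Fin 3 → ℝ

def det3 (a b c : Fin 3 → ℝ) : ℝ :=
  a 0 * (b 1 * c 2 - b 2 * c 1) + a 1 * (b 2 * c 0 - b 0 * c 2) + a 2 * (b 0 * c 1 - b 1 * c 0)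

def bas (i : Fin 3) : E3 := Pi.single i 1

def DD (n : Fin 3 → E3 → ℝ) (i : Fin 3) (x : E3) : Fin 3 → ℝ := fun j => fderiv ℝ (n j) x (bas i)

def FF (n : Fin 3 → E3 → ℝ) (i : Fin 3) (x : E3) : ℝ :=
  det3 (fun j => n j x) (DD n (i+1) x) (DD n (i+2) x)

lemma hasFDerivAt_det3 {a b c : Fin 3 → E3 → ℝ} {a' b' c' : Fin 3 → E3 →L[ℝ] ℝ} {x : E3}
    (ha : ∀ j, HasFDerivAt (a j) (a' j) x) (hb : ∀ j, HasFDerivAt (b j) (b' j) x)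
    (hc : ∀ j, HasFDerivAt (c j) (c' j) x) :
    ∃ L : E3 →L[ℝ] ℝ,
      HasFDerivAt (fun y => det3 (fun j => a j y) (fun j => b j y) (fun j => c j y)) L x ∧
      ∀ v, L v = det3 (fun j => a' j v) (fun j => b j x) (fun j => c j x)
        + det3 (fun j => a j x) (fun j => b' j v) (fun j => c j x)
        + det3 (fun j => a j x) (fun j => b j x) (fun j => c' j v) := by
  refine ⟨_, (((ha 0).fun_mul (((hb 1).fun_mul (hc 2)).fun_sub ((hb 2).fun_mul (hc 1)))).fun_add
    ((ha 1).fun_mul (((hb 2).fun_mul (hc 0)).fun_sub ((hb 0).fun_mul (hc 2))))).fun_add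
    ((ha 2).fun_mul (((hb 0).fun_mul (hc 1)).fun_sub ((hb 1).fun_mul (hc 0)))), ?_⟩
  intro v
  simp [det3]
  ring

lemma hasFDerivAt_DD {n : Fin 3 → E3 → ℝ} (hn : ∀ j, ContDiff ℝ 2 (n j)) (i j : Fin 3) (x : E3) :
    HasFDerivAt (fun y => DD n i y j)
      ((fderiv ℝ (fderiv ℝ (n j)) x).flip (bas i)) x := by
  have h1 : ContDiff ℝ 1 (fderiv ℝ (n j)) := (hn j).fderiv_right (by norm_num)
  have h2 := (h1.differentiable (by norm_num) x).hasFDerivAt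
  have := h2.clm_apply (hasFDerivAt_const (bas i) x)
  rw [ContinuousLinearMap.comp_zero, zero_add] at this
  exact this

lemma symm2 {n : Fin 3 → E3 → ℝ} (hn : ∀ j, ContDiff ℝ 2 (n j)) (j : Fin 3) (x u v : E3) :
    fderiv ℝ (fderiv ℝ (n j)) x u v = fderiv ℝ (fderiv ℝ (n j)) x v u :=
  ((hn j).contDiffAt.isSymmSndFDerivAt (by simp)).eq u v

lemma ortho {n : Fin 3 → E3 → ℝ} (hn : ∀ j, ContDiff ℝ 2 (n j))
    (h1 : ∀ x, n 0 x ^ 2 + n 1 x ^ 2 + n 2 x ^ 2 = 1) (x v : E3) :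
    n 0 x * fderiv ℝ (n 0) x v + n 1 x * fderiv ℝ (n 1) x v + n 2 x * fderiv ℝ (n 2) x v = 0 := by
  have hd : ∀ j, HasFDerivAt (n j) (fderiv ℝ (n j) x) x := fun j =>
    ((hn j).differentiable (by norm_num) x).hasFDerivAt
  have h := (((hd 0).fun_mul (hd 0)).fun_add ((hd 1).fun_mul (hd 1))).fun_add ((hd 2).fun_mul (hd 2))
  have h0 : HasFDerivAt (fun y => n 0 y * n 0 y + n 1 y * n 1 y + n 2 y * n 2 y)
      (0 : E3 →L[ℝ] ℝ) x := by
    have : (fun y => n 0 y * n 0 y + n 1 y * n 1 y + n 2 y * n 2 y) = fun _ => (1:ℝ) := by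
      funext y; rw [← h1 y]; ring
    rw [this]; exact hasFDerivAt_const _ _
  have := congrArg (fun L => L v) (h.unique h0)
  simp at this
  linarith

lemma det_zero {m a b c : Fin 3 → ℝ} (h1 : m 0 ^ 2 + m 1 ^ 2 + m 2 ^ 2 = 1)
    (ha : m 0 * a 0 + m 1 * a 1 + m 2 * a 2 = 0) (hb : m 0 * b 0 + m 1 * b 1 + m 2 * b 2 = 0)
    (hc : m 0 * c 0 + m 1 * c 1 + m 2 * c 2 = 0) : det3 a b c = 0 := by
  have e0 : m 0 * det3 a b c = 0 := by
    unfold det3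
    linear_combination (b 1 * c 2 - b 2 * c 1) * ha + (c 1 * a 2 - c 2 * a 1) * hb +
      (a 1 * b 2 - a 2 * b 1) * hc
  have e1 : m 1 * det3 a b c = 0 := by
    unfold det3
    linear_combination (b 2 * c 0 - b 0 * c 2) * ha + (c 2 * a 0 - c 0 * a 2) * hb +
      (a 2 * b 0 - a 0 * b 2) * hc
  have e2 : m 2 * det3 a b c = 0 := by
    unfold det3
    linear_combination (b 0 * c 1 - b 1 * c 0) * ha + (c 0 * a 1 - c 1 * a 0) * hb +
      (a 0 * b 1 - a 1 * b 0) * hc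
  linear_combination m 0 * e0 + m 1 * e1 + m 2 * e2 - det3 a b c * h1

lemma div_zero' {n : Fin 3 → E3 → ℝ} (hn : ∀ j, ContDiff ℝ 2 (n j))
    (h1 : ∀ x, n 0 x ^ 2 + n 1 x ^ 2 + n 2 x ^ 2 = 1) :
    ∃ f' : Fin 3 → E3 → E3 →L[ℝ] ℝ, (∀ i x, HasFDerivAt (FF n i) (f' i x) x) ∧
      ∀ x, ∑ i, f' i x (Pi.single i 1) = 0 := by
  have hd : ∀ j x, HasFDerivAt (n j) (fderiv ℝ (n j) x) x := fun j x =>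
    ((hn j).differentiable (by norm_num) x).hasFDerivAt
  have key := fun i x => hasFDerivAt_det3 (fun j => hd j x)
    (fun j => hasFDerivAt_DD hn (i+1) j x) (fun j => hasFDerivAt_DD hn (i+2) j x)
  choose L hL hv using key
  refine ⟨L, hL, fun x => ?_⟩
  have hz : det3 (DD n 0 x) (DD n 1 x) (DD n 2 x) = 0 :=
    det_zero (m := fun j => n j x) (h1 x) (ortho hn h1 x _) (ortho hn h1 x _) (ortho hn h1 x _)
  have hs := symm2 hn
  rw [Fin.sum_univ_three, hv, hv, hv]
  simp only [ContinuousLinearMap.flip_apply]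
  change det3 (fun j => fderiv ℝ (n j) x (bas 0)) (fun j => DD n 1 x j) (fun j => DD n 2 x j)
    + det3 (fun j => n j x) (fun j => fderiv ℝ (fderiv ℝ (n j)) x (bas 0) (bas 1))
      (fun j => DD n 2 x j)
    + det3 (fun j => n j x) (fun j => DD n 1 x j)
      (fun j => fderiv ℝ (fderiv ℝ (n j)) x (bas 0) (bas 2))
    + (det3 (fun j => fderiv ℝ (n j) x (bas 1)) (fun j => DD n 2 x j) (fun j => DD n 0 x j)
    + det3 (fun j => n j x) (fun j => fderiv ℝ (fderiv ℝ (n j)) x (bas 1) (bas 2))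
      (fun j => DD n 0 x j)
    + det3 (fun j => n j x) (fun j => DD n 2 x j)
      (fun j => fderiv ℝ (fderiv ℝ (n j)) x (bas 1) (bas 0)))
    + (det3 (fun j => fderiv ℝ (n j) x (bas 2)) (fun j => DD n 0 x j) (fun j => DD n 1 x j)
    + det3 (fun j => n j x) (fun j => fderiv ℝ (fderiv ℝ (n j)) x (bas 2) (bas 0))
      (fun j => DD n 1 x j)
    + det3 (fun j => n j x) (fun j => DD n 0 x j)
      (fun j => fderiv ℝ (fderiv ℝ (n j)) x (bas 2) (bas 1))) = 0
  simp only [hs _ x (bas 1) (bas 0), hs _ x (bas 2) (bas 0), hs _ x (bas 2) (bas 1)]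
  simp only [det3, DD] at hz ⊢
  linear_combination 3 * hz

lemma cont_FF {n : Fin 3 → E3 → ℝ} (hn : ∀ j, ContDiff ℝ 2 (n j))
    (h1 : ∀ x, n 0 x ^ 2 + n 1 x ^ 2 + n 2 x ^ 2 = 1) (i : Fin 3) : Continuous (FF n i) := by
  obtain ⟨f', h, -⟩ := div_zero' hn h1
  exact continuous_iff_continuousAt.2 fun x => (h i x).continuousAt

/-- derivative of `n j` along a coordinate line -/
lemma line_deriv {g : E3 → ℝ} (hg : Differentiable ℝ g) (x : E3) (i : Fin 3) :
    HasDerivAt (fun s => g (Function.update x i s)) (fderiv ℝ g x (bas i)) (x i) := by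
  have h := hasDerivAt_update x i (x i)
  have hg' : HasFDerivAt g (fderiv ℝ g x) (Function.update x i (x i)) := by
    rw [Function.update_eq_self]; exact (hg x).hasFDerivAt
  exact hg'.comp_hasDerivAt (x i) h

def loB : E3 := ![0, 0, 0]
def hiB : E3 := ![Real.pi, Real.pi, 2 * Real.pi]

/-- On a face `t = t0` where `n` is rotation equivariant. -/
lemma face_integral {n : Fin 3 → E3 → ℝ} (hn : ∀ j, ContDiff ℝ 2 (n j))
    (h1 : ∀ x, n 0 x ^ 2 + n 1 x ^ 2 + n 2 x ^ 2 = 1) (t : ℝ)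
    (e0 : ∀ θ φ, n 0 ![t, θ, φ] = Real.cos φ * n 0 ![t, θ, 0] - Real.sin φ * n 1 ![t, θ, 0])
    (e1 : ∀ θ φ, n 1 ![t, θ, φ] = Real.sin φ * n 0 ![t, θ, 0] + Real.cos φ * n 1 ![t, θ, 0])
    (e2 : ∀ θ φ, n 2 ![t, θ, φ] = n 2 ![t, θ, 0]) :
    ∫ y in Icc (![0,0] : Fin 2 → ℝ) ![Real.pi, 2 * Real.pi], FF n 0 ![t, y 0, y 1]
      = (2 * Real.pi) * (n 2 ![t, 0, 0] - n 2 ![t, Real.pi, 0]) := by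
  have hdiff : ∀ j, Differentiable ℝ (n j) := fun j => (hn j).differentiable (by norm_num)
  have hF : ∀ θ φ, FF n 0 ![t, θ, φ] = - fderiv ℝ (n 2) ![t, θ, φ] (bas 1) := by
    intro θ φ
    have upd : ∀ s, Function.update ![t, θ, φ] 2 s = ![t, θ, s] := by
      intro s; ext j; fin_cases j <;> simp [Function.update]
    have l := fun j => line_deriv (hdiff j) ![t, θ, φ] 2
    simp only [upd] at l
    have d0 : fderiv ℝ (n 0) ![t, θ, φ] (bas 2) = - n 1 ![t, θ, φ] := by
      have := l 0
      rw [show (fun s => n 0 ![t, θ, s]) = fun s => Real.cos s * n 0 ![t, θ, 0]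
        - Real.sin s * n 1 ![t, θ, 0] from funext fun s => e0 θ s] at this
      have h' := ((Real.hasDerivAt_cos φ).mul_const (n 0 ![t, θ, 0])).fun_sub
        ((Real.hasDerivAt_sin φ).mul_const (n 1 ![t, θ, 0]))
      rw [this.unique h', e1 θ φ]; ring
    have d1 : fderiv ℝ (n 1) ![t, θ, φ] (bas 2) = n 0 ![t, θ, φ] := by
      have := l 1
      rw [show (fun s => n 1 ![t, θ, s]) = fun s => Real.sin s * n 0 ![t, θ, 0]
        + Real.cos s * n 1 ![t, θ, 0] from funext fun s => e1 θ s] at this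
      have h' := ((Real.hasDerivAt_sin φ).mul_const (n 0 ![t, θ, 0])).fun_add
        ((Real.hasDerivAt_cos φ).mul_const (n 1 ![t, θ, 0]))
      rw [this.unique h', e0 θ φ]; ring
    have d2 : fderiv ℝ (n 2) ![t, θ, φ] (bas 2) = 0 := by
      have := l 2
      rw [show (fun s => n 2 ![t, θ, s]) = fun s => n 2 ![t, θ, 0] from
        funext fun s => e2 θ s] at this
      exact this.unique (hasDerivAt_const _ _)
    have ho := ortho hn h1 ![t, θ, φ] (bas 1)
    have hh := h1 ![t, θ, φ]
    simp only [FF, det3, DD, zero_add, d0, d1, d2]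
    linear_combination n 2 ![t, θ, φ] * ho - fderiv ℝ (n 2) ![t, θ, φ] (bas 1) * hh
  simp only [hF]
  -- two-dimensional divergence theorem
  let emb : (Fin 2 → ℝ) → E3 := fun y => ![t, y 0, y 1]
  have hemb : ∀ y, HasFDerivAt emb (ContinuousLinearMap.pi ![0, ContinuousLinearMap.proj 0,
      ContinuousLinearMap.proj 1] : (Fin 2 → ℝ) →L[ℝ] E3) y := by
    intro y
    rw [hasFDerivAt_pi']
    intro i
    fin_cases i
    · exact hasFDerivAt_const t y
    · exact (ContinuousLinearMap.proj (R := ℝ) (φ := fun _ : Fin 2 => ℝ) 0).hasFDerivAt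
    · exact (ContinuousLinearMap.proj (R := ℝ) (φ := fun _ : Fin 2 => ℝ) 1).hasFDerivAt
  have hcomp : ∀ y, HasFDerivAt (fun y => - n 2 (emb y)) (-((fderiv ℝ (n 2) (emb y)).comp
      (ContinuousLinearMap.pi ![0, ContinuousLinearMap.proj 0,
      ContinuousLinearMap.proj 1] : (Fin 2 → ℝ) →L[ℝ] E3))) y := fun y =>
    ((hdiff 2 (emb y)).hasFDerivAt.comp y (hemb y)).neg
  let f : Fin 2 → (Fin 2 → ℝ) → ℝ := ![fun y => - n 2 (emb y), fun _ => 0]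
  let f' : Fin 2 → (Fin 2 → ℝ) → (Fin 2 → ℝ) →L[ℝ] ℝ := ![fun y => -((fderiv ℝ (n 2) (emb y)).comp
      (ContinuousLinearMap.pi ![0, ContinuousLinearMap.proj 0,
      ContinuousLinearMap.proj 1] : (Fin 2 → ℝ) →L[ℝ] E3)), fun _ => 0]
  have hff : ∀ x i, HasFDerivAt (f i) (f' i x) x := by
    intro x i
    fin_cases i
    · exact hcomp x
    · exact hasFDerivAt_const _ _
  have hcf : ∀ i, Continuous (f i) := fun i =>
    continuous_iff_continuousAt.2 fun x => (hff x i).continuousAt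
  have hsum : ∀ x, ∑ i, f' i x (Pi.single i 1) = - fderiv ℝ (n 2) ![t, x 0, x 1] (bas 1) := by
    intro x
    rw [Fin.sum_univ_two]
    simp only [f', Matrix.cons_val_zero, Matrix.cons_val_one]
    simp only [_root_.neg_apply, ContinuousLinearMap.comp_apply,
      _root_.zero_apply, add_zero]
    congr 2
    ext j; fin_cases j <;> simp [bas]
  have hcont : Continuous fun x : Fin 2 → ℝ => - fderiv ℝ (n 2) ![t, x 0, x 1] (bas 1) := by
    have c1 : Continuous (fderiv ℝ (n 2)) := (hn 2).continuous_fderiv (by norm_num)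
    have c2 : Continuous emb := continuous_iff_continuousAt.2 fun x => (hemb x).continuousAt
    exact ((c1.comp c2).clm_apply continuous_const).neg
  have hle : (![0,0] : Fin 2 → ℝ) ≤ ![Real.pi, 2 * Real.pi] := by
    intro i; fin_cases i <;> simp [Real.pi_pos.le]
  have := integral_divergence_of_hasFDerivAt_off_countable' (![0,0] : Fin 2 → ℝ)
    ![Real.pi, 2 * Real.pi] hle f f' ∅ countable_empty (fun i => (hcf i).continuousOn)
    (fun x _ i => hff x i) (by
      simp only [hsum]
      exact hcont.continuousOn.integrableOn_compact isCompact_Icc)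
  simp only [hsum] at this
  rw [this, Fin.sum_univ_two]
  have hvol : (volume : Measure (Fin 1 → ℝ)).real (Icc ((![0,0] : Fin 2 → ℝ) ∘ Fin.succAbove 0)
      (![Real.pi, 2 * Real.pi] ∘ Fin.succAbove 0)) = 2 * Real.pi := by
    rw [Measure.real, Real.volume_Icc_pi]
    simp [Real.pi_pos.le]
  have ev : ∀ (s : ℝ) (x : Fin 1 → ℝ), f 0 ((0 : Fin 2).insertNth s x) = - n 2 ![t, s, 0] := by
    intro s x
    rw [← e2 s (x 0)]
    rfl
  have ev1 : ∀ x, f 1 x = 0 := fun x => rfl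
  simp only [ev, ev1, setIntegral_const, hvol]
  simp
  ring

theorem degree_thm {n : Fin 3 → E3 → ℝ} (hn : ∀ j, ContDiff ℝ 2 (n j))
    (h1 : ∀ x, n 0 x ^ 2 + n 1 x ^ 2 + n 2 x ^ 2 = 1)
    (hper : ∀ j x, n j (x + ![0, 0, 2 * Real.pi]) = n j x)
    (hpole : ∀ j t φ, n j ![t, 0, φ] = n j ![t, 0, 0])
    (hpole' : ∀ j t φ, n j ![t, Real.pi, φ] = n j ![t, Real.pi, 0])
    (heq : ∀ t, (t = 0 ∨ t = Real.pi) → ∀ θ φ,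
      n 0 ![t, θ, φ] = Real.cos φ * n 0 ![t, θ, 0] - Real.sin φ * n 1 ![t, θ, 0] ∧
      n 1 ![t, θ, φ] = Real.sin φ * n 0 ![t, θ, 0] + Real.cos φ * n 1 ![t, θ, 0] ∧
      n 2 ![t, θ, φ] = n 2 ![t, θ, 0]) :
    n 2 ![0, 0, 0] - n 2 ![0, Real.pi, 0] =
      n 2 ![Real.pi, 0, 0] - n 2 ![Real.pi, Real.pi, 0] := by
  have hdiff : ∀ j, Differentiable ℝ (n j) := fun j => (hn j).differentiable (by norm_num)
  obtain ⟨f', hf', hdiv⟩ := div_zero' hn h1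
  have hle : loB ≤ hiB := by
    intro i; fin_cases i <;> simp [loB, hiB, Real.pi_pos.le]
  have main := integral_divergence_of_hasFDerivAt_off_countable' loB hiB hle (FF n) f' ∅
    countable_empty (fun i => (cont_FF hn h1 i).continuousOn) (fun x _ i => hf' i x) (by
      simp only [hdiv]
      exact integrableOn_zero)
  simp only [hdiv, integral_zero] at main
  rw [Fin.sum_univ_three] at main
  -- periodic faces cancel
  have hDper : ∀ i x, DD n i (x + ![0, 0, 2 * Real.pi]) = DD n i x := by
    intro i x
    funext j
    have : (fun y => n j (y + ![0, 0, 2 * Real.pi])) = n j := funext fun y => hper j y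
    have h := fderiv_comp_add_right (𝕜 := ℝ) (f := n j) (x := x) ![0, 0, 2 * Real.pi]
    rw [this] at h
    simp only [DD, h]
  have hFper : ∀ i x, FF n i (x + ![0, 0, 2 * Real.pi]) = FF n i x := by
    intro i x
    simp only [FF, hDper, hper]
  have p2 : ∀ x : Fin 2 → ℝ, FF n 2 ((2 : Fin 3).insertNth (hiB 2) x) =
      FF n 2 ((2 : Fin 3).insertNth (loB 2) x) := by
    intro x
    rw [← hFper 2 ((2 : Fin 3).insertNth (loB 2) x)]
    congr 1
    ext j
    fin_cases j
    · change x 0 = x 0 + 0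
      simp
    · change x 1 = x 1 + 0
      simp
    · change 2 * Real.pi = 0 + 2 * Real.pi
      simp
  have pz : ∀ θ, (∀ j t φ, n j ![t, θ, φ] = n j ![t, θ, 0]) → ∀ t φ, FF n 1 ![t, θ, φ] = 0 := by
    intro θ h t φ
    have hz : DD n 2 ![t, θ, φ] = 0 := by
      funext j
      have upd : ∀ s, Function.update ![t, θ, φ] 2 s = ![t, θ, s] := by
        intro s; ext j; fin_cases j <;> simp [Function.update]
      have l := line_deriv (hdiff j) ![t, θ, φ] 2
      simp only [upd] at l
      rw [show (fun s => n j ![t, θ, s]) = fun s => n j ![t, θ, 0] from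
        funext fun s => h j t s] at l
      exact l.unique (hasDerivAt_const _ _)
    have : FF n 1 ![t, θ, φ] = det3 (fun j => n j ![t, θ, φ]) (DD n 2 ![t, θ, φ])
      (DD n 0 ![t, θ, φ]) := rfl
    rw [this, hz]
    simp [det3]
  have q1 : ∀ x : Fin 2 → ℝ, FF n 1 ((1 : Fin 3).insertNth (hiB 1) x) = 0 := by
    intro x
    have : ((1 : Fin 3).insertNth (hiB 1) x : E3) = ![x 0, Real.pi, x 1] := by
      ext j; fin_cases j <;> rfl
    rw [this]
    exact pz _ hpole' _ _
  have q2 : ∀ x : Fin 2 → ℝ, FF n 1 ((1 : Fin 3).insertNth (loB 1) x) = 0 := by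
    intro x
    have : ((1 : Fin 3).insertNth (loB 1) x : E3) = ![x 0, 0, x 1] := by
      ext j; fin_cases j <;> rfl
    rw [this]
    exact pz _ hpole _ _
  have r1 : ∀ x : Fin 2 → ℝ, ((0 : Fin 3).insertNth (hiB 0) x : E3) = ![Real.pi, x 0, x 1] := by
    intro x
    ext j; fin_cases j <;> rfl
  have r2 : ∀ x : Fin 2 → ℝ, ((0 : Fin 3).insertNth (loB 0) x : E3) = ![0, x 0, x 1] := by
    intro x
    ext j; fin_cases j <;> rfl
  simp only [p2, q1, q2, r1, r2, sub_self, add_zero] at main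
  have b1 : loB ∘ Fin.succAbove 0 = (![0, 0] : Fin 2 → ℝ) := by
    ext j; fin_cases j <;> rfl
  have b2 : hiB ∘ Fin.succAbove 0 = (![Real.pi, 2 * Real.pi] : Fin 2 → ℝ) := by
    ext j; fin_cases j <;> rfl
  rw [b1, b2, face_integral hn h1 0 (fun θ φ => (heq 0 (Or.inl rfl) θ φ).1)
    (fun θ φ => (heq 0 (Or.inl rfl) θ φ).2.1) (fun θ φ => (heq 0 (Or.inl rfl) θ φ).2.2),
    face_integral hn h1 Real.pi (fun θ φ => (heq _ (Or.inr rfl) θ φ).1)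
    (fun θ φ => (heq _ (Or.inr rfl) θ φ).2.1) (fun θ φ => (heq _ (Or.inr rfl) θ φ).2.2)] at main
  have hp := Real.pi_pos
  have : 2 * Real.pi ≠ 0 := by positivity
  have := mul_left_cancel₀ this (sub_eq_zero.1 main.symm)
  exact this.symm

end
end Freih
namespace Freih
noncomputable section
open Quaternion

abbrev U := unitary (Quaternion ℝ)

def qq (a b c d : ℝ) : ℍ[ℝ] := ⟨a, b, c, d⟩

@[simp] lemma qq_re (a b c d : ℝ) : (qq a b c d).re = a := rfl
@[simp] lemma qq_imI (a b c d : ℝ) : (qq a b c d).imI = b := rfl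
@[simp] lemma qq_imJ (a b c d : ℝ) : (qq a b c d).imJ = c := rfl
@[simp] lemma qq_imK (a b c d : ℝ) : (qq a b c d).imK = d := rfl

lemma qq_mem (a b c d : ℝ) (h : a ^ 2 + b ^ 2 + c ^ 2 + d ^ 2 = 1) :
    qq a b c d ∈ unitary (Quaternion ℝ) := by
  rw [Unitary.mem_iff]
  constructor <;> ext <;> simp <;> nlinarith

def ek (a : ℝ) : U := ⟨qq (Real.cos a) 0 0 (Real.sin a), qq_mem _ _ _ _ (by
  have h := Real.sin_sq_add_cos_sq a
  linarith)⟩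

def ej (a : ℝ) : U := ⟨qq (Real.cos (a/2)) 0 (Real.sin (a/2)) 0, qq_mem _ _ _ _ (by
  have h := Real.sin_sq_add_cos_sq (a/2)
  linarith)⟩

@[simp] lemma ek_re (a : ℝ) : (ek a : ℍ[ℝ]).re = Real.cos a := rfl
@[simp] lemma ek_imI (a : ℝ) : (ek a : ℍ[ℝ]).imI = 0 := rfl
@[simp] lemma ek_imJ (a : ℝ) : (ek a : ℍ[ℝ]).imJ = 0 := rfl
@[simp] lemma ek_imK (a : ℝ) : (ek a : ℍ[ℝ]).imK = Real.sin a := rfl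
@[simp] lemma ej_re (a : ℝ) : (ej a : ℍ[ℝ]).re = Real.cos (a/2) := rfl
@[simp] lemma ej_imI (a : ℝ) : (ej a : ℍ[ℝ]).imI = 0 := rfl
@[simp] lemma ej_imJ (a : ℝ) : (ej a : ℍ[ℝ]).imJ = Real.sin (a/2) := rfl
@[simp] lemma ej_imK (a : ℝ) : (ej a : ℍ[ℝ]).imK = 0 := rfl

lemma coe_inv_U (u : U) : ((u⁻¹ : U) : ℍ[ℝ]) = star (u : ℍ[ℝ]) := rfl

lemma ek_add (a b : ℝ) : ek (a + b) = ek a * ek b := by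
  apply Subtype.ext
  ext <;> simp [Real.cos_add, Real.sin_add]
  ring

lemma ek_zero : ek 0 = 1 := by
  apply Subtype.ext
  ext <;> simp

lemma ej_zero : ej 0 = 1 := by
  apply Subtype.ext
  ext <;> simp

def ekHom : Multiplicative ℝ →* U where
  toFun a := ek a.toAdd
  map_one' := ek_zero
  map_mul' _ _ := ek_add _ _

lemma ek_comm (a b : ℝ) : ek a * ek b = ek b * ek a := by
  rw [← ek_add, ← ek_add, add_comm]

lemma ek_zpow (a : ℝ) (i : ℤ) : ek a ^ i = ek (i * a) := by
  have := map_zpow ekHom (Multiplicative.ofAdd a) i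
  have h2 : ekHom (Multiplicative.ofAdd a ^ i) = ek (i * a) := by
    simp [ekHom]
  rw [← h2, this]; rfl

lemma ej_pi_conj (b : ℝ) : ej Real.pi * ek b * (ej Real.pi)⁻¹ = ek (-b) := by
  apply Subtype.ext
  ext <;> simp [coe_inv_U]

/-- smoothness of a family of unit quaternions -/
def Sm (g : E3 → U) : Prop :=
  ContDiff ℝ 2 (fun x => (g x : ℍ[ℝ]).re) ∧ ContDiff ℝ 2 (fun x => (g x : ℍ[ℝ]).imI) ∧
  ContDiff ℝ 2 (fun x => (g x : ℍ[ℝ]).imJ) ∧ ContDiff ℝ 2 (fun x => (g x : ℍ[ℝ]).imK)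

lemma Sm.mul {g h : E3 → U} (hg : Sm g) (hh : Sm h) : Sm (fun x => g x * h x) := by
  obtain ⟨a, b, c, d⟩ := hg
  obtain ⟨a', b', c', d'⟩ := hh
  refine ⟨?_, ?_, ?_, ?_⟩ <;> simp <;> fun_prop

lemma Sm.inv {g : E3 → U} (hg : Sm g) : Sm (fun x => (g x)⁻¹) := by
  obtain ⟨a, b, c, d⟩ := hg
  refine ⟨?_, ?_, ?_, ?_⟩ <;> simp [coe_inv_U] <;> fun_prop

lemma Sm.ek {f : E3 → ℝ} (hf : ContDiff ℝ 2 f) : Sm (fun x => ek (f x)) := by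
  refine ⟨?_, ?_, ?_, ?_⟩ <;> simp <;> fun_prop

lemma Sm.ej {f : E3 → ℝ} (hf : ContDiff ℝ 2 f) : Sm (fun x => ej (f x)) := by
  refine ⟨?_, ?_, ?_, ?_⟩ <;> simp <;> fun_prop

def conjr (x : E3) : Fin 3 → U := ![1, ej (x 0), ek (x 2 / 2) * ej (x 1)]

def gens (α : Fin 3 → ℝ) (x : E3) : Fin 3 → U := fun i => conjr x i * ek (α i) * (conjr x i)⁻¹

def WW (α : Fin 3 → ℝ) (w : FreeGroup (Fin 3)) (x : E3) : U := FreeGroup.lift (gens α x) w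

lemma sm_gens (α : Fin 3 → ℝ) (i : Fin 3) : Sm (fun x => gens α x i) := by
  have hc : Sm (fun x => conjr x i) := by
    fin_cases i
    · refine ⟨?_, ?_, ?_, ?_⟩ <;> simp [conjr] <;> fun_prop
    · exact Sm.ej (f := fun x => x 0) (by fun_prop)
    · exact (Sm.ek (f := fun x => x 2 / 2) (by fun_prop)).mul
        (Sm.ej (f := fun x => x 1) (by fun_prop))
  exact (hc.mul (Sm.ek contDiff_const)).mul hc.inv

lemma sm_WW (α : Fin 3 → ℝ) (w : FreeGroup (Fin 3)) : Sm (WW α w) := by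
  unfold WW
  induction w using FreeGroup.induction_on with
  | C1 => refine ⟨?_, ?_, ?_, ?_⟩ <;> simp <;> fun_prop
  | of i => simpa using sm_gens α i
  | inv_of i h => simpa using (sm_gens α i).inv
  | mul a b ha hb => simpa using ha.mul hb

/-- exponent sums -/
def ex (i : Fin 3) : FreeGroup (Fin 3) →* Multiplicative ℤ :=
  FreeGroup.lift (fun j => Multiplicative.ofAdd (if j = i then 1 else 0))

def es (i : Fin 3) (w : FreeGroup (Fin 3)) : ℤ := (ex i w).toAdd

lemma lift_ek (α : Fin 3 → ℝ) (w : FreeGroup (Fin 3)) :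
    FreeGroup.lift (fun i => ek (α i)) w = ek (∑ i, es i w * α i) := by
  induction w using FreeGroup.induction_on with
  | C1 => simp [es, ek_zero]
  | of i => fin_cases i <;> simp [es, ex]
  | inv_of i h =>
    have e : ∀ a, (ek a)⁻¹ = ek (-a) := by
      intro a
      rw [inv_eq_iff_mul_eq_one, ← ek_add]; simp [ek_zero]
    fin_cases i <;> simp [es, ex, e]
  | mul a b ha hb =>
    rw [map_mul, ha, hb, ← ek_add, ← Finset.sum_add_distrib]
    congr 1
    apply Finset.sum_congr rfl
    intro i _
    simp [es]; ring

lemma WW_collinear (α α' : Fin 3 → ℝ) (w : FreeGroup (Fin 3)) (x : E3)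
    (h : ∀ i, gens α x i = ek (α' i)) : WW α w x = ek (∑ i, es i w * α' i) := by
  rw [← lift_ek, WW]
  congr 2
  funext i; exact h i

lemma ek_conj (a b : ℝ) : ek a * ek b * (ek a)⁻¹ = ek b := by
  rw [ek_comm]; simp

lemma ej_conj {t : ℝ} (ht : t = 0 ∨ t = Real.pi) (b : ℝ) :
    ∃ b', ej t * ek b * (ej t)⁻¹ = ek b' := by
  rcases ht with rfl | rfl
  · exact ⟨b, by simp [ej_zero]⟩
  · exact ⟨-b, ej_pi_conj b⟩

lemma WW_equiv (α : Fin 3 → ℝ) (w : FreeGroup (Fin 3)) {t : ℝ} (ht : t = 0 ∨ t = Real.pi)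
    (θ φ : ℝ) : WW α w ![t, θ, φ] = ek (φ/2) * WW α w ![t, θ, 0] * (ek (φ/2))⁻¹ := by
  have : FreeGroup.lift (gens α ![t, θ, φ]) =
      (MulAut.conj (ek (φ/2))).toMonoidHom.comp (FreeGroup.lift (gens α ![t, θ, 0])) := by
    ext1 i
    obtain ⟨b', hb'⟩ := ej_conj ht (α 1)
    fin_cases i
    · simp [gens, conjr, ek_conj]
    · simp [gens, conjr, hb', ek_conj]
    · simp [gens, conjr, ek_zero, mul_assoc]
  unfold WW
  rw [this]; rfl

lemma WW_pole (α : Fin 3 → ℝ) (w : FreeGroup (Fin 3)) {θ : ℝ} (ht : θ = 0 ∨ θ = Real.pi)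
    (t φ : ℝ) : WW α w ![t, θ, φ] = WW α w ![t, θ, 0] := by
  unfold WW
  congr 2
  funext i
  obtain ⟨b', hb'⟩ := ej_conj ht (α 2)
  fin_cases i
  · rfl
  · rfl
  · have h : ∀ k : U, k * ej θ * ek (α 2) * (k * ej θ)⁻¹ = k * ek b' * k⁻¹ := by
      intro k; rw [← hb']; group
    change ek (φ/2) * ej θ * ek (α 2) * (ek (φ/2) * ej θ)⁻¹ =
      ek (0/2) * ej θ * ek (α 2) * (ek (0/2) * ej θ)⁻¹
    rw [h, h, ek_conj, ek_conj]

lemma WW_per (α : Fin 3 → ℝ) (w : FreeGroup (Fin 3)) (x : E3) :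
    WW α w (x + ![0, 0, 2 * Real.pi]) = WW α w x := by
  unfold WW
  congr 2
  funext i
  fin_cases i
  · rfl
  · simp [gens, conjr]
  · have hk : ek Real.pi = ⟨-1, by simp [Unitary.mem_iff]⟩ := by
      apply Subtype.ext; ext <;> simp
    have e : (x 2 + 2 * Real.pi) / 2 = x 2 / 2 + Real.pi := by ring
    simp only [gens, conjr]
    apply Subtype.ext
    simp [e, ek_add, hk, coe_inv_U]

theorem exists_solution (α : Fin 3 → ℝ) (w : FreeGroup (Fin 3))
    (h12 : Real.sin (es 0 w * α 0 + es 1 w * α 1 + es 2 w * α 2) *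
      Real.sin (es 0 w * α 0 + es 1 w * α 1 - es 2 w * α 2) < 0)
    (h23 : 0 < Real.sin (es 0 w * α 0 + es 1 w * α 1 - es 2 w * α 2) *
      Real.sin (es 0 w * α 0 - es 1 w * α 1 + es 2 w * α 2))
    (h34 : Real.sin (es 0 w * α 0 - es 1 w * α 1 + es 2 w * α 2) *
      Real.sin (es 0 w * α 0 - es 1 w * α 1 - es 2 w * α 2) < 0) :
    ∃ x, (WW α w x : ℍ[ℝ]).imI = 0 ∧ (WW α w x : ℍ[ℝ]).imJ = 0 ∧ (WW α w x : ℍ[ℝ]).imK = 0 := by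
  by_contra hcon
  let N : E3 → ℝ := fun x => (WW α w x : ℍ[ℝ]).imI ^ 2 + (WW α w x : ℍ[ℝ]).imJ ^ 2
    + (WW α w x : ℍ[ℝ]).imK ^ 2
  have hN : ∀ x, 0 < N x := by
    intro x
    by_contra hx
    apply hcon
    have hx' : (WW α w x : ℍ[ℝ]).imI ^ 2 + (WW α w x : ℍ[ℝ]).imJ ^ 2
      + (WW α w x : ℍ[ℝ]).imK ^ 2 ≤ 0 := not_lt.1 hx
    refine ⟨x, ?_, ?_, ?_⟩ <;> nlinarith [sq_nonneg (WW α w x : ℍ[ℝ]).imI,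
      sq_nonneg (WW α w x : ℍ[ℝ]).imJ, sq_nonneg (WW α w x : ℍ[ℝ]).imK]
  obtain ⟨-, sI, sJ, sK⟩ := sm_WW α w
  have sN : ContDiff ℝ 2 N := by simp only [N]; fun_prop
  have sR : ContDiff ℝ 2 (fun x => √(N x)) := sN.sqrt (fun x => (hN x).ne')
  have hR : ∀ x, √(N x) ≠ 0 := fun x => (Real.sqrt_pos.2 (hN x)).ne'
  have hRR : ∀ x, √(N x) ^ 2 = N x := fun x => Real.sq_sqrt (hN x).le
  let n : Fin 3 → E3 → ℝ := ![fun x => (WW α w x : ℍ[ℝ]).imI / √(N x),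
    fun x => (WW α w x : ℍ[ℝ]).imJ / √(N x), fun x => (WW α w x : ℍ[ℝ]).imK / √(N x)]
  have n0 : ∀ x, n 0 x = (WW α w x : ℍ[ℝ]).imI / √(N x) := fun x => rfl
  have n1 : ∀ x, n 1 x = (WW α w x : ℍ[ℝ]).imJ / √(N x) := fun x => rfl
  have n2 : ∀ x, n 2 x = (WW α w x : ℍ[ℝ]).imK / √(N x) := fun x => rfl
  have ncongr : ∀ x y, WW α w x = WW α w y → ∀ j, n j x = n j y := by
    intro x y h j
    fin_cases j <;> simp [n, N, h]
  have key := degree_thm (n := n)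
    (by
      intro j
      fin_cases j
      · exact sI.div sR hR
      · exact sJ.div sR hR
      · exact sK.div sR hR)
    (by
      intro x
      rw [n0, n1, n2, div_pow, div_pow, div_pow, hRR, ← add_div, ← add_div]
      exact div_self (hN x).ne')
    (fun j x => ncongr _ _ (WW_per α w x) j)
    (fun j t φ => ncongr _ _ (WW_pole α w (Or.inl rfl) t φ) j)
    (fun j t φ => ncongr _ _ (WW_pole α w (Or.inr rfl) t φ) j)
    (by
      intro t ht θ φ
      have h := WW_equiv α w ht θ φ
      have hc : Real.cos φ = Real.cos (φ/2) ^ 2 - Real.sin (φ/2) ^ 2 := by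
        rw [← Real.cos_two_mul']; ring_nf
      have hs : Real.sin φ = 2 * Real.sin (φ/2) * Real.cos (φ/2) := by
        rw [← Real.sin_two_mul]; ring_nf
      have h1 := Real.sin_sq_add_cos_sq (φ/2)
      have eI : (WW α w ![t, θ, φ] : ℍ[ℝ]).imI = Real.cos φ * (WW α w ![t, θ, 0] : ℍ[ℝ]).imI
          - Real.sin φ * (WW α w ![t, θ, 0] : ℍ[ℝ]).imJ := by
        rw [h, hc, hs]; simp [coe_inv_U]; ring
      have eJ : (WW α w ![t, θ, φ] : ℍ[ℝ]).imJ = Real.sin φ * (WW α w ![t, θ, 0] : ℍ[ℝ]).imI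
          + Real.cos φ * (WW α w ![t, θ, 0] : ℍ[ℝ]).imJ := by
        rw [h, hc, hs]; simp [coe_inv_U]; ring
      have eK : (WW α w ![t, θ, φ] : ℍ[ℝ]).imK = (WW α w ![t, θ, 0] : ℍ[ℝ]).imK := by
        rw [h]; simp [coe_inv_U]; linear_combination (WW α w ![t, θ, 0] : ℍ[ℝ]).imK * h1
      have eN : N ![t, θ, φ] = N ![t, θ, 0] := by
        simp only [N]
        rw [eI, eJ, eK]
        linear_combination ((WW α w ![t, θ, 0] : ℍ[ℝ]).imI ^ 2
          + (WW α w ![t, θ, 0] : ℍ[ℝ]).imJ ^ 2) * Real.sin_sq_add_cos_sq φ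
      refine ⟨?_, ?_, ?_⟩
      · rw [n0, n0, n1, eN, eI]; ring
      · rw [n1, n0, n1, eN, eJ]; ring
      · rw [n2, n2, eN, eK])
  have val : ∀ (x : E3) (α' : Fin 3 → ℝ), (∀ i, gens α x i = ek (α' i)) →
      n 2 x = Real.sin (∑ i, es i w * α' i) / |Real.sin (∑ i, es i w * α' i)| := by
    intro x α' h
    have := WW_collinear α α' w x h
    rw [n2]
    simp only [N]
    rw [this]
    simp [Real.sqrt_sq_eq_abs]
  have v1 := val ![0, 0, 0] ![α 0, α 1, α 2] (by
    intro i; fin_cases i <;> simp [gens, conjr, ej_zero, ek_zero])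
  have v2 := val ![0, Real.pi, 0] ![α 0, α 1, - α 2] (by
    intro i; fin_cases i <;> simp [gens, conjr, ej_zero, ek_zero, ← ej_pi_conj])
  have v3 := val ![Real.pi, 0, 0] ![α 0, - α 1, α 2] (by
    intro i; fin_cases i <;> simp [gens, conjr, ej_zero, ek_zero, ← ej_pi_conj])
  have v4 := val ![Real.pi, Real.pi, 0] ![α 0, - α 1, - α 2] (by
    intro i; fin_cases i <;> simp [gens, conjr, ek_zero, ← ej_pi_conj])
  simp only [Fin.sum_univ_three, Matrix.cons_val_zero, Matrix.cons_val_one, Matrix.cons_val,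
    mul_neg, ← sub_eq_add_neg] at v1 v2 v3 v4
  rw [v1, v2, v3, v4] at key
  generalize Real.sin (es 0 w * α 0 + es 1 w * α 1 + es 2 w * α 2) = a1 at *
  generalize Real.sin (es 0 w * α 0 + es 1 w * α 1 - es 2 w * α 2) = a2 at *
  generalize Real.sin (es 0 w * α 0 - es 1 w * α 1 + es 2 w * α 2) = a3 at *
  generalize Real.sin (es 0 w * α 0 - es 1 w * α 1 - es 2 w * α 2) = a4 at *
  have pos : ∀ a : ℝ, 0 < a → a / |a| = 1 := fun a ha => by rw [abs_of_pos ha, div_self ha.ne']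
  have neg : ∀ a : ℝ, a < 0 → a / |a| = -1 := fun a ha => by
    rw [abs_of_neg ha, div_neg, div_self ha.ne]
  rcases mul_neg_iff.1 h12 with ⟨p1, p2⟩ | ⟨p1, p2⟩ <;>
  rcases mul_pos_iff.1 h23 with ⟨p3, p4⟩ | ⟨p3, p4⟩ <;>
  rcases mul_neg_iff.1 h34 with ⟨p5, p6⟩ | ⟨p5, p6⟩ <;>
  first
  | linarith
  | (rw [pos _ p1, neg _ p2, neg _ p4, pos _ p6] at key; norm_num at key)
  | (rw [neg _ p1, pos _ p2, pos _ p4, neg _ p6] at key; norm_num at key)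

end
end Freih
namespace Freih
noncomputable section
open Quaternion

lemma exists_char {G : Type*} [Group G] (a : G) (e s : ℤ) (q : ℕ) (hq : q ≠ 0)
    (hdvd : q ∣ orderOf (a ^ e)) :
    ∃ α : ℝ, (∀ i : ℤ, a ^ i = 1 → ∃ N : ℤ, (i : ℝ) * α = N * Real.pi) ∧
      ∃ N : ℤ, (e : ℝ) * α = Real.pi * s / q + N * Real.pi := by
  have hqR : (q : ℝ) ≠ 0 := Nat.cast_ne_zero.2 hq
  rcases Nat.eq_zero_or_pos (orderOf a) with hm | hm
  · by_cases he : e = 0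
    · subst he
      simp only [zpow_zero, orderOf_one, Nat.dvd_one] at hdvd
      subst hdvd
      refine ⟨0, fun i _ => ⟨0, by simp⟩, -s, ?_⟩
      push_cast; ring
    · have heR : (e : ℝ) ≠ 0 := Int.cast_ne_zero.2 he
      refine ⟨Real.pi * s / (q * e), fun i hi => ⟨0, ?_⟩, 0, ?_⟩
      · have := orderOf_dvd_iff_zpow_eq_one.2 hi
        rw [hm] at this
        have : i = 0 := by simpa using this
        simp [this]
      · field_simp
        simp
  · obtain ⟨m, hmdef⟩ : ∃ m : ℤ, m = orderOf a := ⟨_, rfl⟩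
    have hm0 : m ≠ 0 := by omega
    obtain ⟨d, hd⟩ : ∃ d : ℤ, d = Int.gcd e m := ⟨_, rfl⟩
    have hde : d ∣ e := hd ▸ Int.gcd_dvd_left _ _
    have hdm : d ∣ m := hd ▸ Int.gcd_dvd_right _ _
    obtain ⟨e', he'⟩ := hde
    obtain ⟨n, hn⟩ := hdm
    have h1 : (orderOf (a ^ e) : ℤ) ∣ n := by
      rw [orderOf_dvd_iff_zpow_eq_one, ← zpow_mul, ← orderOf_dvd_iff_zpow_eq_one, ← hmdef]
      exact ⟨e', by rw [he', hn]; ring⟩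
    obtain ⟨r, hr⟩ := (Int.natCast_dvd_natCast.2 hdvd).trans h1
    have bez := Int.gcd_eq_gcd_ab e m
    rw [← hd] at bez
    have hmR : (m : ℝ) ≠ 0 := Int.cast_ne_zero.2 hm0
    have hn' : (m : ℝ) = d * (q * r) := by
      have : m = d * (q * r) := by rw [hn, hr]
      exact_mod_cast this
    have bez' : (d : ℝ) = e * (Int.gcdA e m) + m * (Int.gcdB e m) := by exact_mod_cast bez
    refine ⟨Real.pi * (s * r * Int.gcdA e m) / m, fun i hi => ?_, -(s * r * Int.gcdB e m), ?_⟩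
    · obtain ⟨c, hc⟩ := orderOf_dvd_iff_zpow_eq_one.2 hi
      rw [← hmdef] at hc
      refine ⟨c * (s * r * Int.gcdA e m), ?_⟩
      rw [hc]
      push_cast
      field_simp
    · push_cast
      field_simp
      linear_combination (-(s : ℝ) * r * q) * bez' - (s : ℝ) * hn'

lemma exists_prime_pow {n : ℕ} {t : ℤ} (h : ¬ (n : ℤ) ∣ t) :
    ∃ p k : ℕ, p.Prime ∧ p ^ k ∣ n ∧ ¬ ((p ^ k : ℕ) : ℤ) ∣ t := by
  rw [Int.natCast_dvd, Nat.dvd_iff_prime_pow_dvd_dvd] at h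
  push Not at h
  obtain ⟨p, k, hp, h1, h2⟩ := h
  exact ⟨p, k, hp, h1, by rwa [Int.natCast_dvd]⟩

/-- central iff imaginary part vanishes -/
lemma conj_eq_one_of_im {u : U} (hI : (u : ℍ[ℝ]).imI = 0) (hJ : (u : ℍ[ℝ]).imJ = 0)
    (hK : (u : ℍ[ℝ]).imK = 0) : MulAut.conj u = 1 := by
  ext1 v
  rw [MulAut.conj_apply, MulAut.one_apply, mul_inv_eq_iff_eq_mul]
  apply Subtype.ext
  ext <;> simp [hI, hJ, hK] <;> ring

lemma sin_of_conj {a : ℝ} (h : MulAut.conj (ek a) = 1) : Real.sin a = 0 := by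
  have h1 := congrArg (fun f : MulAut U => f (ej Real.pi)) h
  simp only [MulAut.conj_apply, MulAut.one_apply, mul_inv_eq_iff_eq_mul] at h1
  have h2 := congrArg (fun u : U => (u : ℍ[ℝ]).imI) h1
  simp at h2
  linarith

lemma conj_ek_pi (N : ℤ) : MulAut.conj (ek (N * Real.pi)) = 1 :=
  conj_eq_one_of_im (by simp) (by simp) (by simp [Real.sin_int_mul_pi])

lemma gens_zpow (α : Fin 3 → ℝ) (x : E3) (i : Fin 3) (m : ℤ) :
    MulAut.conj (gens α x i ^ m) = 1 ↔ MulAut.conj (ek (m * α i)) = 1 := by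
  have : gens α x i ^ m = conjr x i * ek (m * α i) * (conjr x i)⁻¹ := by
    rw [gens, conj_zpow, ek_zpow]
  rw [this, map_mul, map_mul, map_inv, mul_inv_eq_one, mul_eq_left]

lemma half_bounds {q : ℕ} (h2 : 2 ≤ q) {x : ℝ} (hx : x = Real.pi * ((q / 2 : ℕ) : ℤ) / q) :
    Real.pi / 3 ≤ x ∧ x ≤ Real.pi / 2 ∧ (q ≠ 3 → 2 * Real.pi / 5 ≤ x) := by
  have hq : (0 : ℝ) < q := by exact_mod_cast (by omega : 0 < q)
  have hp := Real.pi_pos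
  have a1 : (q : ℝ) ≤ 3 * (q / 2 : ℕ) := by exact_mod_cast (by omega : q ≤ 3 * (q / 2))
  have a2 : 2 * ((q / 2 : ℕ) : ℝ) ≤ q := by exact_mod_cast (by omega : 2 * (q / 2) ≤ q)
  have e : x = Real.pi * (((q / 2 : ℕ) : ℝ) / q) := by rw [hx]; rw [Int.cast_natCast]; ring
  have b1 : 1 / 3 ≤ ((q / 2 : ℕ) : ℝ) / q := by rw [le_div_iff₀ hq]; linarith
  have b2 : ((q / 2 : ℕ) : ℝ) / q ≤ 1 / 2 := by rw [div_le_iff₀ hq]; linarith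
  refine ⟨by rw [e]; nlinarith, by rw [e]; nlinarith, fun h3 => ?_⟩
  have a3 : 2 * (q : ℝ) ≤ 5 * (q / 2 : ℕ) := by exact_mod_cast (by omega : 2 * q ≤ 5 * (q / 2))
  have b3 : 2 / 5 ≤ ((q / 2 : ℕ) : ℝ) / q := by rw [le_div_iff₀ hq]; linarith
  rw [e]; nlinarith

lemma odd_survive {q : ℕ} (ho : ¬ 2 ∣ q) {t N : ℤ} (ht : ¬ (q : ℤ) ∣ t) {y : ℝ}
    (hy : y = Real.pi * ((q / 2 : ℕ) : ℤ) / q + N * Real.pi) : Real.sin (t * y) ≠ 0 := by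
  intro h
  obtain ⟨c, hc⟩ := Real.sin_eq_zero_iff.1 h
  have hq : (q : ℝ) ≠ 0 := by
    have : q ≠ 0 := by rintro rfl; simp at ho
    exact_mod_cast this
  have hp := Real.pi_ne_zero
  rw [hy] at hc
  field_simp at hc
  have hc' : c * q = t * (((q / 2 : ℕ) : ℤ) + q * N) := by
    have : (c * q : ℝ) = t * ((((q / 2 : ℕ) : ℤ) : ℝ) + q * N) := by
      first
      | linear_combination hc
      | (push_cast at hc ⊢; linear_combination hc)
    exact_mod_cast this
  have hcop : IsCoprime (q : ℤ) ((q / 2 : ℕ) : ℤ) := by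
    refine ⟨1, -2, ?_⟩
    have : 2 * (q / 2) + 1 = q := by omega
    have : 2 * ((q / 2 : ℕ) : ℤ) + 1 = q := by exact_mod_cast this
    linarith
  have : (q : ℤ) ∣ t * ((q / 2 : ℕ) : ℤ) := ⟨c - t * N, by linear_combination -hc'⟩
  exact ht (hcop.dvd_of_dvd_mul_right this)

lemma sgn_cases (N : ℤ) : ((-1 : ℝ) ^ N = 1 ∨ (-1 : ℝ) ^ N = -1) := by
  rcases Int.even_or_odd N with h | h
  · left; exact h.neg_one_zpow
  · right; exact h.neg_one_zpow

lemma sin_conds {x0 x1 x2 y0 y1 y2 : ℝ} {N0 N1 N2 : ℤ}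
    (h0 : y0 = x0 + N0 * Real.pi) (h1 : y1 = x1 + N1 * Real.pi) (h2 : y2 = x2 + N2 * Real.pi)
    (a0 : Real.pi / 3 ≤ x0 ∧ x0 ≤ Real.pi / 2) (a1 : Real.pi / 3 ≤ x1 ∧ x1 ≤ Real.pi / 2)
    (a2 : Real.pi / 3 ≤ x2 ∧ x2 ≤ Real.pi / 2) (hs : Real.pi < x0 + x1 + x2) :
    Real.sin (y0 + y1 + y2) * Real.sin (y0 + y1 - y2) < 0 ∧
    0 < Real.sin (y0 + y1 - y2) * Real.sin (y0 - y1 + y2) ∧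
    Real.sin (y0 - y1 + y2) * Real.sin (y0 - y1 - y2) < 0 := by
  have hp := Real.pi_pos
  have neg1 : ∀ N : ℤ, (-1 : ℝ) ^ (-N) = (-1) ^ N := by
    intro N; rw [zpow_neg, ← inv_zpow]; norm_num
  have key : ∀ (u : ℝ) (ε : ℝ) (M : ℤ), (u = ε + M * Real.pi) → Real.sin u = (-1) ^ M * Real.sin ε := by
    intro u ε M h; rw [h, Real.sin_add_int_mul_pi]
  have k1 := key (y0 + y1 + y2) (x0 + x1 + x2) (N0 + N1 + N2) (by rw [h0, h1, h2]; push_cast; ring)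
  have k2 := key (y0 + y1 - y2) (x0 + x1 - x2) (N0 + N1 + -N2) (by rw [h0, h1, h2]; push_cast; ring)
  have k3 := key (y0 - y1 + y2) (x0 - x1 + x2) (N0 + -N1 + N2) (by rw [h0, h1, h2]; push_cast; ring)
  have k4 := key (y0 - y1 - y2) (x0 - x1 - x2) (N0 + -N1 + -N2)
    (by rw [h0, h1, h2]; push_cast; ring)
  have hne : (-1 : ℝ) ≠ 0 := by norm_num
  simp only [zpow_add₀ hne, neg1] at k1 k2 k3 k4
  obtain ⟨σ, hσ⟩ : ∃ σ : ℝ, σ = (-1) ^ N0 * (-1) ^ N1 * (-1) ^ N2 := ⟨_, rfl⟩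
  rw [← hσ] at k1 k2 k3 k4
  have hσ2 : σ * σ = 1 := by
    rw [hσ]
    rcases sgn_cases N0 with e | e <;> rcases sgn_cases N1 with e' | e' <;>
      rcases sgn_cases N2 with e'' | e'' <;> rw [e, e', e''] <;> norm_num
  have s1 : Real.sin (x0 + x1 + x2) < 0 := by
    have : 0 < Real.sin (x0 + x1 + x2 - Real.pi) :=
      Real.sin_pos_of_pos_of_lt_pi (by linarith) (by linarith)
    rw [Real.sin_sub_pi] at this; linarith
  have s2 : 0 < Real.sin (x0 + x1 - x2) :=
    Real.sin_pos_of_pos_of_lt_pi (by linarith) (by linarith)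
  have s3 : 0 < Real.sin (x0 - x1 + x2) :=
    Real.sin_pos_of_pos_of_lt_pi (by linarith) (by linarith)
  have s4 : Real.sin (x0 - x1 - x2) < 0 :=
    Real.sin_neg_of_neg_of_neg_pi_lt (by linarith) (by linarith)
  have mm : ∀ a b : ℝ, (σ * a) * (σ * b) = a * b := by
    intro a b; linear_combination a * b * hσ2
  rw [k1, k2, k3, k4, mm, mm, mm]
  exact ⟨mul_neg_of_neg_of_pos s1 s2, mul_pos s2 s3, mul_neg_of_pos_of_neg s3 s4⟩

theorem main {G : Fin 3 → Type*} [∀ i, Group (G i)] [∀ i, IsCyclic (G i)]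
    (w : Monoid.CoprodI G) (g : ∀ i, G i) (hg1 : ∀ i, g i ≠ 1)
    (hgw : ∀ i, (Monoid.CoprodI.of (g i) : Monoid.CoprodI G) ∈ Subgroup.normalClosure {w}) :
    False := by
  classical
  choose a ha using fun i => IsCyclic.exists_generator (α := G i)
  let P : FreeGroup (Fin 3) →* Monoid.CoprodI G := FreeGroup.lift fun i => Monoid.CoprodI.of (a i)
  have hP : ∀ v, ∃ u, P u = v := by
    intro v
    induction v using Monoid.CoprodI.induction_on with
    | one => exact ⟨1, map_one _⟩
    | of i m =>
      obtain ⟨k, hk⟩ := Subgroup.mem_zpowers_iff.1 (ha i m)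
      refine ⟨FreeGroup.of i ^ k, ?_⟩
      rw [map_zpow, ← hk, map_zpow]
      simp [P]
    | mul x y hx hy =>
      obtain ⟨u, rfl⟩ := hx
      obtain ⟨v, rfl⟩ := hy
      exact ⟨u * v, map_mul _ _ _⟩
  obtain ⟨u, hu⟩ := hP w
  -- abelianisation
  let Q : Monoid.CoprodI G →* (∀ i, G i) := Monoid.CoprodI.lift fun i => MonoidHom.mulSingle G i
  have hQ : ∀ i, Q w i = a i ^ es i u := by
    intro i
    have : ((Pi.evalMonoidHom G i).comp Q).comp P = (zpowersHom (G i) (a i)).comp (ex i) := by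
      ext1 j
      by_cases h : j = i
      · subst h; simp [P, Q, ex]
      · simp [P, Q, ex, h, Pi.mulSingle_eq_of_ne (Ne.symm h)]
    have := DFunLike.congr_fun this u
    rw [← hu]
    exact this
  have hcomm : ∀ x y : (∀ i, G i), x * y = y * x := by
    intro x y
    funext i
    obtain ⟨k, hk⟩ := Subgroup.mem_zpowers_iff.1 (ha i (x i))
    obtain ⟨l, hl⟩ := Subgroup.mem_zpowers_iff.1 (ha i (y i))
    rw [Pi.mul_apply, Pi.mul_apply, ← hk, ← hl, ← zpow_add, ← zpow_add, add_comm]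
  have hnorm : (Subgroup.zpowers (Q w)).Normal :=
    ⟨fun n hn x => by rw [hcomm x n, mul_inv_cancel_right]; exact hn⟩
  have hle : Subgroup.normalClosure {w} ≤ (Subgroup.zpowers (Q w)).comap Q := by
    apply Subgroup.normalClosure_le_normal
    intro x hx
    rw [Set.mem_singleton_iff] at hx
    subst hx
    exact Subgroup.mem_zpowers _
  have ht : ∀ i, ∃ t : ℤ, ∀ j, (a j ^ es j u) ^ t = Pi.mulSingle (M := G) i (g i) j := by
    intro i
    obtain ⟨t, ht⟩ := Subgroup.mem_zpowers_iff.1 (Subgroup.mem_comap.1 (hle (hgw i)))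
    refine ⟨t, fun j => ?_⟩
    rw [← hQ, ← Pi.pow_apply, ht]
    simp [Q]
  choose t ht using ht
  have hself : ∀ i, (a i ^ es i u) ^ t i = g i := by
    intro i; rw [ht]; simp
  have hother : ∀ i j, j ≠ i → (a j ^ es j u) ^ t i = 1 := by
    intro i j h; rw [ht]; exact Pi.mulSingle_eq_of_ne h _
  have hnd : ∀ i, ¬ (orderOf (a i ^ es i u) : ℤ) ∣ t i := by
    intro i h
    rw [orderOf_dvd_iff_zpow_eq_one, hself] at h
    exact hg1 i h
  choose p k hp hpk hpt using fun i => exists_prime_pow (hnd i)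
  have hk0 : ∀ i, k i ≠ 0 := by
    intro i h
    apply hpt i
    simp [h]
  have hpne : ∀ i j, i ≠ j → p i ≠ p j := by
    have aux : ∀ i j, i ≠ j → p i = p j → k j < k i := by
      intro i j hij h
      by_contra hlt
      apply hpt i
      have h1 : (p i) ^ (k i) ∣ (p j) ^ (k j) := by
        rw [h]; exact pow_dvd_pow _ (not_lt.1 hlt)
      have h2 : (orderOf (a j ^ es j u) : ℤ) ∣ t i :=
        orderOf_dvd_iff_zpow_eq_one.2 (hother i j (Ne.symm hij))
      exact (Int.natCast_dvd_natCast.2 (h1.trans (hpk j))).trans h2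
    intro i j hij h
    have := aux i j hij h
    have := aux j i (Ne.symm hij) h.symm
    omega
  let q : Fin 3 → ℕ := fun i => p i ^ k i
  have hq2 : ∀ i, 2 ≤ q i := fun i =>
    (hp i).two_le.trans (Nat.le_self_pow (hk0 i) _)
  have hcop : ∀ i j, i ≠ j → Nat.Coprime (q i) (q j) := fun i j h =>
    Nat.Coprime.pow _ _ ((Nat.coprime_primes (hp i) (hp j)).2 (hpne i j h))
  have hne3 : ∀ i j, i ≠ j → q i = 3 → q j ≠ 3 := by
    intro i j h h1 h2
    have := hcop i j h
    rw [h1, h2] at this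
    norm_num at this
  choose α hα1 N hαN using fun i => exists_char (a i) (es i u) (((q i) / 2 : ℕ) : ℤ) (q i)
    (by have := hq2 i; omega) (hpk i)
  have B := fun i => half_bounds (hq2 i) rfl
  have hsum : Real.pi < Real.pi * ((q 0 / 2 : ℕ) : ℤ) / q 0 + Real.pi * ((q 1 / 2 : ℕ) : ℤ) / q 1
      + Real.pi * ((q 2 / 2 : ℕ) : ℤ) / q 2 := by
    obtain ⟨b0, -, c0⟩ := B 0
    obtain ⟨b1, -, c1⟩ := B 1
    obtain ⟨b2, -, c2⟩ := B 2
    have hpi := Real.pi_pos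
    by_cases h0 : q 0 = 3
    · have := c1 (hne3 0 1 (by decide) h0)
      have := c2 (hne3 0 2 (by decide) h0)
      linarith
    · have := c0 h0
      linarith
  obtain ⟨s12, s23, s34⟩ := sin_conds (hαN 0) (hαN 1) (hαN 2) ⟨(B 0).1, (B 0).2.1⟩
    ⟨(B 1).1, (B 1).2.1⟩ ⟨(B 2).1, (B 2).2.1⟩ hsum
  obtain ⟨x, xI, xJ, xK⟩ := exists_solution α u s12 s23 s34
  -- the representation
  have hord : ∀ i, orderOf (MulAut.conj (gens α x i)) ∣ orderOf (a i) := by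
    intro i
    apply orderOf_dvd_of_pow_eq_one
    obtain ⟨M, hM⟩ := hα1 i (orderOf (a i) : ℤ) (by rw [zpow_natCast, pow_orderOf_eq_one])
    have := (gens_zpow α x i (orderOf (a i) : ℤ)).2 (by rw [hM]; exact conj_ek_pi M)
    rw [zpow_natCast, map_pow] at this
    exact this
  let ψ : ∀ i, G i →* MulAut U := fun i => monoidHomOfForallMemZpowers (ha i) (hord i)
  have hψ : ∀ i, ψ i (a i) = MulAut.conj (gens α x i) := fun i =>
    monoidHomOfForallMemZpowers_apply_gen (ha i) (hord i)
  let Ψ : Monoid.CoprodI G →* MulAut U := Monoid.CoprodI.lift ψ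
  have hΨ : Ψ.comp P = (MulAut.conj : U →* MulAut U).comp (FreeGroup.lift (gens α x)) := by
    ext1 i
    simp [Ψ, P, hψ]
  have hw : Ψ w = 1 := by
    rw [← hu]
    have := DFunLike.congr_fun hΨ u
    exact this.trans (conj_eq_one_of_im xI xJ xK)
  have hker : Subgroup.normalClosure {w} ≤ Ψ.ker := by
    apply Subgroup.normalClosure_le_normal
    intro y hy
    rw [Set.mem_singleton_iff] at hy
    subst hy
    exact hw
  have hsin : ∀ i, Real.sin (t i * (es i u * α i)) = 0 := by
    intro i
    have h1 : Ψ (Monoid.CoprodI.of (g i)) = 1 := hker (hgw i)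
    have h2 : ψ i (g i) = 1 := by simpa [Ψ] using h1
    rw [← hself, ← zpow_mul, map_zpow, hψ, ← map_zpow, gens_zpow] at h2
    have := sin_of_conj h2
    rw [← this]
    congr 1
    push_cast; ring
  have hev : ¬ 2 ∣ q 0 ∨ ¬ 2 ∣ q 1 := by
    by_contra h
    push Not at h
    have := Nat.dvd_gcd h.1 h.2
    rw [hcop 0 1 (by decide)] at this
    omega
  rcases hev with h | h
  · exact odd_survive h (hpt 0) (hαN 0) (hsin 0)
  · exact odd_survive h (hpt 1) (hαN 1) (hsin 1)

end
end Freih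

/-- **Corollary 4.2 (Chinyere–Howie).** Any one-relator product of three nontrivial cyclic
groups contains a Freiheitssatz factor: at least one of the natural maps from the factors
into the quotient is injective. -/
theorem one_relator_product_of_three_cyclics_has_freiheitssatz_factor
    {G : Fin 3 → Type*} [∀ i, Group (G i)] [∀ i, Nontrivial (G i)] [∀ i, IsCyclic (G i)]
    (w : Monoid.CoprodI G) :
    ∃ i : Fin 3,
      Function.Injective
        ((QuotientGroup.mk' (Subgroup.normalClosure {w})).comp
          (Monoid.CoprodI.of : G i →* Monoid.CoprodI G)) := by
  by_contra hcon
  push Not at hcon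
  have h : ∀ i, ∃ g : G i, g ≠ 1 ∧
      (Monoid.CoprodI.of g : Monoid.CoprodI G) ∈ Subgroup.normalClosure {w} := by
    intro i
    have := hcon i
    rw [injective_iff_map_eq_one] at this
    push Not at this
    obtain ⟨g, h1, h2⟩ := this
    refine ⟨g, h2, ?_⟩
    rwa [MonoidHom.comp_apply, QuotientGroup.mk'_apply, QuotientGroup.eq_one_iff] at h1
  choose g h1 h2 using h
  exact Freih.main w g h1 h2
end
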